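/- The generating series G^{(α)}(t,p,q,r) satisfies the differential equation (B_∞^{(α)}(−t,q,u) + B_∞^{(α)}(−t,r,u)) · G^{(α)}(t,p,q,r) = B_∞^{(α)⊥}(−t,p,u) · G^{(α)}(t,p,q,r), as an identity in A⟦u⟧, where B_∞^{(α)}(−t,q,u) (resp. B_∞^{(α)}(−t,r,u)) acts on the alphabet q (resp. r) and B_∞^{(α)⊥}(−t,p,u) is the adjoint of B_∞^{(α)}(−t,p,u) with respect to the α-deformed Hall scalar product in the p variables. -/

import Mathlib

open scoped Classical

noncomputable section

/-- The base field `ℚ(α)` of rational functions in the Jack parameter `α`. -/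
abbrev F : Type := RatFunc ℚ

/-- The Jack deformation parameter `α`. -/
def alpha : F := RatFunc.X

/-- An integer partition, encoded as a multiset of positive integers (its parts). -/
abbrev JPartition : Type := Multiset ℕ+

/-- The size `|λ|` of a partition. -/
def psize (l : JPartition) : ℕ := (l.map fun i => (i : ℕ)).sum

/-- The length `ℓ(λ)` of a partition. -/
def plen (l : JPartition) : ℕ := Multiset.card l

/-- `m_i(λ)`, the number of parts of `λ` equal to `i`. -/
def pmult (l : JPartition) (i : ℕ+) : ℕ := Multiset.count i l

/-- `λ ∪ 1^k`, adjoining `k` parts equal to `1`. -/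
def addOnes (l : JPartition) (k : ℕ) : JPartition := l + Multiset.replicate k 1

/-- `λ̃`, the partition obtained by deleting all parts equal to `1`. -/
def removeOnes (l : JPartition) : JPartition := Multiset.filter (fun i => i ≠ 1) l

/-- Exponent vectors of monomials in the power-sum generators `p₁, p₂, …`. -/
abbrev Exp : Type := ℕ+ →₀ ℕ

/-- The exponent vector of the monomial `p_λ`. -/
def toExp (l : JPartition) : Exp := l.toFinset.sum fun i => Finsupp.single i (Multiset.count i l)

/-- The partition corresponding to an exponent vector. -/
def toPart (m : Exp) : JPartition := m.sum fun i k => Multiset.replicate k i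

/-- The weighted degree (`deg p_i = i`) of an exponent vector; this is the size of the
corresponding partition. -/
def wt (m : Exp) : ℕ := m.sum fun i k => k * (i : ℕ)

/-- The algebra `ℚ(α)[p₁, p₂, …]` of symmetric functions written in the power-sum basis. -/
abbrev SymA : Type := MvPolynomial ℕ+ F

/-- The power-sum monomial `p_λ`. -/
def pPow (l : JPartition) : SymA := (l.map fun i => MvPolynomial.X i).prod

/-- `z_λ α^{ℓ(λ)}`, attached to the exponent vector of `p_λ`. -/
def zalpha (m : Exp) : F :=
  algebraMap ℚ F (m.prod fun i k => (Nat.factorial k : ℚ) * ((i : ℕ) : ℚ) ^ k) *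
    alpha ^ (m.sum fun _ k => k)

/-- The `α`-deformed Hall scalar product: `⟨p_λ, p_μ⟩ = δ_{λμ} z_λ α^{ℓ(λ)}`. -/
def hall (f g : SymA) : F :=
  ∑ m ∈ f.support, MvPolynomial.coeff m f * MvPolynomial.coeff m g * zalpha m

/-- The parts of a partition, sorted in weakly decreasing order. -/
def sortedParts (l : JPartition) : List ℕ := ((l.map fun i => (i : ℕ)).sort (· ≤ ·)).reverse

/-- The sum of the `k` largest parts of a partition. -/
def topSum (l : JPartition) (k : ℕ) : ℕ := ((sortedParts l).take k).sum

/-- The dominance order on partitions: `μ ⊴ λ`. -/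
def dominates (mu lam : JPartition) : Prop :=
  psize mu = psize lam ∧ ∀ k, topSum mu k ≤ topSum lam k

/-- Evaluation of a symmetric function (in power-sum coordinates) in `N` variables
`x₁, …, x_N`: it sends `p_i ↦ x₁^i + ⋯ + x_N^i`. -/
def evalN (N : ℕ) : SymA →ₐ[F] MvPolynomial (Fin N) F :=
  MvPolynomial.aeval fun i : ℕ+ => ∑ j : Fin N, MvPolynomial.X j ^ (i : ℕ)

/-- The exponent of the monomial `x₁^{μ₁} ⋯ x_s^{μ_s}` in `N` variables, for `μ` a
partition; its coefficient in a symmetric polynomial is the coefficient of the monomial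
symmetric function `m_μ` (provided `N ≥ ℓ(μ)`). -/
def xexp (mu : JPartition) (N : ℕ) : Fin N →₀ ℕ :=
  Finsupp.equivFunOnFinite.symm fun j => (sortedParts mu).getD (j : ℕ) 0

/-- The defining properties of the family of Jack polynomials `J_λ^{(α)}` (Macdonald's
characterization): orthogonality for the `α`-deformed Hall product, triangularity with
respect to monomial symmetric functions in dominance order, and normalization
`[p_{1^n}] J_λ^{(α)} = 1`. -/
structure IsJackFamily (J : JPartition → SymA) : Prop where
  orthogonal : ∀ l m : JPartition, l ≠ m → hall (J l) (J m) = 0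
  triangular : ∀ l m : JPartition, ¬ dominates m l →
    MvPolynomial.coeff (xexp m (psize l + psize m + plen m))
      (evalN (psize l + psize m + plen m) (J l)) = 0
  normalized : ∀ l : JPartition, MvPolynomial.coeff (Finsupp.single 1 (psize l)) (J l) = 1

/-- The Jack character `θ_μ^{(α)}(λ)`. -/
def theta (J : JPartition → SymA) (mu lam : JPartition) : F :=
  if psize lam < psize mu then 0
  else (Nat.choose (psize lam - psize mu + pmult mu 1) (pmult mu 1) : F) *
    MvPolynomial.coeff (toExp (addOnes mu (psize lam - psize mu))) (J lam)

/-- `g` is the family of structure coefficients of Jack characters: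
`θ_μ^{(α)} θ_ν^{(α)} = ∑_π g^π_{μ,ν}(α) θ_π^{(α)}` (as functions on Young diagrams,
with finitely many nonzero terms). -/
def IsStructCoeffs (J : JPartition → SymA) (g : JPartition → JPartition → JPartition → F) :
    Prop :=
  (∀ mu nu : JPartition, {pi : JPartition | g pi mu nu ≠ 0}.Finite) ∧
  ∀ mu nu lam : JPartition,
    theta J mu lam * theta J nu lam = ∑ᶠ pi : JPartition, g pi mu nu * theta J pi lam


/-- The polynomial algebra `ℚ(α)[p₁,p₂,…][y₀,y₁,…]` containing the catalytic variables. -/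
abbrev PY : Type := MvPolynomial (ℕ+ ⊕ ℕ) F

/-- The variable `p_i` inside `PY`. -/
def pv (i : ℕ+) : PY := MvPolynomial.X (Sum.inl i)

/-- The catalytic variable `y_j` inside `PY`. -/
def yv (j : ℕ) : PY := MvPolynomial.X (Sum.inr j)

/-- The operator `Y₊ = ∑_{i≥0} y_{i+1} ∂/∂y_i`. -/
def Yplus (f : PY) : PY := ∑ᶠ j : ℕ, yv (j + 1) * MvPolynomial.pderiv (Sum.inr j) f

/-- The operator
`Γ_Y = (1+b) ∑_{i,j≥1} y_{i+j} j ∂²/(∂y_{i-1}∂p_j) + ∑_{i,j≥1} y_i p_j ∂/∂y_{i+j-1}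
      + b ∑_{i≥1} y_{i+1} i ∂/∂y_i`, with `b = α - 1`. -/
def GammaY (f : PY) : PY :=
  alpha • (∑ᶠ i : ℕ+, ∑ᶠ j : ℕ+, ((j : ℕ) : F) •
      (yv ((i : ℕ) + (j : ℕ)) *
        MvPolynomial.pderiv (Sum.inl j) (MvPolynomial.pderiv (Sum.inr ((i : ℕ) - 1)) f)))
  + (∑ᶠ i : ℕ+, ∑ᶠ j : ℕ+,
      yv (i : ℕ) * pv j * MvPolynomial.pderiv (Sum.inr ((i : ℕ) + (j : ℕ) - 1)) f)
  + (alpha - 1) • (∑ᶠ i : ℕ+, ((i : ℕ) : F) •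
      (yv ((i : ℕ) + 1) * MvPolynomial.pderiv (Sum.inr (i : ℕ)) f))

/-- The operator `Θ_Y = ∑_{i≥1} p_i ∂/∂y_i`. -/
def ThetaY (f : PY) : PY := ∑ᶠ i : ℕ+, pv i * MvPolynomial.pderiv (Sum.inr (i : ℕ)) f

/-- Ordered composite of the operators `Y₊` (for `true`) and `Γ_Y` (for `false`). -/
def wordOp : List Bool → PY → PY
  | [], f => f
  | b :: w, f => (if b then Yplus else GammaY) (wordOp w f)

/-- Projection `PY → SymA` killing the catalytic variables. -/
def dropY : PY →ₐ[F] SymA :=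
  MvPolynomial.aeval fun v => match v with
    | Sum.inl i => MvPolynomial.X i
    | Sum.inr _ => 0

/-- `Bc n ℓ` is the coefficient of `u^ℓ` in the operator
`B_n^{(α)}(p, u) = Θ_Y (Γ_Y + u Y₊)^n (y₀ / (1+b))`, viewed as an operator on `ℚ(α)[p]`. -/
def Bc (n ℓ : ℕ) (f : SymA) : SymA :=
  dropY (ThetaY (∑ s ∈ Finset.univ.filter
      (fun s : Fin n → Bool => (Finset.univ.filter fun i => s i = true).card = ℓ),
    wordOp (List.ofFn s) (alpha⁻¹ • (yv 0 * MvPolynomial.rename Sum.inl f))))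

/-- Matrix entries of `Bc n ℓ` in the basis of power-sum monomials. -/
def Bmat (n ℓ : ℕ) (m m' : Exp) : F :=
  MvPolynomial.coeff m (Bc n ℓ (MvPolynomial.monomial m' 1))

/-- The adjoint of `Bc n ℓ` with respect to the `α`-deformed Hall scalar product
(`⟨Bperp f, g⟩ = ⟨f, Bc g⟩`), given by its matrix in the power-sum basis. -/
def Bperp (n ℓ : ℕ) (f : SymA) : SymA :=
  ∑ m' ∈ f.support, MvPolynomial.coeff m' f •
    ∑ᶠ m : Exp, (Bmat n ℓ m' m * zalpha m' / zalpha m) • (MvPolynomial.monomial m (1 : F))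



/-- The coefficient of `q_μ r_ν t^k` in the generating series
`G^{(α)}(t,p,q,r) = ∑_{π,μ,ν} (g^π_{μ,ν}(α)/(z_π α^{ℓ(π)})) t^{|μ|+|ν|-|π|} p_π q_μ r_ν`,
an element of `ℚ(α)[p]`. -/
def Gcoef (g : JPartition → JPartition → JPartition → F) (mu nu : JPartition) (k : ℕ) :
    SymA :=
  ∑ᶠ pi : JPartition, if psize pi + k = psize mu + psize nu
    then (g pi mu nu / zalpha (toExp pi)) • pPow pi else 0


set_option linter.unusedSimpArgs false

namespace JK

/-- Polynomials in one catalytic variable `z` over `SymA`; `z ^ k` plays the role of `y_k`. -/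
abbrev ZA : Type := Polynomial SymA

open Finset.HasAntidiagonal (antidiagonal)

/-- `p_k`, with the convention `p_0 = 0`. -/
def pp (k : ℕ) : SymA := if h : 0 < k then MvPolynomial.X (⟨k, h⟩ : ℕ+) else 0

@[simp] lemma pp_zero : pp 0 = 0 := by simp [pp]

lemma pp_pnat (k : ℕ+) : pp (k : ℕ) = MvPolynomial.X k := by
  simp only [pp, k.pos, dif_pos]
  rfl

/-- constants -/
abbrev cF (a : F) : SymA := MvPolynomial.C a

lemma alpha_ne : alpha ≠ 0 := RatFunc.X_ne_zero

/-- The derivation `f ↦ ∑ z^j p_j^⊥ f`. -/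
def V : Derivation F SymA ZA :=
  MvPolynomial.mkDerivation F fun j : ℕ+ =>
    Polynomial.monomial (j : ℕ) (MvPolynomial.C (alpha * ((j : ℕ) : F)))

lemma V_pp (k : ℕ) : V (pp k) = Polynomial.monomial k (cF (alpha * (k : F))) := by
  by_cases h : 0 < k
  · obtain ⟨k', rfl⟩ : ∃ k' : ℕ+, (k' : ℕ) = k := ⟨⟨k, h⟩, rfl⟩
    rw [pp_pnat, V, MvPolynomial.mkDerivation_X]
  · have : k = 0 := by omega
    subst this
    simp

lemma V_mul (f g : SymA) : V (f * g) = Polynomial.C f * V g + Polynomial.C g * V f := by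
  rw [Derivation.leibniz, Polynomial.smul_eq_C_mul, Polynomial.smul_eq_C_mul]

@[simp] lemma V_C (a : F) : V (MvPolynomial.C a) = 0 := by
  exact V.map_algebraMap a

@[simp] lemma V_one : V 1 = 0 := V.map_one_eq_zero

/-- monomials as `F`-linear maps -/
def mon (k : ℕ) : SymA →ₗ[F] ZA := (Polynomial.monomial k).restrictScalars F

@[simp] lemma mon_apply (k : ℕ) (f : SymA) : mon k f = Polynomial.monomial k f := rfl

lemma zext {M : Type*} [AddCommMonoid M] [Module F M] {S T : ZA →ₗ[F] M}
    (h : ∀ k f, S (Polynomial.monomial k f) = T (Polynomial.monomial k f)) : S = T := by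
  ext x
  induction x using Polynomial.induction_on' with
  | add p q hp hq => rw [map_add, map_add, hp, hq]
  | monomial n a => exact h n a

/-- an induction principle for `ZA` -/
lemma zind {P : ZA → Prop} (hadd : ∀ x y, P x → P y → P (x + y))
    (hm : ∀ k f, P (Polynomial.monomial k f)) (x : ZA) : P x := by
  induction x using Polynomial.induction_on' with
  | add p q hp hq => exact hadd _ _ hp hq
  | monomial n a => exact hm n a

/-- `ρ (z^k f) = p_k f` -/
def rho : ZA →ₗ[F] SymA := Polynomial.lsum fun k => LinearMap.mulLeft F (pp k)

@[simp] lemma rho_mon (k : ℕ) (f : SymA) : rho (Polynomial.monomial k f) = pp k * f := by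
  simp [rho, Polynomial.lsum_apply, Polynomial.sum_monomial_index]

@[simp] lemma rho_C (f : SymA) : rho (Polynomial.C f) = 0 := by
  rw [← Polynomial.monomial_zero_left, rho_mon, pp_zero, zero_mul]

lemma rho_C_mul (f : SymA) (x : ZA) : rho (Polynomial.C f * x) = f * rho x := by
  induction x using zind with
  | hadd x y hx hy => rw [mul_add, map_add, map_add, hx, hy, mul_add]
  | hm k g => rw [Polynomial.C_mul_monomial, rho_mon, rho_mon]; ring

/-- The Lax operator. -/
def L : ZA →ₗ[F] ZA := Polynomial.lsum fun k =>
  (LinearMap.mulLeft F (Polynomial.X ^ k : ZA)) ∘ₗ (V : SymA →ₗ[F] ZA)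
    + (∑ x ∈ antidiagonal k, mon x.1 ∘ₗ LinearMap.mulLeft F (pp x.2))
    + ((alpha - 1) * (k : F)) • mon k

lemma L_mon (k : ℕ) (f : SymA) : L (Polynomial.monomial k f) =
    Polynomial.X ^ k * V f + (∑ x ∈ antidiagonal k, Polynomial.monomial x.1 (pp x.2 * f))
    + ((alpha - 1) * (k : F)) • Polynomial.monomial k f := by
  simp [L, Polynomial.lsum_apply, Polynomial.sum_monomial_index]

/-- The operator `R`. -/
def R : ZA →ₗ[F] ZA := Polynomial.lsum fun k =>
  (k : F) • ((LinearMap.mulLeft F (Polynomial.X ^ k : ZA)) ∘ₗ (V : SymA →ₗ[F] ZA))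
    + (∑ x ∈ antidiagonal k, (x.1 : F) • (mon x.1 ∘ₗ LinearMap.mulLeft F (pp x.2)))
    + ((alpha - 1) * (k : F) * ((k : F) - 1) / 2) • mon k

lemma R_mon (k : ℕ) (f : SymA) : R (Polynomial.monomial k f) =
    (k : F) • (Polynomial.X ^ k * V f)
    + (∑ x ∈ antidiagonal k, (x.1 : F) • Polynomial.monomial x.1 (pp x.2 * f))
    + ((alpha - 1) * (k : F) * ((k : F) - 1) / 2) • Polynomial.monomial k f := by
  simp [R, Polynomial.lsum_apply, Polynomial.sum_monomial_index]

@[simp] lemma L_C (f : SymA) : L (Polynomial.C f) = V f := by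
  rw [← Polynomial.monomial_zero_left, L_mon]; simp

@[simp] lemma R_C (f : SymA) : R (Polynomial.C f) = 0 := by
  rw [← Polynomial.monomial_zero_left, R_mon]; simp

/-- The Laplace--Beltrami operator. -/
def D : SymA →ₗ[F] SymA :=
  (2 * alpha)⁻¹ • (rho ∘ₗ (L - (alpha - 1) • LinearMap.id) ∘ₗ (V : SymA →ₗ[F] ZA))

lemma D_apply (f : SymA) : D f = (2 * alpha)⁻¹ • (rho (L (V f)) - (alpha - 1) • rho (V f)) := by
  simp [D]

/-- `D` acting coefficientwise -/
def Dc : ZA →ₗ[F] ZA := Polynomial.lsum fun k => mon k ∘ₗ D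

@[simp] lemma Dc_mon (k : ℕ) (f : SymA) :
    Dc (Polynomial.monomial k f) = Polynomial.monomial k (D f) := by
  simp [Dc, Polynomial.lsum_apply, Polynomial.sum_monomial_index]

/-- The lifted Laplace--Beltrami operator. -/
def Dt : ZA →ₗ[F] ZA := Dc + R

lemma Dt_mon (k : ℕ) (f : SymA) :
    Dt (Polynomial.monomial k f) = Polynomial.monomial k (D f) + R (Polynomial.monomial k f) := by
  simp [Dt]

lemma smul_eq_cF (a : F) (f : SymA) : a • f = cF a * f := MvPolynomial.smul_eq_C_mul f a

lemma smul_eq_CcF (a : F) (x : ZA) : a • x = Polynomial.C (cF a) * x := by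
  rw [← Polynomial.smul_eq_C_mul]
  ext n : 1
  simp [MvPolynomial.smul_eq_C_mul]

lemma L_C_mul (f : SymA) (x : ZA) : L (Polynomial.C f * x) = Polynomial.C f * L x + V f * x := by
  induction x using zind with
  | hadd x y hx hy => rw [mul_add, map_add, map_add, hx, hy]; ring
  | hm k g =>
    rw [Polynomial.C_mul_monomial, L_mon, L_mon, V_mul]
    simp only [smul_eq_CcF, mul_add, Finset.mul_sum, Polynomial.C_mul_monomial]
    simp only [← Polynomial.C_mul_X_pow_eq_monomial, map_mul]
    simp only [mul_left_comm (Polynomial.C f)]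
    ring

lemma L_X_mul (x : ZA) : L (Polynomial.X * x) = Polynomial.X * L x
    + (alpha - 1) • (Polynomial.X * x) + Polynomial.C (rho (Polynomial.X * x)) := by
  induction x using zind with
  | hadd x y hx hy => simp only [mul_add, map_add, hx, hy, smul_add]; ring
  | hm k g =>
    rw [Polynomial.X_mul_monomial, L_mon, L_mon, rho_mon, Finset.Nat.antidiagonal_succ]
    simp only [Finset.sum_cons, Finset.sum_map, mul_add, Finset.mul_sum, smul_eq_CcF]
    simp only [Function.Embedding.prodMap, Function.Embedding.coeFn_mk, Prod.map,
      Polynomial.X_mul_monomial, Polynomial.monomial_zero_left, Function.Embedding.refl_apply]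
    simp only [← Polynomial.C_mul_X_pow_eq_monomial, map_mul, map_add, Nat.cast_succ, map_one,
      mul_one, cF]
    simp only [mul_left_comm (Polynomial.X : ZA)]
    simp only [Nat.succ_eq_add_one, pow_succ]
    ring

lemma Dt_C (f : SymA) : Dt (Polynomial.C f) = Polynomial.C (D f) := by
  rw [← Polynomial.monomial_zero_left, Dt_mon]
  simp

lemma Dt_X_mul (x : ZA) : Dt (Polynomial.X * x) = Polynomial.X * Dt x + Polynomial.X * L x := by
  induction x using zind with
  | hadd x y hx hy => simp only [mul_add, map_add, hx, hy]; ring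
  | hm k g =>
    rw [Polynomial.X_mul_monomial, Dt_mon, Dt_mon, L_mon, R_mon, R_mon,
      Finset.Nat.antidiagonal_succ]
    simp only [Finset.sum_cons, Finset.sum_map, mul_add, Finset.mul_sum, smul_eq_CcF]
    simp only [Function.Embedding.prodMap, Function.Embedding.coeFn_mk, Prod.map,
      Polynomial.X_mul_monomial, Polynomial.monomial_zero_left, Function.Embedding.refl_apply]
    simp only [mul_left_comm (Polynomial.X : ZA), Polynomial.X_mul_monomial]
    have e1 : (alpha - 1) * ((Nat.succ k : ℕ) : F) * (((Nat.succ k : ℕ) : F) - 1) / 2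
        = (alpha - 1) * (k : F) * ((k : F) - 1) / 2 + (alpha - 1) * (k : F) := by
      push_cast; ring
    rw [e1]
    simp only [Nat.cast_succ, Nat.cast_zero, map_zero, zero_mul, zero_add, cF, map_add, map_one,
      add_mul, Finset.sum_add_distrib, one_mul]
    simp only [Nat.succ_eq_add_one, pow_succ]
    ring

lemma D_mul (f h : SymA) : D (f * h) = f * D h + h * D f + alpha⁻¹ • rho (V f * V h) := by
  simp only [D_apply, V_mul, map_add, L_C_mul, rho_C_mul, mul_comm (V h) (V f)]
  simp only [smul_eq_cF, mul_inv, map_mul]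
  have h2 : (cF (2⁻¹) : SymA) * 2 = 1 := by
    have : (2 : SymA) = cF 2 := (map_ofNat MvPolynomial.C 2).symm
    rw [this, cF, ← map_mul]; norm_num
  linear_combination (cF alpha⁻¹ * rho (V f * V h)) * h2

lemma D_pp (k : ℕ) : D (pp k) = ((k : F) / 2) •
    ((∑ x ∈ antidiagonal k, pp x.1 * pp x.2) + ((alpha - 1) * ((k : F) - 1)) • pp k) := by
  rw [D_apply, V_pp, L_mon]
  simp only [map_add, map_sum, rho_mon, V_C, mul_zero, map_zero, zero_add, map_smul]
  simp only [smul_eq_cF, mul_add, Finset.mul_sum, mul_sub]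
  have e : (2 * alpha)⁻¹ * (alpha * (k : F)) = (k : F) / 2 := by
    have := alpha_ne
    field_simp
  rw [← e]
  simp only [map_mul, map_sub, map_one, cF]
  rw [add_sub_assoc]
  congr 1
  · refine Finset.sum_congr rfl fun x _ => by ring
  · ring

lemma rho_Dt (x : ZA) : rho (Dt x) = D (rho x) := by
  induction x using zind with
  | hadd x y hx hy => simp only [map_add, hx, hy]
  | hm k g =>
    rw [Dt_mon, R_mon, rho_mon, D_mul, D_pp, V_pp]
    simp only [map_add, map_sum, rho_mon, map_smul]
    rw [← Polynomial.C_mul_X_pow_eq_monomial,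
      mul_assoc (Polynomial.C (cF (alpha * (k : F)))), rho_C_mul]
    have hs : ∑ x ∈ antidiagonal k, (x.1 : F) • (pp x.1 * (pp x.2 * g))
        = ((k : F) / 2) • ((∑ x ∈ antidiagonal k, pp x.1 * pp x.2) * g) := by
      have h1 : ∑ x ∈ antidiagonal k, (x.1 : F) • (pp x.1 * (pp x.2 * g))
        = ∑ x ∈ antidiagonal k, (x.2 : F) • (pp x.1 * (pp x.2 * g)) := by
        rw [← Finset.Nat.sum_antidiagonal_swap]
        refine Finset.sum_congr rfl fun x _ => ?_
        simp only [Prod.fst_swap, Prod.snd_swap]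
        congr 1; ring
      have h2 : (2 : F) • (∑ x ∈ antidiagonal k, (x.1 : F) • (pp x.1 * (pp x.2 * g)))
          = (k : F) • ((∑ x ∈ antidiagonal k, pp x.1 * pp x.2) * g) := by
        rw [two_smul]
        nth_rewrite 2 [h1]
        rw [← Finset.sum_add_distrib, Finset.sum_mul, Finset.smul_sum]
        refine Finset.sum_congr rfl fun x hx => ?_
        rw [← add_smul, ← Nat.cast_add, Finset.HasAntidiagonal.mem_antidiagonal.1 hx, mul_assoc]
      rw [div_eq_inv_mul, mul_smul, ← h2, smul_smul]
      norm_num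
    rw [hs]
    simp only [smul_eq_cF, map_mul, cF]
    have e : (MvPolynomial.C alpha⁻¹ : SymA) * MvPolynomial.C alpha = 1 := by
      rw [← map_mul, inv_mul_cancel₀ alpha_ne, map_one]
    have e2 : (alpha - 1) * (k : F) * ((k : F) - 1) / 2 = (k : F) / 2 * ((alpha - 1) * ((k : F) - 1)) := by
      ring
    rw [e2]
    simp only [map_mul]
    linear_combination (- MvPolynomial.C (k : F) * rho (Polynomial.X ^ k * V g)) * e

end JK

set_option linter.unusedSimpArgs false

namespace JK
open Finset.HasAntidiagonal (antidiagonal)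
open Polynomial (X C monomial)

/-- `T_n (z^k f) = z^k ρ(z^n V f)` -/
def Tn (n : ℕ) : ZA →ₗ[F] ZA := Polynomial.lsum fun k =>
  mon k ∘ₗ rho ∘ₗ (LinearMap.mulLeft F (X ^ n : ZA)) ∘ₗ (V : SymA →ₗ[F] ZA)

lemma Tn_mon (n k : ℕ) (f : SymA) :
    Tn n (monomial k f) = monomial k (rho (X ^ n * V f)) := by
  simp [Tn, Polynomial.lsum_apply, Polynomial.sum_monomial_index]

/-- `z ∂_z` -/
def zd (x : ZA) : ZA := X * Polynomial.derivative x

lemma zd_add (x y : ZA) : zd (x + y) = zd x + zd y := by simp [zd, mul_add]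

lemma zd_mon (k : ℕ) (f : SymA) : zd (monomial k f) = (k : F) • monomial k f := by
  rw [zd, Polynomial.derivative_monomial, Polynomial.X_mul_monomial]
  rcases k with _ | k
  · simp
  · simp only [Nat.add_sub_cancel, Polynomial.smul_monomial]
    congr 1
    rw [smul_eq_cF, cF, map_natCast]; exact mul_comm _ _

lemma zd_C_mul (f : SymA) (x : ZA) : zd (C f * x) = C f * zd x := by
  simp [zd]; ring

lemma smul_ZA_cF (a : F) (x : ZA) : a • x = C (cF a) * x := smul_eq_CcF a x

lemma V_smul (a : F) (f : SymA) : V (a • f) = a • V f := V.map_smul a f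

lemma V_pp' (n : ℕ) : V (pp n) = (alpha * (n : F)) • X ^ n := by
  rw [V_pp, smul_eq_CcF, Polynomial.C_mul_X_pow_eq_monomial]

lemma D_pp_mul (n : ℕ) (f : SymA) :
    D (pp n * f) = pp n * D f + f * D (pp n) + (n : F) • rho (X ^ n * V f) := by
  rw [D_mul, V_pp', smul_mul_assoc, map_smul, smul_smul, ← mul_assoc,
    inv_mul_cancel₀ alpha_ne, one_mul]

lemma R_pp_mul (n k : ℕ) (f : SymA) :
    R (monomial k (pp n * f)) = C (pp n) * R (monomial k f)
      + (alpha * n * k) • (X ^ n * monomial k f) := by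
  rw [R_mon, R_mon, V_mul, V_pp']
  simp only [smul_eq_CcF, mul_add, Finset.mul_sum]
  simp only [← Polynomial.C_mul_X_pow_eq_monomial, map_mul, cF]
  simp only [mul_left_comm (C (pp n))]
  ring

lemma Dt_pp_mul (n : ℕ) (x : ZA) : Dt (C (pp n) * x) = C (pp n) * Dt x + C (D (pp n)) * x
    + (n : F) • Tn n x + (alpha * n) • (X ^ n * zd x) := by
  induction x using zind with
  | hadd x y hx hy => simp only [mul_add, map_add, hx, hy, smul_add, zd_add]; ring
  | hm k g =>
    rw [Polynomial.C_mul_monomial, Dt_mon, Dt_mon, D_pp_mul, R_pp_mul, Tn_mon, zd_mon]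
    simp only [smul_eq_CcF, smul_eq_cF]
    simp only [← Polynomial.C_mul_X_pow_eq_monomial, map_mul, map_add, cF]
    ring

lemma R_one (n : ℕ) : (alpha * n) • R (monomial n 1) = V (D (pp n)) := by
  rw [D_pp, R_mon]
  simp only [V_smul, map_add, map_sum, V_mul, V_pp', V_one, mul_zero, smul_zero, zero_add, mul_one]
  have h1 : ∑ x ∈ antidiagonal n, (C (pp x.1) * (alpha * (x.2 : F)) • (X : ZA) ^ x.2
      + C (pp x.2) * (alpha * (x.1 : F)) • (X : ZA) ^ x.1)
      = (2 * alpha) • ∑ x ∈ antidiagonal n, (x.1 : F) • monomial x.1 (pp x.2) := by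
    rw [Finset.sum_add_distrib, ← Finset.Nat.sum_antidiagonal_swap]
    simp only [Prod.fst_swap, Prod.snd_swap]
    rw [← two_mul, Finset.smul_sum, Finset.mul_sum]
    refine Finset.sum_congr rfl fun x _ => ?_
    rw [← Polynomial.C_mul_X_pow_eq_monomial]
    simp only [smul_eq_CcF, map_mul, cF, map_ofNat]
    ring
  rw [h1, smul_add, smul_add, smul_smul, smul_smul, smul_smul, smul_smul,
    ← Polynomial.C_mul_X_pow_eq_monomial, map_one, one_mul]
  congr 2 <;> ring

lemma R_mul (n : ℕ) (f : SymA) :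
    R (monomial n f) = (n : F) • (X ^ n * V f) + C f * R (monomial n 1) := by
  rw [R_mon, R_mon, V_one]
  simp only [mul_zero, smul_zero, zero_add, mul_one, smul_eq_CcF, mul_add, Finset.mul_sum]
  simp only [← Polynomial.C_mul_X_pow_eq_monomial, map_mul, cF, map_one]
  have : ∀ x ∈ antidiagonal n, C f * (C (MvPolynomial.C (x.1 : F)) * (C (pp x.2) * X ^ x.1))
      = C (MvPolynomial.C (x.1 : F)) * (C (pp x.2) * C f * X ^ x.1) := fun x _ => by ring
  rw [Finset.sum_congr rfl this]
  ring

lemma Tn_C_mul (n : ℕ) (f : SymA) (x : ZA) :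
    Tn n (C f * x) = C f * Tn n x + C (rho (X ^ n * V f)) * x := by
  induction x using zind with
  | hadd x y hx hy => simp only [mul_add, map_add, hx, hy]; ring
  | hm k g =>
    rw [Polynomial.C_mul_monomial, Tn_mon, Tn_mon, V_mul, mul_add, map_add,
      mul_left_comm, rho_C_mul, mul_left_comm, rho_C_mul, Polynomial.C_mul_monomial,
      Polynomial.C_mul_monomial, ← map_add]
    congr 1; ring

lemma Sn (n : ℕ) (f : SymA) : Tn n (V f) + alpha • (X ^ n * zd (V f))
    + (alpha * n) • (X ^ n * V f) = V (rho (X ^ n * V f)) := by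
  induction f using MvPolynomial.induction_on with
  | C a => simp [zd]
  | add f g hf hg => simp only [mul_add, map_add, zd_add, smul_add, ← hf, ← hg]; ring
  | mul_X f k hf =>
    have e : Tn n (V (pp k)) + alpha • (X ^ n * zd (V (pp k)))
      + (alpha * n) • (X ^ n * V (pp k)) = V (rho (X ^ n * V (pp k))) := by
      rw [V_pp, zd_mon, Tn_mon, V_C, Polynomial.X_pow_mul_monomial, rho_mon, V_mul, V_C, V_pp',
        mul_zero, map_zero, map_zero]
      simp only [← Polynomial.C_mul_X_pow_eq_monomial]
      simp only [smul_eq_CcF, map_mul, cF, mul_zero, map_zero, zero_add, Nat.cast_add, map_add,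
        pow_add]
      ring
    rw [pp_pnat] at e
    have e1 : V (rho (X ^ n * V (f * MvPolynomial.X k))) =
        C f * V (rho (X ^ n * V (MvPolynomial.X k))) + C (rho (X ^ n * V (MvPolynomial.X k))) * V f
        + (C (MvPolynomial.X k) * V (rho (X ^ n * V f)) + C (rho (X ^ n * V f)) * V (MvPolynomial.X k)) := by
      rw [V_mul, mul_add, map_add, mul_left_comm, rho_C_mul, mul_left_comm, rho_C_mul, map_add,
        V_mul, V_mul]
    rw [e1, ← e, ← hf, V_mul]
    simp only [map_add, Tn_C_mul, zd_add, zd_C_mul, smul_eq_CcF]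
    ring

lemma Dt_V (f : SymA) : Dt (V f) = V (D f) := by
  induction f using MvPolynomial.induction_on with
  | C a => simp [D_apply]
  | add f g hf hg => simp only [map_add, hf, hg]
  | mul_X f k hf =>
    rw [← pp_pnat, mul_comm, V_mul, D_pp_mul]
    simp only [map_add, V_mul, Dt_pp_mul, hf, V_smul, ← Sn]
    rw [V_pp', mul_smul_comm, Polynomial.C_mul_X_pow_eq_monomial, map_smul, Dt_mon, R_mul,
      ← R_one, ← Polynomial.C_mul_X_pow_eq_monomial]
    simp only [smul_eq_CcF, map_mul, cF]
    ring

lemma zind' {P : ZA → Prop} (hadd : ∀ x y, P x → P y → P (x + y))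
    (hC : ∀ f, P (C f)) (hX : ∀ x, P x → P (X * x)) (x : ZA) : P x := by
  refine zind hadd (fun k f => ?_) x
  induction k with
  | zero => exact hC f
  | succ k ih => rw [← Polynomial.X_mul_monomial]; exact hX _ ih

lemma Dt_L (x : ZA) : Dt (L x) = L (Dt x) := by
  induction x using zind' with
  | hadd x y hx hy => simp only [map_add, hx, hy]
  | hC f => rw [L_C, Dt_V, Dt_C, L_C]
  | hX x hx =>
    rw [L_X_mul, Dt_X_mul, map_add, map_add, map_smul, Dt_X_mul, Dt_X_mul, Dt_C, map_add,
      L_X_mul, L_X_mul, hx, ← rho_Dt, Dt_X_mul]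
    simp only [map_add, smul_add]
    ring

section ring
variable {A : Type*} [Ring A]

lemma ring_rel (a u z p l d : A) (ha : ∀ x, a * x = x * a) (hu : ∀ x, u * x = x * u)
    (h1 : l * p = p * l + a * z) (h2 : d * z = z * d + z * l) (h3 : d * l = l * d)
    (h4 : p * z = z * p) (B G M : A) (hB : B = u * p + (d * p - p * d)) (hG : G = z * (l + u))
    (hM : M = d * B - B * d) : M * G - G * M = a * (G * G) := by
  have k1 : B * z - z * B = a * (z * z) := by
    rw [hB]
    linear_combination (norm := skip) u * h4 + hu z * p  + h2 * p - p * h2 - h4 * l + z * h1 + d * h4 - h4 * d - ha z * z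
    noncomm_ring
  have k2 : B * l - l * B = - (a * (z * (l + u))) := by
    rw [hB]
    linear_combination (norm := skip) - u * h1 + hu l * p - d * h1 + h1 * d + h3 * p - p * h3 + ha d * z - a * h2 - hu (a * z)
    noncomm_ring
  have k3 : B * G - G * B = 0 := by
    rw [hG]
    linear_combination (norm := skip) k1 * (l + u) + z * k2 - z * hu B + ha z * z * (l + u)
    noncomm_ring
  have k4 : d * G - G * d = G * l := by
    rw [hG]
    linear_combination (norm := skip) h2 * (l + u) + z * h3 - z * hu d - z * hu l
    noncomm_ring
  rw [← hG] at k2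
  rw [hM]
  linear_combination (norm := skip) d * k3 - k3 * d - B * k4 + k4 * B - k3 * l - G * k2 - ha G * G
  noncomm_ring

lemma ring_rel_pow (a G M : A) (ha : ∀ x, a * x = x * a) (h : M * G - G * M = a * (G * G)) (n : ℕ) :
    M * G ^ n - G ^ n * M = (n : A) * (a * G ^ (n + 1)) := by
  induction n with
  | zero => simp
  | succ n ih =>
    have c : (n : A) * G = G * (n : A) := Nat.cast_commute n G
    push_cast
    rw [pow_succ' G (n+1), pow_succ' G n] at *
    linear_combination (norm := skip) h * G ^ n + G * ih - c * a * G * G ^ n - (n : A) * ha G * G * G ^ n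
    noncomm_ring
end ring

end JK

set_option linter.unusedSimpArgs false

namespace JK
open Finset.HasAntidiagonal (antidiagonal)
open Polynomial (X C monomial)

/-- multiplication by `z` -/
def zE : Module.End F ZA := LinearMap.mulLeft F (X : ZA)
/-- multiplication by `p_1` on `ZA` -/
def pE : Module.End F ZA := LinearMap.mulLeft F (C (pp 1) : ZA)
/-- multiplication by `p_n` -/
def mulp (n : ℕ) : Module.End F SymA := LinearMap.mulLeft F (pp n)

@[simp] lemma zE_apply (x : ZA) : zE x = X * x := rfl
@[simp] lemma pE_apply (x : ZA) : pE x = C (pp 1) * x := rfl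
@[simp] lemma mulp_apply (n : ℕ) (x : SymA) : mulp n x = pp n * x := rfl

/-- `ι : SymA → ZA` -/
def iot : SymA →ₗ[F] ZA := mon 0
@[simp] lemma iot_apply (f : SymA) : iot f = C f := rfl

/-- `Γ + u Y₊` -/
def Gam (u : F) : Module.End F ZA := zE * ((L : Module.End F ZA) + algebraMap F _ u)

lemma Gam_apply (u : F) (x : ZA) : Gam u x = X * L x + u • (X * x) := by
  simp [Gam, mul_add, Module.algebraMap_end_apply]

/-- `α B_n(u)` -/
def BB (u : F) (n : ℕ) : Module.End F SymA := rho ∘ₗ (Gam u ^ n) ∘ₗ iot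

lemma BB_apply (u : F) (n : ℕ) (f : SymA) : BB u n f = rho ((Gam u ^ n) (C f)) := rfl

lemma D_pp_one : D (pp 1) = 0 := by
  rw [D_pp]
  simp [Finset.Nat.antidiagonal_succ]

lemma BB_one (u : F) (f : SymA) : BB u 1 f = u • (pp 1 * f) + rho (X * V f) := by
  rw [BB_apply, pow_one, Gam_apply, L_C, map_add, map_smul]
  have : rho (X * C f) = pp 1 * f := by
    rw [mul_comm, Polynomial.C_mul_X_eq_monomial, rho_mon]
  rw [this, add_comm]

lemma BB_one' (u : F) (f : SymA) :
    BB u 1 f = u • (pp 1 * f) + (D (pp 1 * f) - pp 1 * D f) := by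
  rw [BB_one, D_pp_mul, D_pp_one]
  simp

/-- lift of `BB u 1` -/
def Bh (u : F) : Module.End F ZA := algebraMap F _ u * pE + ((Dt : Module.End F ZA) * pE - pE * Dt)
/-- lift of `[D, BB u 1]` -/
def Mh (u : F) : Module.End F ZA := Dt * Bh u - Bh u * Dt
/-- `[D, BB u 1]` -/
def MM (u : F) : Module.End F SymA := D * BB u 1 - BB u 1 * D

lemma Mh_Gam (u : F) (n : ℕ) : Mh u * Gam u ^ n - Gam u ^ n * Mh u =
    (n : Module.End F ZA) * (algebraMap F _ alpha * Gam u ^ (n + 1)) := by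
  refine ring_rel_pow (algebraMap F _ alpha) (Gam u) (Mh u) (fun x => Algebra.commutes _ x) ?_ n
  refine ring_rel (algebraMap F _ alpha) (algebraMap F _ u) zE pE L Dt
    (fun x => Algebra.commutes _ x) (fun x => Algebra.commutes _ x) ?_ ?_ ?_ ?_ (Bh u) (Gam u)
    (Mh u) rfl rfl rfl
  · refine LinearMap.ext fun x => ?_
    simp only [Module.End.mul_apply, LinearMap.add_apply, pE_apply, zE_apply, L_C_mul, V_pp',
      Module.algebraMap_end_apply, Nat.cast_one, pow_one, mul_one, smul_mul_assoc]
  · refine LinearMap.ext fun x => ?_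
    simp only [Module.End.mul_apply, LinearMap.add_apply, zE_apply, Dt_X_mul]
  · refine LinearMap.ext fun x => ?_
    simp only [Module.End.mul_apply, Dt_L]
  · refine LinearMap.ext fun x => ?_
    simp only [Module.End.mul_apply, pE_apply, zE_apply]
    ring

lemma rho_Bh (u : F) (x : ZA) : rho (Bh u x) = BB u 1 (rho x) := by
  simp only [Bh, BB_one', LinearMap.add_apply, LinearMap.sub_apply, Module.End.mul_apply, pE_apply,
      Module.algebraMap_end_apply, map_add, map_sub, map_smul, rho_Dt, rho_C_mul]

lemma Bh_C (u : F) (f : SymA) : Bh u (C f) = C (BB u 1 f) := by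
  simp only [Bh, BB_one', LinearMap.add_apply, LinearMap.sub_apply, Module.End.mul_apply, pE_apply,
      Module.algebraMap_end_apply, map_add, map_sub, Dt_C, ← map_mul]
  congr 1
  rw [smul_eq_CcF, ← map_mul, smul_eq_cF]

lemma rho_Mh (u : F) (x : ZA) : rho (Mh u x) = MM u (rho x) := by
  simp only [Mh, MM, LinearMap.sub_apply, Module.End.mul_apply, map_sub, rho_Dt, rho_Bh]

lemma Mh_C (u : F) (f : SymA) : Mh u (C f) = C (MM u f) := by
  simp only [Mh, MM, LinearMap.sub_apply, Module.End.mul_apply, map_sub, Dt_C, Bh_C]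

/-- Relation (R). -/
lemma BB_rel (u : F) (n : ℕ) :
    MM u * BB u n - BB u n * MM u = ((n : F) * alpha) • BB u (n + 1) := by
  refine LinearMap.ext fun f => ?_
  have := congrArg (fun T => rho (T (C f))) (Mh_Gam u n)
  simp only [LinearMap.sub_apply, Module.End.mul_apply, map_sub, rho_Mh, Mh_C,
    Module.algebraMap_end_apply, ← map_natCast (algebraMap F (Module.End F ZA)), map_smul] at this
  simp only [LinearMap.sub_apply, Module.End.mul_apply, BB_apply, LinearMap.smul_apply, this,
    smul_smul, mul_comm alpha]

end JK

set_option linter.unusedSimpArgs false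

namespace JK
open Finset.HasAntidiagonal (antidiagonal)
open Polynomial (X C monomial)

/-- weights of variables -/
abbrev wv : ℕ+ → ℕ := fun i => (i : ℕ)

lemma wt_eq (m : Exp) : wt m = Finsupp.weight wv m := by
  simp [wt, Finsupp.weight_apply]

@[simp] lemma wt_add (m m' : Exp) : wt (m + m') = wt m + wt m' := by
  simp [wt_eq]

@[simp] lemma wt_zero : wt 0 = 0 := by simp [wt_eq]

lemma wt_single (i : ℕ+) (k : ℕ) : wt (Finsupp.single i k) = k * i := by
  simp [wt]

lemma toExp_eq (l : JPartition) : toExp l = Multiset.toFinsupp l := by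
  ext i
  simp only [toExp, Finsupp.coe_finsetSum, Finset.sum_apply, Multiset.toFinsupp_apply,
    Finsupp.single_apply, Finset.sum_ite_eq', Multiset.mem_toFinset]
  split_ifs with h
  · rfl
  · exact (Multiset.count_eq_zero_of_notMem h).symm

@[simp] lemma toExp_add (l l' : JPartition) : toExp (l + l') = toExp l + toExp l' := by
  simp [toExp_eq]

@[simp] lemma toExp_zero : toExp 0 = 0 := by simp [toExp_eq]

lemma toExp_singleton (i : ℕ+) : toExp {i} = Finsupp.single i 1 := by
  simp [toExp_eq]

lemma toExp_inj {l l' : JPartition} : toExp l = toExp l' ↔ l = l' := by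
  rw [toExp_eq, toExp_eq]; exact Multiset.toFinsupp.injective.eq_iff

lemma toExp_surj (m : Exp) : ∃ l, toExp l = m :=
  ⟨Finsupp.toMultiset m, by rw [toExp_eq]; simp⟩

@[simp] lemma psize_zero : psize 0 = 0 := by simp [psize]
@[simp] lemma psize_add (l l' : JPartition) : psize (l + l') = psize l + psize l' := by
  simp [psize]
@[simp] lemma psize_cons (a : ℕ+) (l : JPartition) : psize (a ::ₘ l) = a + psize l := by
  simp [psize]
@[simp] lemma psize_singleton (a : ℕ+) : psize {a} = a := by
  simp [psize]

lemma wt_toExp (l : JPartition) : wt (toExp l) = psize l := by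
  induction l using Multiset.induction with
  | empty => simp
  | cons a s ih =>
    rw [psize_cons, ← ih, ← Multiset.singleton_add, toExp_add, wt_add, toExp_singleton, wt_single,
      one_mul]

lemma pPow_eq (l : JPartition) : pPow l = MvPolynomial.monomial (toExp l) 1 := by
  induction l using Multiset.induction with
  | empty => simp [pPow]
  | cons a s ih =>
    rw [← Multiset.singleton_add, toExp_add, toExp_singleton, pPow, Multiset.map_add,
      Multiset.prod_add, ← pPow, ← pPow, ih]
    rw [← one_mul (1 : F), ← MvPolynomial.monomial_mul]
    simp [pPow, MvPolynomial.X]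

/-- homogeneous symmetric functions -/
def Hom (d : ℕ) : Submodule F SymA := MvPolynomial.weightedHomogeneousSubmodule F wv d

lemma mem_Hom {d : ℕ} {f : SymA} :
    f ∈ Hom d ↔ ∀ m, MvPolynomial.coeff m f ≠ 0 → wt m = d := by
  rw [Hom, MvPolynomial.mem_weightedHomogeneousSubmodule]
  constructor
  · intro h m hm; rw [wt_eq]; exact h hm
  · intro h m hm; rw [← wt_eq]; exact h m hm

lemma Hom_mul {d e : ℕ} {f g : SymA} (hf : f ∈ Hom d) (hg : g ∈ Hom e) : f * g ∈ Hom (d + e) :=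
  MvPolynomial.IsWeightedHomogeneous.mul hf hg

lemma Hom_pp (k : ℕ) : pp k ∈ Hom k := by
  by_cases h : 0 < k
  · obtain ⟨k', rfl⟩ : ∃ k' : ℕ+, (k' : ℕ) = k := ⟨⟨k, h⟩, rfl⟩
    rw [pp_pnat]
    exact MvPolynomial.isWeightedHomogeneous_X F wv k'
  · have : k = 0 := by omega
    subst this
    simp

lemma Hom_monomial (m : Exp) (a : F) : MvPolynomial.monomial m a ∈ Hom (wt m) := by
  rw [wt_eq]
  exact MvPolynomial.isWeightedHomogeneous_monomial wv m a rfl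

lemma Hom_C (a : F) : cF a ∈ Hom 0 := by
  have := Hom_monomial 0 a
  simpa using this

/-- homogeneous elements of `ZA` -/
def HZ (d : ℕ) : Submodule F ZA :=
  Submodule.span F {x | ∃ k e f, f ∈ Hom e ∧ k + e = d ∧ x = monomial k f}

lemma HZ_mon {k e d : ℕ} {f : SymA} (hf : f ∈ Hom e) (h : k + e = d) : monomial k f ∈ HZ d :=
  Submodule.subset_span ⟨k, e, f, hf, h, rfl⟩

lemma HZ_map {M : Type*} [AddCommGroup M] [Module F M] {T : ZA →ₗ[F] M} {d : ℕ} {S : Submodule F M}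
    (h : ∀ k e f, f ∈ Hom e → k + e = d → T (monomial k f) ∈ S) {x : ZA} (hx : x ∈ HZ d) :
    T x ∈ S := by
  have : HZ d ≤ S.comap T := Submodule.span_le.2 (by
    rintro _ ⟨k, e, f, hf, hk, rfl⟩
    exact h k e f hf hk)
  exact this hx

lemma HZ_Cmul {e d : ℕ} {f : SymA} {x : ZA} (hf : f ∈ Hom e) (hx : x ∈ HZ d) :
    C f * x ∈ HZ (e + d) := by
  refine HZ_map (T := LinearMap.mulLeft F (C f)) (fun k e' g hg hk => ?_) hx
  rw [LinearMap.mulLeft_apply, Polynomial.C_mul_monomial]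
  exact HZ_mon (Hom_mul hf hg) (by omega)

lemma HZ_X {d : ℕ} {x : ZA} (n : ℕ) (hx : x ∈ HZ d) : X ^ n * x ∈ HZ (d + n) := by
  refine HZ_map (T := LinearMap.mulLeft F (X ^ n)) (fun k e' g hg hk => ?_) hx
  rw [LinearMap.mulLeft_apply, Polynomial.X_pow_mul_monomial]
  exact HZ_mon hg (by omega)

lemma Hom_ind {M : Type*} [AddCommGroup M] [Module F M] {T : SymA →ₗ[F] M} {d : ℕ}
    {S : Submodule F M} (h : ∀ m a, wt m = d → T (MvPolynomial.monomial m a) ∈ S) {f : SymA}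
    (hf : f ∈ Hom d) : T f ∈ S := by
  rw [f.as_sum, map_sum]
  refine Submodule.sum_mem _ fun m hm => h _ _ ?_
  exact mem_Hom.1 hf m (MvPolynomial.mem_support_iff.1 hm)

lemma HZ_V {d : ℕ} {f : SymA} (hf : f ∈ Hom d) : V f ∈ HZ d := by
  refine Hom_ind (T := (V : SymA →ₗ[F] ZA)) (fun m a hm => ?_) hf
  clear hf
  subst hm
  change V _ ∈ _
  induction m using Finsupp.induction_linear generalizing a with
  | zero => simp
  | add m m' h h' =>
    have : MvPolynomial.monomial (m + m') a
        = MvPolynomial.monomial m a * MvPolynomial.monomial m' (1 : F) := by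
      rw [MvPolynomial.monomial_mul, mul_one]
    rw [this, V_mul, wt_add]
    refine add_mem (HZ_Cmul (Hom_monomial _ _) (h' _)) ?_
    rw [add_comm]
    exact (HZ_Cmul (Hom_monomial _ _) (h _))
  | single i k =>
    rw [wt_single]
    induction k generalizing a with
    | zero => simp
    | succ k ih =>
      have : MvPolynomial.monomial (Finsupp.single i (k + 1)) a
          = MvPolynomial.monomial (Finsupp.single i k) a * pp i := by
        rw [pp_pnat, MvPolynomial.X, MvPolynomial.monomial_mul, mul_one, Finsupp.single_add]
      rw [this, V_mul, V_pp, add_mul, one_mul]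
      refine add_mem (HZ_Cmul ?_ (HZ_mon (Hom_C _) (by simp))) ?_
      · rw [← wt_single]; exact Hom_monomial _ _
      · rw [add_comm]
        exact (HZ_Cmul (Hom_pp _) (ih _))

lemma Hom_rho {d : ℕ} {x : ZA} (hx : x ∈ HZ d) : rho x ∈ Hom d := by
  refine HZ_map (fun k e g hg hk => ?_) hx
  rw [rho_mon, ← hk]
  exact Hom_mul (Hom_pp _) hg

lemma HZ_L {d : ℕ} {x : ZA} (hx : x ∈ HZ d) : L x ∈ HZ d := by
  refine HZ_map (fun k e g hg hk => ?_) hx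
  rw [L_mon]
  refine add_mem (add_mem ?_ (Submodule.sum_mem _ fun y hy => ?_)) (Submodule.smul_mem _ _ (HZ_mon hg hk))
  · rw [← hk, add_comm]; exact HZ_X _ (HZ_V hg)
  · have := Finset.HasAntidiagonal.mem_antidiagonal.1 hy
    exact HZ_mon (Hom_mul (Hom_pp _) hg) (by omega)

lemma Hom_D {d : ℕ} {f : SymA} (hf : f ∈ Hom d) : D f ∈ Hom d := by
  rw [D_apply]
  exact Submodule.smul_mem _ _ (sub_mem (Hom_rho (HZ_L (HZ_V hf)))
    (Submodule.smul_mem _ _ (Hom_rho (HZ_V hf))))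

lemma HZ_Gam {d : ℕ} (u : F) (n : ℕ) {x : ZA} (hx : x ∈ HZ d) : (Gam u ^ n) x ∈ HZ (d + n) := by
  induction n with
  | zero => simpa
  | succ n ih =>
    rw [pow_succ', Module.End.mul_apply, Gam_apply, ← add_assoc]
    have h1 := HZ_X 1 ih
    have h2 := HZ_X 1 (HZ_L ih)
    rw [pow_one] at h1 h2
    exact add_mem h2 (Submodule.smul_mem _ _ h1)

lemma Hom_BB {d : ℕ} (u : F) (n : ℕ) {f : SymA} (hf : f ∈ Hom d) : BB u n f ∈ Hom (d + n) :=
  Hom_rho (HZ_Gam u n (by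
    exact HZ_mon (k := 0) hf (by omega)))

end JK

set_option linter.unusedSimpArgs false

namespace JK
open Finset.HasAntidiagonal (antidiagonal)
open Polynomial (X C monomial)
open MvPolynomial (pderiv rename)

lemma coeff_V (f : SymA) (j : ℕ+) : (V f).coeff (j : ℕ) = (alpha * (j : ℕ)) • pderiv j f := by
  induction f using MvPolynomial.induction_on with
  | C a => simp
  | add f g hf hg => simp only [map_add, Polynomial.coeff_add, hf, hg, smul_add]
  | mul_X f k hf =>
    rw [← pp_pnat, V_mul, V_pp, Polynomial.coeff_add, Polynomial.coeff_C_mul,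
      Polynomial.coeff_C_mul, hf, Polynomial.coeff_monomial, pp_pnat, MvPolynomial.pderiv_mul,
      MvPolynomial.pderiv_X]
    by_cases h : k = j
    · subst h; simp [smul_eq_cF]; ring
    · have h' : (k : ℕ) ≠ j := fun e => h (PNat.coe_injective e)
      rw [if_neg h', Pi.single_eq_of_ne h]
      simp [smul_eq_cF]; ring

lemma coeff_V_zero (f : SymA) : (V f).coeff 0 = 0 := by
  induction f using MvPolynomial.induction_on with
  | C a => simp
  | add f g hf hg => simp only [map_add, Polynomial.coeff_add, hf, hg, add_zero]
  | mul_X f k hf =>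
    rw [← pp_pnat, V_mul, V_pp, Polynomial.coeff_add, Polynomial.coeff_C_mul,
      Polynomial.coeff_C_mul, hf, Polynomial.coeff_monomial, if_neg k.ne_zero]
    simp

lemma V_eq_sum (f : SymA) :
    V f = ∑ j ∈ f.vars, monomial (j : ℕ) ((alpha * (j : ℕ)) • pderiv j f) := by
  ext1 n
  rw [Polynomial.finsetSum_coeff]
  simp only [Polynomial.coeff_monomial]
  rcases Nat.eq_zero_or_pos n with rfl | hn
  · rw [coeff_V_zero, Finset.sum_eq_zero]
    intro j _
    rw [if_neg j.ne_zero]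
  · obtain ⟨k, rfl⟩ : ∃ k' : ℕ+, (k' : ℕ) = n := ⟨⟨n, hn⟩, rfl⟩
    rw [coeff_V]
    by_cases hk : k ∈ f.vars
    · rw [Finset.sum_eq_single k]
      · simp
      · intro j _ hj
        rw [if_neg fun e => hj (PNat.coe_injective e)]
      · intro h; exact absurd hk h
    · rw [MvPolynomial.pderiv_eq_zero_of_notMem_vars hk, smul_zero, Finset.sum_eq_zero]
      intro j hj
      rw [if_neg]
      intro e
      exact hk (PNat.coe_injective e ▸ hj)

/-- embedding of `ZA` in `PY` -/
def emb : ZA →ₗ[F] PY := Polynomial.lsum fun k =>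
  LinearMap.mulLeft F (yv k) ∘ₗ (rename Sum.inl : SymA →ₐ[F] PY).toLinearMap

lemma emb_mon (k : ℕ) (f : SymA) : emb (monomial k f) = yv k * rename Sum.inl f := by
  simp [emb, Polynomial.lsum_apply, Polynomial.sum_monomial_index]

lemma fin_inr (f : PY) : {i : ℕ | pderiv (Sum.inr i) f ≠ 0}.Finite := by
  refine Set.Finite.subset (s := Sum.inr ⁻¹' (f.vars : Set (ℕ+ ⊕ ℕ)))
    (Set.Finite.preimage Sum.inr_injective.injOn f.vars.finite_toSet) fun i hi => ?_
  by_contra h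
  exact hi (MvPolynomial.pderiv_eq_zero_of_notMem_vars h)

lemma fin_inl (f : PY) : {i : ℕ+ | pderiv (Sum.inl i) f ≠ 0}.Finite := by
  refine Set.Finite.subset (s := Sum.inl ⁻¹' (f.vars : Set (ℕ+ ⊕ ℕ)))
    (Set.Finite.preimage Sum.inl_injective.injOn f.vars.finite_toSet) fun i hi => ?_
  by_contra h
  exact hi (MvPolynomial.pderiv_eq_zero_of_notMem_vars h)

lemma bd_inr (f : PY) : ∃ N, ∀ i ≥ N, pderiv (Sum.inr i) f = 0 := by
  obtain ⟨N, hN⟩ := (fin_inr f).bddAbove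
  refine ⟨N + 1, fun i hi => ?_⟩
  by_contra h
  have := hN h
  omega

lemma Yplus_add (f g : PY) : Yplus (f + g) = Yplus f + Yplus g := by
  rw [Yplus, Yplus, Yplus, ← finsum_add_distrib]
  · simp only [map_add, mul_add]
  · exact (fin_inr f).subset fun j hj => by
      intro h; apply hj; simp only [h, mul_zero]
  · exact (fin_inr g).subset fun j hj => by
      intro h; apply hj; simp only [h, mul_zero]

lemma ThetaY_add (f g : PY) : ThetaY (f + g) = ThetaY f + ThetaY g := by
  have key : ∀ f : PY, (Function.support fun i : ℕ+ => pv i * pderiv (Sum.inr (i : ℕ)) f).Finite := by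
    intro f
    refine Set.Finite.subset (Set.Finite.preimage PNat.coe_injective.injOn (fin_inr f)) fun j hj => ?_
    intro h; apply hj; simp only [h, mul_zero]
  rw [ThetaY, ThetaY, ThetaY, ← finsum_add_distrib (key f) (key g)]
  simp only [map_add, mul_add]

lemma pnat_fin (N : ℕ) : {i : ℕ+ | (i : ℕ) < N}.Finite :=
  Set.Finite.preimage PNat.coe_injective.injOn (Set.finite_lt_nat N)

lemma GammaY_add (f g : PY) : GammaY (f + g) = GammaY f + GammaY g := by
  have key1 : ∀ (i : ℕ+) (f : PY), (Function.support fun j : ℕ+ => ((j : ℕ) : F) •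
      (yv ((i : ℕ) + (j : ℕ)) * pderiv (Sum.inl j) f)).Finite := by
    intro i f
    refine (fin_inl f).subset fun j hj => ?_
    intro h; apply hj; simp only [h, mul_zero, smul_zero]
  have key1' : ∀ (f : PY), (Function.support fun i : ℕ+ => ∑ᶠ j : ℕ+, ((j : ℕ) : F) •
      (yv ((i : ℕ) + (j : ℕ)) *
        pderiv (Sum.inl j) (pderiv (Sum.inr ((i : ℕ) - 1)) f))).Finite := by
    intro f
    obtain ⟨N, hN⟩ := bd_inr f
    refine (pnat_fin (N + 1)).subset fun i hi => ?_
    by_contra h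
    apply hi
    have : N ≤ (i : ℕ) - 1 := by simp at h; omega
    simp only [hN _ this, map_zero, mul_zero, smul_zero, finsum_zero]
  have key2 : ∀ (i : ℕ+) (f : PY), (Function.support fun j : ℕ+ => yv (i : ℕ) * pv j *
      pderiv (Sum.inr ((i : ℕ) + (j : ℕ) - 1)) f).Finite := by
    intro i f
    obtain ⟨N, hN⟩ := bd_inr f
    refine (pnat_fin (N + 1)).subset fun j hi => ?_
    by_contra h
    apply hi
    have : N ≤ (i : ℕ) + (j : ℕ) - 1 := by simp at h; omega
    simp only [hN _ this, mul_zero]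
  have key2' : ∀ (f : PY), (Function.support fun i : ℕ+ => ∑ᶠ j : ℕ+, yv (i : ℕ) * pv j *
      pderiv (Sum.inr ((i : ℕ) + (j : ℕ) - 1)) f).Finite := by
    intro f
    obtain ⟨N, hN⟩ := bd_inr f
    refine (pnat_fin (N + 1)).subset fun i hi => ?_
    by_contra h
    apply hi
    have : ∀ j : ℕ+, N ≤ (i : ℕ) + (j : ℕ) - 1 := fun j => by simp at h; omega
    simp only [hN _ (this _), mul_zero, finsum_zero]
  have key3 : ∀ f : PY, (Function.support fun i : ℕ+ => ((i : ℕ) : F) •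
      (yv ((i : ℕ) + 1) * pderiv (Sum.inr (i : ℕ)) f)).Finite := by
    intro f
    refine Set.Finite.subset (Set.Finite.preimage PNat.coe_injective.injOn (fin_inr f)) fun j hj => ?_
    intro h; apply hj; simp only [h, mul_zero, smul_zero]
  simp only [GammaY, map_add, mul_add, smul_add]
  simp only [finsum_add_distrib (key1 _ _) (key1 _ _), finsum_add_distrib (key2 _ _) (key2 _ _)]
  rw [finsum_add_distrib (key1' f) (key1' g), finsum_add_distrib (key2' f) (key2' g),
    finsum_add_distrib (key3 f) (key3 g)]
  simp only [smul_add]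
  ring

lemma pd_inr (j k : ℕ) (f : SymA) : pderiv (Sum.inr j) (yv k * rename Sum.inl f : PY)
    = if k = j then rename Sum.inl f else 0 := by
  have h0 : pderiv (Sum.inr j) (rename Sum.inl f : PY) = 0 := by
    apply MvPolynomial.pderiv_eq_zero_of_notMem_vars
    intro h
    have := MvPolynomial.vars_rename Sum.inl f h
    simp at this
  rw [MvPolynomial.pderiv_mul, h0, mul_zero, add_zero, yv]
  split_ifs with h
  · subst h; rw [MvPolynomial.pderiv_X_self, one_mul]
  · rw [MvPolynomial.pderiv_X_of_ne (by simpa using h), zero_mul]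

lemma Yplus_emb (x : ZA) : Yplus (emb x) = emb (X * x) := by
  induction x using zind with
  | hadd x y hx hy => rw [map_add, Yplus_add, hx, hy, mul_add, map_add]
  | hm k f =>
    rw [Polynomial.X_mul_monomial, emb_mon, emb_mon, Yplus, finsum_eq_single _ k]
    · rw [pd_inr, if_pos rfl]
    · intro j hj
      rw [pd_inr, if_neg hj.symm, mul_zero]

lemma ThetaY_emb (x : ZA) : dropY (ThetaY (emb x)) = rho x := by
  have hd : ∀ f : SymA, dropY (rename Sum.inl f) = f := by
    intro f
    rw [dropY, MvPolynomial.aeval_rename]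
    exact MvPolynomial.aeval_X_left_apply f
  induction x using zind with
  | hadd x y hx hy => rw [map_add, ThetaY_add, map_add, hx, hy, map_add]
  | hm k f =>
    rw [emb_mon, ThetaY, rho_mon]
    simp only [pd_inr]
    rcases Nat.eq_zero_or_pos k with rfl | hk
    · rw [pp_zero, zero_mul]
      have : ∀ i : ℕ+, pv i * (if 0 = (i : ℕ) then rename Sum.inl f else 0 : PY) = 0 := by
        intro i
        rw [if_neg i.ne_zero.symm, mul_zero]
      simp only [this, finsum_zero, map_zero]
    · obtain ⟨k, rfl⟩ : ∃ k' : ℕ+, (k' : ℕ) = k := ⟨⟨k, hk⟩, rfl⟩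
      rw [finsum_eq_single _ k, if_pos rfl, map_mul, hd, pp_pnat, pv, dropY, MvPolynomial.aeval_X]
      intro j hj
      rw [if_neg fun e => hj (PNat.coe_injective e.symm), mul_zero]

lemma GammaY_emb (x : ZA) : GammaY (emb x) = emb (X * L x) := by
  induction x using zind with
  | hadd x y hx hy => rw [map_add, GammaY_add, hx, hy, map_add, mul_add, map_add]
  | hm k f =>
    rw [emb_mon, GammaY, L_mon]
    simp only [mul_add, map_add]
    congr 1
    · congr 1
      · rw [finsum_eq_single _ k.succPNat]
        · have : ((k.succPNat : ℕ+) : ℕ) - 1 = k := by simp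
          rw [this, pd_inr, if_pos rfl, V_eq_sum, finsum_eq_sum_of_support_subset (s := f.vars),
            Finset.smul_sum, Finset.mul_sum, Finset.mul_sum, map_sum]
          · refine Finset.sum_congr rfl fun j _ => ?_
            rw [MvPolynomial.pderiv_rename Sum.inl_injective, ← mul_assoc, ← pow_succ',
              Polynomial.X_pow_mul_monomial, emb_mon, map_smul, mul_smul_comm, smul_smul,
              Nat.succPNat_coe, add_comm (j : ℕ)]
          · intro j hj
            by_contra h
            apply hj
            simp only [MvPolynomial.pderiv_rename Sum.inl_injective]
            rw [MvPolynomial.pderiv_eq_zero_of_notMem_vars h]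
            simp
        · intro i hi
          have : k ≠ (i : ℕ) - 1 := by
            intro e; apply hi; apply PNat.coe_injective
            have := i.pos
            rw [Nat.succPNat_coe]; omega
          simp only [pd_inr, if_neg this, map_zero, mul_zero, smul_zero, finsum_zero]
      · rw [Finset.mul_sum, map_sum]
        simp only [Polynomial.X_mul_monomial, emb_mon, pd_inr, map_mul]
        have inner : ∀ i : ℕ+, ∑ᶠ j : ℕ+, yv (i : ℕ) * pv j *
            (if k = (i : ℕ) + (j : ℕ) - 1 then rename Sum.inl f else 0 : PY)
            = yv (i : ℕ) * (rename Sum.inl (pp (k + 1 - i)) * rename Sum.inl f) := by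
          intro i
          have hi := i.pos
          by_cases h : 0 < k + 1 - (i : ℕ)
          · obtain ⟨r, hr⟩ : ∃ r : ℕ+, (r : ℕ) = k + 1 - i := ⟨⟨_, h⟩, rfl⟩
            rw [finsum_eq_single _ r]
            · rw [if_pos (by omega), ← hr, pp_pnat, pv, MvPolynomial.rename_X, mul_assoc]
            · intro j hj
              rw [if_neg, mul_zero]
              intro e
              apply hj
              apply PNat.coe_injective
              omega
          · have h0 : k + 1 - (i : ℕ) = 0 := by omega
            rw [h0, pp_zero, map_zero, zero_mul, mul_zero]
            have : ∀ j : ℕ+, ¬ (k = (i : ℕ) + (j : ℕ) - 1) := fun j => by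
              have := j.pos
              omega
            simp only [this, if_false, mul_zero, finsum_zero]
        simp only [inner]
        rw [Finset.Nat.sum_antidiagonal_eq_sum_range_succ_mk,
          finsum_eq_sum_of_support_subset
            (s := (Finset.range (k + 1)).map ⟨Nat.succPNat, Nat.succPNat_injective⟩)]
        · rw [Finset.sum_map]
          refine Finset.sum_congr rfl fun i _ => ?_
          simp only [Function.Embedding.coeFn_mk, Nat.succPNat_coe, Nat.succ_eq_add_one,
            Nat.add_sub_add_right]
        · intro i hi
          simp only [Finset.coe_map, Function.Embedding.coeFn_mk, Set.mem_image, Finset.coe_range,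
            Set.mem_Iio]
          refine ⟨(i : ℕ) - 1, ?_, ?_⟩
          · by_contra h
            apply hi
            have h0 : k + 1 - (i : ℕ) = 0 := by omega
            simp only [h0, pp_zero, map_zero, zero_mul, mul_zero]
          · apply PNat.coe_injective
            have := i.pos
            rw [Nat.succPNat_coe]; omega
    · rcases Nat.eq_zero_or_pos k with rfl | hk
      · have : ∀ i : ℕ+, (if 0 = (i : ℕ) then rename Sum.inl f else 0 : PY) = 0 := by
          intro i
          rw [if_neg i.ne_zero.symm]
        simp only [pd_inr, this, mul_zero, smul_zero, finsum_zero, Nat.cast_zero, mul_zero,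
          zero_smul, map_zero]
      · obtain ⟨k, rfl⟩ : ∃ k' : ℕ+, (k' : ℕ) = k := ⟨⟨k, hk⟩, rfl⟩
        rw [finsum_eq_single _ k, pd_inr, if_pos rfl, mul_smul_comm, Polynomial.X_mul_monomial,
          map_smul, emb_mon, smul_smul]
        intro j hj
        rw [pd_inr, if_neg fun e => hj (PNat.coe_injective e.symm), mul_zero, smul_zero]


/-- word operators on `ZA` -/
def wE : List Bool → Module.End F ZA
  | [] => 1
  | b :: w => (if b then zE else zE * L) * wE w

lemma wordOp_emb (w : List Bool) (x : ZA) : wordOp w (emb x) = emb (wE w x) := by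
  induction w with
  | nil => rfl
  | cons b w ih =>
    rw [wordOp, ih, wE]
    cases b
    · simp only [Bool.false_eq_true, if_false, GammaY_emb, Module.End.mul_apply, zE_apply]
    · simp only [if_true, Yplus_emb, Module.End.mul_apply, zE_apply]

/-- number of `true` -/
def cnt {n : ℕ} (s : Fin n → Bool) : ℕ := (Finset.univ.filter fun i => s i = true).card

lemma Bc_eq (n ℓ : ℕ) (f : SymA) : Bc n ℓ f = alpha⁻¹ • ∑ s ∈ Finset.univ.filter
      (fun s : Fin n → Bool => cnt s = ℓ), rho (wE (List.ofFn s) (C f)) := by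
  have h0 : (alpha⁻¹ • (yv 0 * rename Sum.inl f) : PY) = emb (alpha⁻¹ • C f) := by
    rw [map_smul, ← Polynomial.monomial_zero_left, emb_mon]
  rw [Bc, h0]
  simp only [wordOp_emb]
  rw [← map_sum, ThetaY_emb, map_sum]
  simp only [map_smul, Finset.smul_sum]
  rfl

lemma cnt_cons {n : ℕ} (b : Bool) (s : Fin n → Bool) :
    cnt (Fin.cons b s : Fin (n + 1) → Bool) = (if b then 1 else 0) + cnt s := by
  simp only [cnt, Finset.card_filter, Fin.sum_univ_succ, Fin.cons_zero, Fin.cons_succ]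

lemma Gam_pow (u : F) (n : ℕ) :
    Gam u ^ n = ∑ s : Fin n → Bool, u ^ cnt s • wE (List.ofFn s) := by
  induction n with
  | zero => simp [cnt, wE]
  | succ n ih =>
    rw [pow_succ', ih, ← (Fin.consEquiv fun _ => Bool).sum_comp, Fintype.sum_prod_type,
      Fintype.sum_bool, Finset.mul_sum, ← Finset.sum_add_distrib]
    refine Finset.sum_congr rfl fun s _ => ?_
    simp only [Fin.consEquiv, Equiv.coe_fn_mk, cnt_cons, List.ofFn_succ, Fin.cons_zero,
      Fin.cons_succ, wE, if_true, Bool.false_eq_true, if_false, zero_add]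
    refine LinearMap.ext fun x => ?_
    simp only [Module.End.mul_apply, LinearMap.smul_apply, LinearMap.add_apply, map_smul,
      Gam_apply, zE_apply, smul_add, smul_smul]
    rw [pow_add, pow_one, mul_comm u, add_comm]

lemma BB_eq_sum (u : F) (n : ℕ) (f : SymA) :
    ∑ ℓ ∈ Finset.range (n + 1), u ^ ℓ • Bc n ℓ f = alpha⁻¹ • BB u n f := by
  rw [BB_apply, Gam_pow, LinearMap.sum_apply, map_sum,
    ← Finset.sum_fiberwise_of_maps_to (t := Finset.range (n + 1)) (g := cnt)]
  · rw [Finset.smul_sum]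
    refine Finset.sum_congr rfl fun ℓ _ => ?_
    rw [Bc_eq, smul_comm]
    congr 1
    rw [Finset.smul_sum]
    refine Finset.sum_congr rfl fun s hs => ?_
    rw [(Finset.mem_filter.1 hs).2.symm, LinearMap.smul_apply, map_smul]
  · intro s _
    rw [Finset.mem_range, Nat.lt_succ_iff]
    exact (Finset.card_filter_le _ _).trans (by simp)

/-- linear version of `Bc` -/
def BL (n ℓ : ℕ) : SymA →ₗ[F] SymA := alpha⁻¹ • ∑ s ∈ Finset.univ.filter
      (fun s : Fin n → Bool => cnt s = ℓ), rho ∘ₗ wE (List.ofFn s) ∘ₗ iot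

lemma Bc_eq_BL (n ℓ : ℕ) (f : SymA) : Bc n ℓ f = BL n ℓ f := by
  rw [Bc_eq, BL, LinearMap.smul_apply, LinearMap.sum_apply]
  rfl

lemma Bc_gt {n ℓ : ℕ} (h : n < ℓ) (f : SymA) : Bc n ℓ f = 0 := by
  rw [Bc_eq, Finset.filter_false_of_mem, Finset.sum_empty, smul_zero]
  intro s _ e
  have : cnt s ≤ n := (Finset.card_filter_le _ _).trans (by simp)
  omega

lemma wE_true (n : ℕ) (x : ZA) : wE (List.replicate n true) x = X ^ n * x := by
  induction n with
  | zero => simp [wE]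
  | succ n ih => simp [List.replicate_succ, wE, ih, pow_succ']; ring

lemma Bc_top (n : ℕ) (f : SymA) : Bc n n f = alpha⁻¹ • (pp n * f) := by
  have : (Finset.univ.filter (fun s : Fin n → Bool => cnt s = n)) = {fun _ => true} := by
    ext s
    simp only [Finset.mem_filter, Finset.mem_univ, true_and, Finset.mem_singleton]
    constructor
    · intro h
      have h2 : (Finset.univ.filter fun i => s i = true) = Finset.univ :=
        Finset.eq_univ_of_card _ (by rw [Fintype.card_fin]; exact h)
      funext i
      have := Finset.mem_univ i
      rw [← h2] at this
      exact (Finset.mem_filter.1 this).2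
    · rintro rfl
      simp [cnt]
  rw [Bc_eq, this, Finset.sum_singleton, List.ofFn_const, wE_true, mul_comm,
    Polynomial.C_mul_X_pow_eq_monomial, rho_mon]

/-- `F` is infinite; two polynomial expressions agreeing on `-α s` for all large `s` agree. -/
lemma poly_coeff_zero {n : ℕ} {a : ℕ → F} (N : ℕ)
    (h : ∀ s : ℕ, N ≤ s → ∑ ℓ ∈ Finset.range n, (-(alpha * s)) ^ ℓ * a ℓ = 0) :
    ∀ ℓ < n, a ℓ = 0 := by
  let P : Polynomial F := ∑ ℓ ∈ Finset.range n, Polynomial.C (a ℓ) * Polynomial.X ^ ℓ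
  have hinj : Function.Injective fun s : ℕ => -(alpha * ((s + N : ℕ) : F)) := by
    intro s s' e
    have e' : alpha * ((s + N : ℕ) : F) = alpha * ((s' + N : ℕ) : F) := neg_injective e
    have := Nat.cast_injective (mul_left_cancel₀ alpha_ne e')
    omega
  have hP : P = 0 := by
    refine Polynomial.eq_zero_of_infinite_isRoot P ((Set.infinite_range_of_injective hinj).mono ?_)
    rintro _ ⟨s, rfl⟩
    rw [Set.mem_ofPred_eq, Polynomial.IsRoot, Polynomial.eval_finsetSum]
    rw [← h (s + N) (by omega)]
    refine Finset.sum_congr rfl fun ℓ _ => ?_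
    rw [Polynomial.eval_mul, Polynomial.eval_C, Polynomial.eval_pow, Polynomial.eval_X, mul_comm]
  intro ℓ hℓ
  have := congrArg (fun Q => Polynomial.coeff Q ℓ) hP
  simpa [P, Polynomial.finsetSum_coeff, Polynomial.coeff_C_mul, Polynomial.coeff_X_pow, hℓ] using this

lemma Bmat_wt {n ℓ : ℕ} {m m' : Exp} (h : Bmat n ℓ m m' ≠ 0) : wt m = wt m' + n := by
  by_contra hw
  by_cases hℓ : n < ℓ
  · exact h (by rw [Bmat, Bc_gt hℓ, MvPolynomial.coeff_zero])
  refine h (poly_coeff_zero (n := n + 1) (a := fun ℓ => Bmat n ℓ m m') 0 (fun s _ => ?_) ℓ (by omega))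
  have h1 := congrArg (MvPolynomial.coeff m)
    (BB_eq_sum (-(alpha * s)) n (MvPolynomial.monomial m' 1))
  rw [MvPolynomial.coeff_sum] at h1
  simp only [MvPolynomial.coeff_smul, smul_eq_mul] at h1
  simp only [Bmat]
  rw [h1]
  have : MvPolynomial.coeff m (BB (-(alpha * s)) n (MvPolynomial.monomial m' 1)) = 0 := by
    by_contra hh
    exact hw (mem_Hom.1 (Hom_BB _ n (Hom_monomial m' 1)) m hh)
  rw [this, mul_zero]

end JK

set_option linter.unusedSimpArgs false

namespace JK
open Finset.HasAntidiagonal (antidiagonal)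
open Polynomial (X C monomial)
open MvPolynomial (pderiv rename)

lemma hall_eq_of_subset {f g : SymA} {s : Finset Exp} (h : f.support ⊆ s) :
    hall f g = ∑ m ∈ s, MvPolynomial.coeff m f * MvPolynomial.coeff m g * zalpha m := by
  refine Finset.sum_subset h fun m _ hm => ?_
  rw [MvPolynomial.notMem_support_iff.1 hm, zero_mul, zero_mul]

/-- bilinear version of `hall` -/
def H : SymA →ₗ[F] SymA →ₗ[F] F := LinearMap.mk₂ F hall
  (fun f f' g => by
    rw [hall_eq_of_subset (s := (f + f').support ∪ (f.support ∪ f'.support))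
      Finset.subset_union_left, hall_eq_of_subset (f := f)
      (s := (f + f').support ∪ (f.support ∪ f'.support)) (by intro; simp; tauto),
      hall_eq_of_subset (f := f')
      (s := (f + f').support ∪ (f.support ∪ f'.support)) (by intro; simp; tauto),
      ← Finset.sum_add_distrib]
    refine Finset.sum_congr rfl fun m _ => ?_
    rw [MvPolynomial.coeff_add]; ring)
  (fun c f g => by
    rw [hall_eq_of_subset (f := c • f) (s := (c • f).support ∪ f.support) Finset.subset_union_left,
      hall_eq_of_subset (f := f) (s := (c • f).support ∪ f.support) Finset.subset_union_right,
      Finset.smul_sum]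
    refine Finset.sum_congr rfl fun m _ => ?_
    rw [MvPolynomial.coeff_smul, smul_eq_mul, smul_eq_mul]; ring)
  (fun f g g' => by
    rw [hall, hall, hall, ← Finset.sum_add_distrib]
    refine Finset.sum_congr rfl fun m _ => ?_
    rw [MvPolynomial.coeff_add]; ring)
  (fun c f g => by
    rw [hall, hall, Finset.smul_sum]
    refine Finset.sum_congr rfl fun m _ => ?_
    rw [MvPolynomial.coeff_smul, smul_eq_mul, smul_eq_mul]; ring)

lemma H_eq (f g : SymA) : H f g = hall f g := rfl

lemma H_comm (f g : SymA) : H f g = H g f := by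
  rw [H_eq, H_eq, hall_eq_of_subset (f := f) (s := f.support ∪ g.support) Finset.subset_union_left,
    hall_eq_of_subset (f := g) (s := f.support ∪ g.support) Finset.subset_union_right]
  exact Finset.sum_congr rfl fun m _ => by ring

lemma H_monomial (m : Exp) (a : F) (g : SymA) :
    H (MvPolynomial.monomial m a) g = a * MvPolynomial.coeff m g * zalpha m := by
  rw [H_eq, hall_eq_of_subset (s := {m}) MvPolynomial.support_monomial_subset]
  simp

lemma alg_eq (q : ℚ) : algebraMap ℚ F q = (q : F) := by
  exact eq_ratCast (algebraMap ℚ F) q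

lemma zalpha_eq (m : Exp) : zalpha m
    = m.prod fun i k => (Nat.factorial k : F) * ((i : ℕ) : F) ^ k * alpha ^ k := by
  rw [zalpha, Finsupp.prod, map_prod, Finsupp.sum, ← Finset.prod_pow_eq_pow_sum,
    ← Finset.prod_mul_distrib, Finsupp.prod]
  refine Finset.prod_congr rfl fun i _ => ?_
  rw [map_mul, map_pow, map_natCast, map_natCast]

lemma zalpha_zero : zalpha 0 = 1 := by rw [zalpha_eq]; simp

lemma zalpha_ne (m : Exp) : zalpha m ≠ 0 := by
  rw [zalpha_eq]
  refine Finset.prod_ne_zero_iff.2 fun i _ => ?_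
  refine mul_ne_zero (mul_ne_zero ?_ (pow_ne_zero _ ?_)) (pow_ne_zero _ alpha_ne)
  · exact_mod_cast Nat.factorial_ne_zero _
  · exact_mod_cast i.ne_zero

lemma zalpha_add_single (m : Exp) (k : ℕ+) :
    zalpha (m + Finsupp.single k 1) = zalpha m * ((m k : F) + 1) * (alpha * (k : ℕ)) := by
  have hs : m.support ⊆ insert k m.support := Finset.subset_insert _ _
  have hs' : (m + Finsupp.single k 1).support ⊆ insert k m.support := by
    intro i hi
    by_cases h : i = k
    · simp [h]
    · simp [h] at hi ⊢
      exact hi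
  rw [zalpha_eq, zalpha_eq, Finsupp.prod_of_support_subset _ hs _ (by simp),
    Finsupp.prod_of_support_subset _ hs' _ (by simp),
    ← Finset.mul_prod_erase _ _ (Finset.mem_insert_self k m.support),
    ← Finset.mul_prod_erase _ _ (Finset.mem_insert_self k m.support)]
  have : ∀ i ∈ (insert k m.support).erase k,
      (Nat.factorial ((m + Finsupp.single k 1 : Exp) i) : F) * ((i : ℕ) : F) ^ ((m + Finsupp.single k 1 : Exp) i)
        * alpha ^ ((m + Finsupp.single k 1 : Exp) i)
      = (Nat.factorial (m i) : F) * ((i : ℕ) : F) ^ (m i) * alpha ^ (m i) := by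
    intro i hi
    have : i ≠ k := (Finset.mem_erase.1 hi).1
    simp only [Finsupp.add_apply, Finsupp.single_eq_of_ne this, add_zero]
  rw [Finset.prod_congr rfl this]
  simp only [Finsupp.add_apply, Finsupp.single_eq_same, Nat.factorial_succ]
  push_cast
  ring

lemma H_pp_mul (k : ℕ) (f g : SymA) : H (pp k * f) g = H f ((V g).coeff k) := by
  rcases Nat.eq_zero_or_pos k with rfl | hk
  · rw [pp_zero, zero_mul, coeff_V_zero]; simp
  obtain ⟨k, rfl⟩ : ∃ k' : ℕ+, (k' : ℕ) = k := ⟨⟨k, hk⟩, rfl⟩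
  induction f using MvPolynomial.monomial_add_induction_on with
  | C a =>
    have := H_monomial (Finsupp.single k 1) a g
    rw [pp_pnat, mul_comm, MvPolynomial.C_mul_X_eq_monomial, this, ← MvPolynomial.monomial_zero',
      H_monomial, coeff_V, MvPolynomial.coeff_smul, MvPolynomial.coeff_pderiv, zalpha_zero,
      ← zero_add (Finsupp.single k 1), zalpha_add_single, zalpha_zero, smul_eq_mul]
    simp; ring
  | monomial_add m a f _ _ ih =>
    rw [mul_add, map_add, map_add, LinearMap.add_apply, LinearMap.add_apply, ih, pp_pnat,
      MvPolynomial.X, MvPolynomial.monomial_mul, one_mul, add_comm _ m, H_monomial, H_monomial,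
      coeff_V, MvPolynomial.coeff_smul, MvPolynomial.coeff_pderiv, zalpha_add_single, smul_eq_mul]
    ring

lemma exists_real : ∃ φ : F →+* ℝ, 0 < φ alpha := by
  set x : ℝ := liouvilleNumber ((2 : ℕ) : ℝ) with hx
  have hT : Transcendental ℚ x := by
    have := transcendental_liouvilleNumber (le_refl 2)
    rwa [Transcendental, IsFractionRing.isAlgebraic_iff ℤ ℚ ℝ] at this
  have hinj := transcendental_iff_injective.1 hT
  refine ⟨IsFractionRing.lift (g := (Polynomial.aeval (R := ℚ) x).toRingHom) hinj, ?_⟩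
  have e : alpha = algebraMap (Polynomial ℚ) F Polynomial.X := RatFunc.algebraMap_X.symm
  rw [e, IsFractionRing.lift_algebraMap]
  have : (Polynomial.aeval (R := ℚ) x).toRingHom Polynomial.X = x := Polynomial.aeval_X x
  rw [this]
  have h0 : 0 ≤ x := tsum_nonneg fun i => by positivity
  refine lt_of_le_of_ne h0 fun h => ?_
  rw [← h] at hT
  exact hT isAlgebraic_zero

lemma H_pos {f : SymA} (h : H f f = 0) : f = 0 := by
  obtain ⟨φ, hφ⟩ := exists_real
  have hz : ∀ m, 0 < φ (zalpha m) := by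
    intro m
    rw [zalpha_eq, Finsupp.prod, map_prod]
    refine Finset.prod_pos fun i _ => ?_
    rw [map_mul, map_mul, map_pow, map_pow, map_natCast, map_natCast]
    have : (0 : ℝ) < ((i : ℕ) : ℝ) := by exact_mod_cast i.pos
    have : (0 : ℝ) < (Nat.factorial (m i) : ℝ) := by exact_mod_cast Nat.factorial_pos _
    positivity
  have h1 := congrArg φ h
  rw [H_eq, hall, map_sum, map_zero] at h1
  have h2 := (Finset.sum_eq_zero_iff_of_nonneg (fun m _ => by
    rw [map_mul, map_mul]
    exact mul_nonneg (mul_self_nonneg _) (hz m).le)).1 h1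
  rw [← MvPolynomial.support_eq_empty]
  by_contra hne
  obtain ⟨m, hm⟩ := Finset.nonempty_iff_ne_empty.2 hne
  have h3 := h2 m hm
  rw [map_mul, map_mul] at h3
  have h4 := (mul_eq_zero.1 h3).resolve_right (hz m).ne'
  have h5 := mul_self_eq_zero.1 h4
  exact MvPolynomial.mem_support_iff.1 hm ((map_eq_zero φ).1 h5)

/-- coefficientwise form on `ZA` -/
def hz (x y : ZA) : F := (Polynomial.lsum fun k => H.flip (y.coeff k) : ZA →ₗ[F] F) x

lemma hz_mon (k : ℕ) (f : SymA) (y : ZA) : hz (monomial k f) y = H f (y.coeff k) := by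
  simp [hz, Polynomial.lsum_apply, Polynomial.sum_monomial_index]

lemma hz_add (x x' y : ZA) : hz (x + x') y = hz x y + hz x' y := by rw [hz, hz, hz, map_add]

lemma hz_smul (a : F) (x y : ZA) : hz (a • x) y = a * hz x y := by simp [hz]

lemma hz_add_right (x y y' : ZA) : hz x (y + y') = hz x y + hz x y' := by
  induction x using zind with
  | hadd x x' h h' => rw [hz_add, h, h', hz_add, hz_add]; ring
  | hm k f => simp only [hz_mon, Polynomial.coeff_add, map_add]

lemma hz_comm (x y : ZA) : hz x y = hz y x := by
  induction x using zind with
  | hadd x x' h h' => rw [hz_add, h, h', hz_add_right]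
  | hm k f =>
    rw [hz_mon]
    induction y using zind with
    | hadd y y' h h' => rw [hz_add, ← h, ← h', Polynomial.coeff_add, map_add]
    | hm l g =>
      rw [hz_mon, Polynomial.coeff_monomial, Polynomial.coeff_monomial]
      by_cases h : l = k
      · rw [if_pos h, if_pos h.symm, H_comm]
      · rw [if_neg h, if_neg (Ne.symm h)]; simp

lemma H_rho (x : ZA) (g : SymA) : H (rho x) g = hz x (V g) := by
  induction x using zind with
  | hadd x x' h h' => rw [map_add, map_add, LinearMap.add_apply, h, h', hz_add]
  | hm k f => rw [rho_mon, hz_mon, H_pp_mul]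

lemma coeff_anti (k l : ℕ) (f : SymA) :
    (∑ x ∈ antidiagonal k, monomial x.1 (pp x.2 * f) : ZA).coeff l
      = if l ≤ k then pp (k - l) * f else 0 := by
  rw [Polynomial.finsetSum_coeff]
  simp only [Polynomial.coeff_monomial]
  split_ifs with h
  · rw [Finset.sum_eq_single (l, k - l)]
    · simp
    · intro x hx hne
      have := Finset.HasAntidiagonal.mem_antidiagonal.1 hx
      rw [if_neg]
      intro e
      apply hne
      ext <;> simp <;> omega
    · intro hh
      exact absurd (Finset.HasAntidiagonal.mem_antidiagonal.2 (by simp; omega)) hh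
  · refine Finset.sum_eq_zero fun x hx => ?_
    have := Finset.HasAntidiagonal.mem_antidiagonal.1 hx
    rw [if_neg (by omega)]

lemma hz_L (x y : ZA) : hz (L x) y = hz x (L y) := by
  induction x using zind with
  | hadd x x' h h' => rw [map_add, hz_add, h, h', hz_add]
  | hm k f =>
    induction y using zind with
    | hadd y y' h h' => rw [map_add, hz_add_right, h, h', hz_add_right]
    | hm l g =>
      rw [hz_comm, hz_mon, hz_mon, L_mon, L_mon]
      simp only [Polynomial.coeff_add, coeff_anti, Polynomial.coeff_X_pow_mul',
        Polynomial.coeff_smul, Polynomial.coeff_monomial, map_add]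
      rcases lt_trichotomy k l with h | h | h
      · rw [if_pos h.le, if_neg (by omega), if_neg (by omega), if_neg (by omega), if_pos h.le,
          if_neg (by omega)]
        simp only [map_zero, smul_zero, add_zero, zero_add]
        rw [H_comm f, H_pp_mul]
      · subst h
        simp [coeff_V_zero, H_comm f g]
      · rw [if_neg (by omega), if_pos h.le, if_neg (by omega), if_pos h.le, if_neg (by omega),
          if_neg (by omega)]
        simp only [map_zero, smul_zero, add_zero, zero_add]
        rw [H_comm g, H_pp_mul]

lemma H_D (f g : SymA) : H (D f) g = H f (D g) := by
  have h1 : ∀ f g, H (rho (L (V f))) g = H f (rho (L (V g))) := by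
    intro f g
    rw [H_rho, hz_L, hz_comm, ← H_rho, H_comm]
  have h2 : ∀ f g, H (rho (V f)) g = H f (rho (V g)) := by
    intro f g
    rw [H_rho, hz_comm, ← H_rho, H_comm]
  rw [D_apply, D_apply]
  simp only [map_smul, map_sub, LinearMap.smul_apply, LinearMap.sub_apply, h1, h2]

/-- adjoint of `ρ z V` -/
def A1t (g : SymA) : SymA := rho (Polynomial.divX (V g))

lemma hz_X (x y : ZA) : hz (X * x) y = hz x y.divX := by
  induction x using zind with
  | hadd x x' h h' => rw [mul_add, hz_add, h, h', hz_add]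
  | hm k f => rw [Polynomial.X_mul_monomial, hz_mon, hz_mon, Polynomial.coeff_divX]

lemma H_A1 (f g : SymA) : H (rho (X * V f)) g = H f (A1t g) := by
  rw [H_rho, hz_X, hz_comm, ← H_rho, H_comm, A1t]

lemma A1t_mul (f g : SymA) : A1t (f * g) = f * A1t g + g * A1t f := by
  rw [A1t, V_mul, Polynomial.divX_add, map_add, Polynomial.divX_C_mul, Polynomial.divX_C_mul,
    rho_C_mul, rho_C_mul, A1t, A1t]

lemma A1t_pp (k : ℕ) : A1t (pp (k + 1)) = (alpha * ((k : F) + 1)) • pp k := by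
  have : Polynomial.divX (monomial (k + 1) (cF (alpha * ((k + 1 : ℕ) : F)))) =
      monomial k (cF (alpha * ((k + 1 : ℕ) : F))) := by
    ext1 n
    rw [Polynomial.coeff_divX, Polynomial.coeff_monomial, Polynomial.coeff_monomial]
    simp
  rw [A1t, V_pp, this, rho_mon, smul_eq_cF, mul_comm]
  push_cast; rfl

end JK

set_option linter.unusedSimpArgs false

namespace JK
open Finset.HasAntidiagonal (antidiagonal)
open Polynomial (X C monomial)
open MvPolynomial (pderiv rename)

/-! ### Combinatorics of partitions -/

lemma take_le (a : ℕ) (l : List ℕ) (h : ∀ b ∈ l, b ≤ a) (k : ℕ) :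
    (l.take (k + 1)).sum ≤ a + (l.take k).sum := by
  induction l generalizing k with
  | nil => simp
  | cons b t ih =>
    cases k with
    | zero => simpa using h b (by simp)
    | succ k =>
      have := ih (fun b hb => h b (by simp [hb])) k
      simp only [List.take_succ_cons, List.sum_cons]
      omega

lemma take_insert (a : ℕ) (l : List ℕ) (hl : l.Pairwise (· ≥ ·)) (k : ℕ) :
    ((l.orderedInsert (· ≥ ·) a).take (k + 1)).sum
      = max ((l.take (k + 1)).sum) (a + (l.take k).sum) := by
  induction l generalizing k with
  | nil => simp
  | cons b t ih =>
    rw [List.orderedInsert_cons]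
    split_ifs with h
    · rw [List.take_succ_cons, List.sum_cons, max_eq_right]
      refine take_le a _ (fun c hc => ?_) k
      rcases List.mem_cons.1 hc with rfl | hc
      · exact h
      · exact ((List.pairwise_cons.1 hl).1 c hc).trans h
    · cases k with
      | zero => simp; omega
      | succ k =>
        have := ih (List.pairwise_cons.1 hl).2 k
        simp only [List.take_succ_cons, List.sum_cons] at this ⊢
        rw [this]
        omega

lemma sP_sorted (l : JPartition) : (sortedParts l).Pairwise (· ≥ ·) := by
  rw [sortedParts, List.pairwise_reverse]
  exact Multiset.pairwise_sort _ _

lemma sP_coe (l : JPartition) : ((sortedParts l : List ℕ) : Multiset ℕ) = l.map fun i : ℕ+ => (i : ℕ) := by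
  rw [sortedParts, Multiset.coe_reverse, Multiset.sort_eq]
  simp [Multiset.bind_def, Multiset.pure_def]

lemma sP_uniq (l : JPartition) (L : List ℕ) (h : L.Pairwise (· ≥ ·))
    (h' : (L : Multiset ℕ) = l.map fun i : ℕ+ => (i : ℕ)) : sortedParts l = L := by
  refine List.Perm.eq_of_pairwise (fun a b _ _ h1 h2 => le_antisymm h2 h1) (sP_sorted l) h ?_
  rw [← Multiset.coe_eq_coe, sP_coe, h']

lemma sP_cons (a : ℕ+) (l : JPartition) :
    sortedParts (a ::ₘ l) = (sortedParts l).orderedInsert (· ≥ ·) (a : ℕ) := by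
  refine sP_uniq _ _ ((sP_sorted l).orderedInsert _ _) ?_
  rw [Multiset.map_cons, ← sP_coe l, Multiset.cons_coe, Multiset.coe_eq_coe]
  exact List.perm_orderedInsert _ _ _

lemma topSum_cons (a : ℕ+) (l : JPartition) (k : ℕ) :
    topSum (a ::ₘ l) (k + 1) = max (topSum l (k + 1)) (a + topSum l k) := by
  rw [topSum, sP_cons, take_insert _ _ (sP_sorted l)]; rfl

lemma topSum_zero (l : JPartition) : topSum l 0 = 0 := by simp [topSum]

/-- all parts are at most `s` -/
def ple (l : JPartition) (s : ℕ) : Prop := ∀ i ∈ l, (i : ℕ) ≤ s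

lemma not_ple {l : JPartition} {s : ℕ} : ¬ ple l s ↔ ∃ i ∈ l, s < (i : ℕ) := by
  simp [ple]

lemma mem_sP {l : JPartition} {a : ℕ} : a ∈ sortedParts l ↔ ∃ i ∈ l, (i : ℕ) = a := by
  rw [← Multiset.mem_coe, sP_coe, Multiset.mem_map]

lemma sP_cons_max (s : ℕ+) (l : JPartition) (h : ple l s) :
    sortedParts (s ::ₘ l) = (s : ℕ) :: sortedParts l := by
  refine sP_uniq _ _ (List.pairwise_cons.2 ⟨fun b hb => ?_, sP_sorted l⟩) ?_
  · obtain ⟨i, hi, rfl⟩ := mem_sP.1 hb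
    exact h i hi
  · rw [Multiset.map_cons, ← sP_coe l, Multiset.cons_coe]

lemma sP_zero : sortedParts 0 = [] := by simp [sortedParts]

lemma psize_map (l : JPartition) : psize l = (l.map fun i : ℕ+ => (i : ℕ)).sum := by
  rw [psize]; simp [Multiset.bind_def, Multiset.pure_def]

lemma sP_sum (l : JPartition) : (sortedParts l).sum = psize l := by
  rw [psize_map, ← sP_coe, Multiset.sum_coe]

lemma topSum_one_le {l : JPartition} {s : ℕ} : topSum l 1 ≤ s ↔ ple l s := by
  induction l using Multiset.induction with
  | empty => simp [topSum, sP_zero, ple]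
  | cons a l ih =>
    have := topSum_cons a l 0
    rw [zero_add] at this
    rw [this, topSum_zero, max_le_iff, ih]
    simp [ple, and_comm]

lemma part_ind {P : JPartition → Prop} (h0 : P 0)
    (h1 : ∀ (s : ℕ+) (l : JPartition), ple l s → P l → P (s ::ₘ l)) (l : JPartition) : P l := by
  induction hn : Multiset.card l generalizing l with
  | zero => rw [Multiset.card_eq_zero.1 hn]; exact h0
  | succ n ih =>
    have hne : l.toFinset.Nonempty := by
      rw [Multiset.toFinset_nonempty]
      rintro rfl
      simp at hn
    obtain ⟨s, hs, hm⟩ := l.toFinset.exists_max_image id hne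
    obtain ⟨l', rfl⟩ := Multiset.exists_cons_of_mem (Multiset.mem_toFinset.1 hs)
    refine h1 s l' (fun i hi => ?_) (ih l' (by simpa using hn))
    have := hm i (Multiset.mem_toFinset.2 (Multiset.mem_cons_of_mem hi))
    exact_mod_cast this

lemma part_cases (l : JPartition) : l = 0 ∨ ∃ (s : ℕ+) (l' : JPartition), ple l' s ∧ l = s ::ₘ l' :=
  part_ind (P := fun l => l = 0 ∨ ∃ (s : ℕ+) (l' : JPartition), ple l' s ∧ l = s ::ₘ l')
    (Or.inl rfl) (fun s l' h _ => Or.inr ⟨s, l', h, rfl⟩) l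

/-- add a possibly zero part -/
def consx (n : ℕ) (l : JPartition) : JPartition := if h : 0 < n then (⟨n, h⟩ : ℕ+) ::ₘ l else l

lemma consx_zero (l : JPartition) : consx 0 l = l := by simp [consx]
lemma consx_pnat (n : ℕ+) (l : JPartition) : consx n l = n ::ₘ l := dif_pos n.pos

lemma nat_cases (n : ℕ) : n = 0 ∨ ∃ k : ℕ+, n = k := by
  rcases Nat.eq_zero_or_pos n with h | h
  · exact Or.inl h
  · exact Or.inr ⟨⟨n, h⟩, rfl⟩

lemma topSum_le_succ (l : JPartition) (k : ℕ) : topSum l k ≤ topSum l (k + 1) := by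
  rw [topSum, topSum, List.take_add_one]; simp

lemma topSum_consx (a : ℕ) (l : JPartition) (k : ℕ) :
    topSum (consx a l) (k + 1) = max (topSum l (k + 1)) (a + topSum l k) := by
  rcases nat_cases a with rfl | ⟨a, rfl⟩
  · rw [consx_zero, zero_add, max_eq_left (topSum_le_succ l k)]
  · rw [consx_pnat, topSum_cons]

lemma psize_consx (a : ℕ) (l : JPartition) : psize (consx a l) = a + psize l := by
  rcases nat_cases a with rfl | ⟨a, rfl⟩
  · rw [consx_zero, zero_add]
  · rw [consx_pnat, psize_cons]

lemma dom_refl (l : JPartition) : dominates l l := ⟨rfl, fun _ => le_rfl⟩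

lemma dom_trans {a b c : JPartition} (h : dominates a b) (h' : dominates b c) : dominates a c :=
  ⟨h.1.trans h'.1, fun k => (h.2 k).trans (h'.2 k)⟩

lemma dom_cons (a : ℕ+) {m l : JPartition} (h : dominates m l) :
    dominates (a ::ₘ m) (a ::ₘ l) := by
  refine ⟨by rw [psize_cons, psize_cons, h.1], fun k => ?_⟩
  cases k with
  | zero => simp [topSum_zero]
  | succ k =>
    rw [topSum_cons, topSum_cons]
    exact max_le_max (h.2 _) (Nat.add_le_add_left (h.2 _) _)

lemma dom_raise (s b j : ℕ) (hb : b ≤ s) (hj : j ≤ b) (l : JPartition) :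
    dominates (consx s (consx b l)) (consx (s + j) (consx (b - j) l)) := by
  refine ⟨by simp only [psize_consx]; omega, fun k => ?_⟩
  cases k with
  | zero => simp [topSum_zero]
  | succ k =>
    rw [topSum_consx, topSum_consx, topSum_consx, topSum_consx]
    cases k with
    | zero => simp only [topSum_zero]; omega
    | succ k => rw [topSum_consx, topSum_consx]; omega

lemma list_eq_of_take : ∀ (l l' : List ℕ), (∀ a ∈ l, 0 < a) → (∀ a ∈ l', 0 < a) →
    (∀ k, (l.take k).sum = (l'.take k).sum) → l = l'
  | [], [], _, _, _ => rfl
  | [], b :: t, _, h, h' => by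
    have := h' 1
    have := h b (by simp)
    simp at *; omega
  | b :: t, [], h, _, h' => by
    have := h' 1
    have := h b (by simp)
    simp at *; omega
  | a :: t, b :: t', h1, h2, h => by
    have h0 := h 1
    simp at h0
    subst h0
    rw [list_eq_of_take t t' (fun a ha => h1 a (by simp [ha])) (fun a ha => h2 a (by simp [ha]))
      (fun k => by
        have := h (k + 1)
        simp only [List.take_succ_cons, List.sum_cons] at this
        omega)]

lemma sP_inj {l m : JPartition} (h : sortedParts l = sortedParts m) : l = m := by
  have h1 := sP_coe l
  rw [h, sP_coe] at h1
  exact (Multiset.map_injective (fun a b h => PNat.coe_injective h) h1).symm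

lemma sP_pos (l : JPartition) : ∀ a ∈ sortedParts l, 0 < a := by
  intro a ha
  obtain ⟨i, _, rfl⟩ := mem_sP.1 ha
  exact i.pos

lemma dom_antisymm {l m : JPartition} (h : dominates l m) (h' : dominates m l) : l = m :=
  sP_inj (list_eq_of_take _ _ (sP_pos l) (sP_pos m) fun k => le_antisymm (h.2 k) (h'.2 k))

lemma dom_ple {m l : JPartition} {s : ℕ} (h : dominates m l) (hl : ple l s) : ple m s :=
  topSum_one_le.1 ((h.2 1).trans (topSum_one_le.2 hl))

/-- `n(λ)` for lists -/
def nL : List ℕ → ℕ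
  | [] => 0
  | _ :: l => l.sum + nL l

lemma nL_eq (l : List ℕ) (M : ℕ) (h : l.length ≤ M) :
    nL l + ∑ k ∈ Finset.range M, (l.take (k + 1)).sum = M * l.sum := by
  induction l generalizing M with
  | nil => simp [nL]
  | cons a t ih =>
    cases M with
    | zero => simp at h
    | succ M =>
      have := ih M (by simpa using h)
      have e : ∑ k ∈ Finset.range (M + 1), (t.take k).sum = ∑ k ∈ Finset.range M, (t.take (k + 1)).sum := by
        rw [Finset.sum_range_succ']; simp
      simp only [nL, List.take_succ_cons, List.sum_cons, Finset.sum_add_distrib, e,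
        Finset.sum_const, Finset.card_range, smul_eq_mul]
      nlinarith

/-- `∑ λ_i (λ_i-1)/2` -/
def aL (l : List ℕ) : ℕ := (l.map fun i => i.choose 2).sum

/-- eigenvalue -/
def ee (l : JPartition) : F := alpha * (aL (sortedParts l) : F) - (nL (sortedParts l) : F)

lemma ee_zero : ee 0 = 0 := by simp [ee, sP_zero, aL, nL]

lemma ee_cons (s : ℕ+) (l : JPartition) (h : ple l s) :
    ee (s ::ₘ l) = alpha * ((s : ℕ).choose 2 : F) + ee l - (psize l : F) := by
  rw [ee, ee, sP_cons_max s l h, ← sP_sum]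
  simp only [aL, nL, List.map_cons, List.sum_cons]
  push_cast
  ring

lemma alpha_lin {a b : ℚ} (h : alpha * (a : F) + (b : F) = 0) : b = 0 := by
  have h1 : algebraMap (Polynomial ℚ) F (Polynomial.X * Polynomial.C a + Polynomial.C b) = 0 := by
    rw [map_add, map_mul, RatFunc.algebraMap_X, RatFunc.algebraMap_C, RatFunc.algebraMap_C]
    have e : ∀ q : ℚ, RatFunc.C q = (q : F) := fun q => eq_ratCast (RatFunc.C : ℚ →+* F) q
    rw [e, e]; exact h
  have h2 := (map_eq_zero_iff _ (RatFunc.algebraMap_injective ℚ)).1 h1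
  have h3 := congrArg (fun p => Polynomial.coeff p 0) h2
  simpa using h3

lemma nL_of_ee {l m : JPartition} (h : ee l = ee m) : nL (sortedParts l) = nL (sortedParts m) := by
  have : alpha * (((aL (sortedParts l) : ℚ) - (aL (sortedParts m) : ℚ) : ℚ) : F)
      + (((nL (sortedParts m) : ℚ) - (nL (sortedParts l) : ℚ) : ℚ) : F) = 0 := by
    rw [ee, ee] at h
    push_cast
    linear_combination h
  have := alpha_lin this
  have : (nL (sortedParts m) : ℚ) = (nL (sortedParts l) : ℚ) := by linarith
  exact_mod_cast this.symm

lemma eq_of_ee {l m : JPartition} (hd : dominates l m) (h : ee l = ee m) : l = m := by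
  have h1 := nL_of_ee h
  set M := (sortedParts l).length + (sortedParts m).length with hM
  have a1 := nL_eq (sortedParts l) M (by omega)
  have a2 := nL_eq (sortedParts m) M (by omega)
  rw [sP_sum] at a1 a2
  have hs : ∑ k ∈ Finset.range M, topSum l (k + 1) = ∑ k ∈ Finset.range M, topSum m (k + 1) := by
    have := hd.1
    rw [this] at a1
    simp only [topSum]
    omega
  have hk := (Finset.sum_eq_sum_iff_of_le (fun k _ => hd.2 (k + 1))).1 hs
  refine sP_inj (list_eq_of_take _ _ (sP_pos l) (sP_pos m) fun k => ?_)
  cases k with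
  | zero => simp
  | succ k =>
    by_cases hkM : k < M
    · exact hk k (Finset.mem_range.2 hkM)
    · rw [List.take_of_length_le (by omega), List.take_of_length_le (by omega), sP_sum, sP_sum, hd.1]

/-- the content polynomial -/
def cL (u : F) : List ℕ → F
  | [] => 1
  | s :: l => (∏ j ∈ Finset.range s, (u + alpha * (j : F))) * cL (u - 1) l

def cc (u : F) (l : JPartition) : F := cL u (sortedParts l)

lemma cc_zero (u : F) : cc u 0 = 1 := by simp [cc, sP_zero, cL]

lemma cc_cons (u : F) (s : ℕ+) (l : JPartition) (h : ple l s) :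
    cc u (s ::ₘ l) = (∏ j ∈ Finset.range s, (u + alpha * (j : F))) * cc (u - 1) l := by
  rw [cc, sP_cons_max s l h]; rfl

lemma cc_ne (u : F) (s : ℕ) (k : ℕ) (hu : u = -(alpha * (s : F)) - (k : F)) (l : JPartition) (h : ple l s) :
    cc u l ≠ 0 := by
  induction l using part_ind generalizing u k with
  | h0 => rw [cc_zero]; exact one_ne_zero
  | h1 r l hl ih =>
    rw [cc_cons u r l hl]
    refine mul_ne_zero (Finset.prod_ne_zero_iff.2 fun j hj => ?_)
      (ih (u - 1) (k + 1) (by rw [hu]; push_cast; ring) fun i hi => h i (Multiset.mem_cons_of_mem hi))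
    have hj := Finset.mem_range.1 hj
    have hr := h r (Multiset.mem_cons_self _ _)
    rw [hu]
    intro e
    have e1 : alpha * (((j : ℚ) - (s : ℚ) : ℚ) : F) + ((-(k : ℚ) : ℚ) : F) = 0 := by
      push_cast; linear_combination e
    have e2 := alpha_lin e1
    have e3 : (k : F) = 0 := by
      have : (k : ℚ) = 0 := by linarith
      exact_mod_cast congrArg (fun q : ℚ => (q : F)) this
    rw [e3] at e
    have e4 : alpha * ((j : F) - (s : F)) = 0 := by linear_combination e
    have e5 := (mul_eq_zero.1 e4).resolve_left alpha_ne
    have e6 : (j : F) = (s : F) := by linear_combination e5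
    have : j = s := by exact_mod_cast e6
    omega

lemma cc_eq_zero (s : ℕ) (l : JPartition) (h : ¬ ple l s) : cc (-(alpha * (s : F))) l = 0 := by
  rcases part_cases l with rfl | ⟨r, l', hl, rfl⟩
  · exact absurd (by simp [ple]) h
  · rw [cc_cons _ _ _ hl]
    have : s < (r : ℕ) := by
      by_contra hr
      apply h
      intro i hi
      rcases Multiset.mem_cons.1 hi with rfl | hi
      · omega
      · exact (hl i hi).trans (by omega)
    rw [Finset.prod_eq_zero (Finset.mem_range.2 this) (by ring), zero_mul]

lemma finite_psize (n : ℕ) : {l : JPartition | psize l = n}.Finite := by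
  have : Function.Injective (fun l : {l : JPartition | psize l = n} =>
      (⟨l.1.map (fun i : ℕ+ => (i : ℕ)), fun {i} hi => by
        obtain ⟨j, _, rfl⟩ := Multiset.mem_map.1 hi
        exact j.pos, (psize_map l.1).symm.trans l.2⟩ : Nat.Partition n)) := by
    intro a b h
    have h1 := congrArg Nat.Partition.parts h
    exact Subtype.ext (Multiset.map_injective (fun a b h => PNat.coe_injective h) h1)
  exact Finite.of_injective _ this

lemma ple_of_psize {l : JPartition} {s : ℕ} (h : psize l ≤ s) : ple l s := by
  intro i hi
  obtain ⟨l', rfl⟩ := Multiset.exists_cons_of_mem hi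
  rw [psize_cons] at h
  omega

end JK

set_option linter.unusedSimpArgs false

namespace JK
open Finset.HasAntidiagonal (antidiagonal)
open Polynomial (X C monomial)
open MvPolynomial (pderiv rename)

/-! ### The one-row functions `g_n` -/

def gg : ℕ → SymA
  | 0 => 1
  | n + 1 => (alpha * ((n : F) + 1))⁻¹ • ∑ i : Fin (n + 1), pp (n + 1 - i) * gg i

lemma gg_zero : gg 0 = 1 := by rw [gg]

lemma an_ne (n : ℕ) : alpha * ((n : F) + 1) ≠ 0 :=
  mul_ne_zero alpha_ne (by exact_mod_cast Nat.succ_ne_zero n)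

lemma gg_rec (n : ℕ) : ∑ x ∈ antidiagonal n, pp x.1 * gg x.2 = (alpha * (n : F)) • gg n := by
  rw [Finset.Nat.sum_antidiagonal_eq_sum_range_succ (fun i j => pp i * gg j),
    ← Finset.sum_range_reflect]
  cases n with
  | zero => simp [pp_zero]
  | succ n =>
    rw [Finset.sum_range_succ]
    have e : n + 1 + 1 - 1 - (n + 1) = 0 := by omega
    rw [e, pp_zero, zero_mul, add_zero, gg, smul_smul]
    push_cast
    rw [mul_inv_cancel₀ (an_ne n), one_smul, Finset.sum_range]
    refine Finset.sum_congr rfl fun i _ => ?_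
    have := i.2
    congr 2; omega

/-- `x_n = ∑ z^i g_{n-i}` -/
def xx (n : ℕ) : ZA := C (gg n) + V (gg n)

def zz (i : ℕ) : ZA := if i = 0 then 0 else X ^ i

lemma V_gg_sum (n : ℕ) : V (gg n) = ∑ x ∈ antidiagonal n, zz x.1 * C (gg x.2) := by
  induction n using Nat.strong_induction_on with
  | _ n ih =>
    rcases Nat.eq_zero_or_pos n with rfl | hn
    · simp [gg_zero, zz]
    set Zs : PowerSeries ZA := PowerSeries.mk zz
    set Gs : PowerSeries ZA := PowerSeries.mk fun n => C (gg n)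
    set Ps : PowerSeries ZA := PowerSeries.mk fun n => C (pp n)
    set Es : PowerSeries ZA := PowerSeries.mk fun n => (alpha * (n : F)) • C (gg n)
    have hPG : Ps * Gs = Es := by
      ext1 m
      rw [PowerSeries.coeff_mul]
      simp only [Ps, Gs, Es, PowerSeries.coeff_mk, ← map_mul]
      rw [← map_sum, gg_rec, smul_eq_cF, smul_eq_CcF, map_mul]
    have h1 := congrArg V (gg_rec n)
    rw [V_smul, map_sum] at h1
    have h2 : ∑ x ∈ antidiagonal n, V (pp x.1 * gg x.2)
        = ∑ x ∈ antidiagonal n, (C (pp x.1) * PowerSeries.coeff x.2 (Zs * Gs)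
          + (alpha * (x.1 : F)) • (zz x.1 * C (gg x.2))) := by
      refine Finset.sum_congr rfl fun x hx => ?_
      have hx := Finset.HasAntidiagonal.mem_antidiagonal.1 hx
      rw [V_mul]
      by_cases h0 : x.1 = 0
      · rw [h0, pp_zero]; simp
      · rw [ih x.2 (by omega), PowerSeries.coeff_mul]
        simp only [Zs, Gs, PowerSeries.coeff_mk]
        rw [V_pp', zz, if_neg h0, smul_eq_CcF, smul_eq_CcF]
        ring
    have h3 : ∑ x ∈ antidiagonal n, C (pp x.1) * PowerSeries.coeff x.2 (Zs * Gs)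
        = ∑ x ∈ antidiagonal n, (alpha * (x.2 : F)) • (zz x.1 * C (gg x.2)) := by
      have : ∑ x ∈ antidiagonal n, C (pp x.1) * PowerSeries.coeff x.2 (Zs * Gs)
          = PowerSeries.coeff n (Ps * (Zs * Gs)) := by
        rw [PowerSeries.coeff_mul]; simp only [Ps, PowerSeries.coeff_mk]
      rw [this, mul_left_comm, hPG, PowerSeries.coeff_mul]
      refine Finset.sum_congr rfl fun x _ => ?_
      simp only [Zs, Es, PowerSeries.coeff_mk]
      rw [mul_smul_comm]
    rw [h2, Finset.sum_add_distrib, h3, ← Finset.sum_add_distrib] at h1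
    have h4 : ∑ x ∈ antidiagonal n, ((alpha * (x.2 : F)) • (zz x.1 * C (gg x.2))
        + (alpha * (x.1 : F)) • (zz x.1 * C (gg x.2)))
        = (alpha * (n : F)) • ∑ x ∈ antidiagonal n, zz x.1 * C (gg x.2) := by
      rw [Finset.smul_sum]
      refine Finset.sum_congr rfl fun x hx => ?_
      have hx := Finset.HasAntidiagonal.mem_antidiagonal.1 hx
      rw [← add_smul, ← hx]
      push_cast
      congr 1; ring
    rw [h4] at h1
    have hne : alpha * (n : F) ≠ 0 := mul_ne_zero alpha_ne (by exact_mod_cast hn.ne')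
    have h5 := congrArg (fun y => (alpha * (n : F))⁻¹ • y) h1
    simp only [smul_smul, inv_mul_cancel₀ hne, one_smul] at h5
    exact h5.symm

lemma V_gg_succ (n : ℕ) : V (gg (n + 1)) = X * xx n := by
  rw [xx, V_gg_sum, V_gg_sum, Finset.Nat.antidiagonal_succ, Finset.sum_cons, Finset.sum_map]
  simp only [zz, if_pos, zero_mul, zero_add, Function.Embedding.prodMap,
    Function.Embedding.coeFn_mk, Prod.map, Function.Embedding.refl_apply, Nat.succ_ne_zero, if_false,
    Nat.succ_eq_add_one]
  have : ∀ x ∈ antidiagonal n, (X : ZA) ^ (x.1 + 1) * C (gg x.2)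
      = X * ((if x.1 = 0 then C (gg n) else 0) + (if x.1 = 0 then 0 else X ^ x.1) * C (gg x.2)) := by
    intro x hx
    have hx := Finset.HasAntidiagonal.mem_antidiagonal.1 hx
    by_cases h : x.1 = 0
    · have : x.2 = n := by omega
      simp [h, this]
    · simp [h, pow_succ]; ring
  rw [Finset.sum_congr rfl this, ← Finset.mul_sum, Finset.sum_add_distrib]
  congr 2
  rw [Finset.sum_eq_single (0, n)]
  · simp
  · intro x hx hne
    have hx := Finset.HasAntidiagonal.mem_antidiagonal.1 hx
    rw [if_neg]
    intro h
    apply hne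
    ext <;> simp <;> omega
  · intro h
    exact absurd (Finset.HasAntidiagonal.mem_antidiagonal.2 (by simp)) h

lemma V_gg_zero : V (gg 0) = 0 := by rw [gg_zero]; simp

lemma rho_V_gg (n : ℕ) : rho (V (gg n)) = (alpha * (n : F)) • gg n := by
  rw [← gg_rec, V_gg_sum, map_sum]
  refine Finset.sum_congr rfl fun x _ => ?_
  rw [mul_comm, rho_C_mul, zz]
  split_ifs with h
  · rw [h, pp_zero]; simp
  · rw [← Polynomial.monomial_one_right_eq_X_pow, rho_mon]; ring

lemma xx_succ (n : ℕ) : xx (n + 1) = C (gg (n + 1)) + X * xx n := by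
  rw [xx, V_gg_succ]

lemma rho_X_xx (n : ℕ) : rho (X * xx n) = (alpha * ((n : F) + 1)) • gg (n + 1) := by
  rw [← V_gg_succ, rho_V_gg]; push_cast; rfl

lemma L_xx (n : ℕ) : L (xx n) = (alpha * (n : F)) • xx n := by
  induction n with
  | zero =>
    have := L_C 1
    simp only [map_one] at this
    simp [xx, V_gg_zero, gg_zero, this]
  | succ n ih =>
    rw [xx_succ, map_add, L_X_mul, L_C, ih, rho_X_xx, V_gg_succ]
    have e : (cF (alpha * ((n + 1 : ℕ) : F)) : SymA) = cF alpha * (cF (n : F) + 1) := by simp [cF]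
    have e' : (cF (alpha * ((n : F) + 1)) : SymA) = cF alpha * (cF (n : F) + 1) := by simp [cF]
    have e2 : (cF (alpha * (n : F)) : SymA) = cF alpha * cF (n : F) := by simp [cF]
    have e'' : (cF (alpha - 1) : SymA) = cF alpha - 1 := by simp [cF]
    rw [smul_eq_CcF, smul_eq_cF, smul_eq_CcF, smul_eq_CcF, e, e', e'', e2]
    simp only [map_add, map_sub, map_one, map_mul]
    ring

lemma D_gg (n : ℕ) : D (gg n) = (alpha * (n.choose 2 : F)) • gg n := by
  have h : L (V (gg n)) = (alpha * (n : F)) • xx n - V (gg n) := by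
    have := L_xx n
    rw [← this, xx, map_add, L_C]; ring
  rw [D_apply, h, map_sub, map_smul, xx, map_add, rho_C, zero_add, rho_V_gg, Nat.cast_choose_two]
  simp only [smul_smul, ← sub_smul]
  congr 1
  have := alpha_ne
  field_simp
  ring

lemma cross_rec (a b : ℕ) : rho (V (gg a) * V (gg (b + 1))) = rho (V (gg (a + 1)) * V (gg b))
    + (alpha * ((a : F) + 1)) • (gg (a + 1) * gg b) - (alpha * ((b : F) + 1)) • (gg a * gg (b + 1)) := by
  have h1 := rho_X_xx a
  have h2 := rho_X_xx b
  have h3 : rho (C (gg b) * (X * xx a)) = gg b * rho (X * xx a) := rho_C_mul _ _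
  have h4 : rho (C (gg a) * (X * xx b)) = gg a * rho (X * xx b) := rho_C_mul _ _
  have e : V (gg a) * V (gg (b + 1)) = V (gg (a + 1)) * V (gg b) + C (gg b) * (X * xx a)
      - C (gg a) * (X * xx b) := by
    rw [V_gg_succ, V_gg_succ, xx, xx]; ring
  rw [e, map_sub, map_add, h3, h4, h1, h2, mul_smul_comm, mul_smul_comm, mul_comm (gg b)]

/-- the product `g_μ` -/
def gP (l : JPartition) : SymA := (l.map fun i : ℕ+ => gg i).prod

lemma gP_zero : gP 0 = 1 := by simp [gP]
lemma gP_cons (a : ℕ+) (l : JPartition) : gP (a ::ₘ l) = gg a * gP l := by simp [gP]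
lemma gP_consx (a : ℕ) (l : JPartition) : gP (consx a l) = gg a * gP l := by
  rcases nat_cases a with rfl | ⟨a, rfl⟩
  · rw [consx_zero, gg_zero, one_mul]
  · rw [consx_pnat, gP_cons]
lemma gP_add (l m : JPartition) : gP (l + m) = gP l * gP m := by simp [gP]

lemma cross_mem (b a : ℕ) : alpha⁻¹ • rho (V (gg a) * V (gg b)) + (b : F) • (gg a * gg b)
    ∈ Submodule.span F {f | ∃ j, 1 ≤ j ∧ j ≤ b ∧ f = gg (a + j) * gg (b - j)} := by
  induction b generalizing a with
  | zero => simp [V_gg_zero]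
  | succ b ih =>
    have h := ih (a + 1)
    have e : alpha⁻¹ • rho (V (gg a) * V (gg (b + 1))) + ((b + 1 : ℕ) : F) • (gg a * gg (b + 1))
        = (alpha⁻¹ • rho (V (gg (a + 1)) * V (gg b)) + (b : F) • (gg (a + 1) * gg b))
          + (((a : F) + 1) - b) • (gg (a + 1) * gg b) := by
      rw [cross_rec]
      simp only [smul_add, smul_sub, smul_smul]
      rw [← mul_assoc, ← mul_assoc, inv_mul_cancel₀ alpha_ne, one_mul, one_mul, sub_smul]
      push_cast
      abel
    rw [e]
    refine add_mem (Submodule.span_mono ?_ h)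
      (Submodule.smul_mem _ _ (Submodule.subset_span ⟨1, le_rfl, by omega, by simp⟩))
    rintro f ⟨j, h1, h2, rfl⟩
    refine ⟨j + 1, by omega, by omega, ?_⟩
    congr 2 <;> omega

/-- span of `g_μ` of size `n` -/
def GS (n : ℕ) : Submodule F SymA := Submodule.span F (gP '' {l | psize l = n})

lemma GS_mul {m n : ℕ} {f g : SymA} (hf : f ∈ GS m) (hg : g ∈ GS n) : f * g ∈ GS (m + n) := by
  have := Submodule.mul_mem_mul hf hg
  rw [GS, GS, Submodule.span_mul_span] at this
  refine Submodule.span_mono ?_ this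
  rintro _ ⟨_, ⟨l, hl, rfl⟩, _, ⟨l', hl', rfl⟩, rfl⟩
  refine ⟨l + l', ?_, gP_add _ _⟩
  simp only [Set.mem_ofPred_eq] at hl hl' ⊢
  rw [psize_add, hl, hl']

lemma GS_gg (n : ℕ) : gg n ∈ GS n := by
  refine Submodule.subset_span ⟨consx n 0, ?_, by rw [gP_consx, gP_zero, mul_one]⟩
  simp [psize_consx]

lemma GS_pp (n : ℕ) : pp n ∈ GS n := by
  induction n using Nat.strong_induction_on with
  | _ n ih =>
    have h := gg_rec n
    have hmem : (n, 0) ∈ antidiagonal n := Finset.HasAntidiagonal.mem_antidiagonal.2 (by simp)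
    rw [← Finset.add_sum_erase _ _ hmem] at h
    simp only [gg_zero, mul_one] at h
    rw [eq_sub_of_add_eq h]
    refine sub_mem (Submodule.smul_mem _ _ (GS_gg n)) (Submodule.sum_mem _ fun x hx => ?_)
    obtain ⟨h1, h2⟩ := Finset.mem_erase.1 hx
    have h2 := Finset.HasAntidiagonal.mem_antidiagonal.1 h2
    have : x.1 < n := by
      by_contra hc
      apply h1
      ext <;> simp <;> omega
    have := GS_mul (ih _ this) (GS_gg x.2)
    rwa [h2] at this

lemma GS_pPow (l : JPartition) : pPow l ∈ GS (psize l) := by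
  induction l using Multiset.induction with
  | empty => exact Submodule.subset_span ⟨0, by simp, by simp [gP_zero, pPow]⟩
  | cons a l ih =>
    have : pPow (a ::ₘ l) = pp a * pPow l := by simp [pPow, pp_pnat]
    rw [this, psize_cons]
    exact GS_mul (GS_pp a) ih

lemma Hom_le_GS (n : ℕ) : Hom n ≤ GS n := by
  intro f hf
  refine Hom_ind (T := LinearMap.id) (fun m a hm => ?_) hf
  obtain ⟨l, rfl⟩ := toExp_surj m
  rw [wt_toExp] at hm
  have h := GS_pPow l
  rw [pPow_eq, hm] at h
  have := Submodule.smul_mem _ a h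
  rwa [MvPolynomial.smul_monomial, smul_eq_mul, mul_one] at this

lemma Hom_gg (n : ℕ) : gg n ∈ Hom n := by
  induction n using Nat.strong_induction_on with
  | _ n ih =>
    cases n with
    | zero => rw [gg_zero]; simpa [cF] using Hom_C 1
    | succ n =>
      rw [gg]
      refine Submodule.smul_mem _ _ (Submodule.sum_mem _ fun i _ => ?_)
      have := Hom_mul (Hom_pp (n + 1 - i)) (ih i i.2)
      rwa [Nat.sub_add_cancel i.2.le] at this

lemma Hom_gP (l : JPartition) : gP l ∈ Hom (psize l) := by
  induction l using Multiset.induction with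
  | empty => rw [gP_zero]; simpa [cF] using Hom_C 1
  | cons a l ih => rw [gP_cons, psize_cons]; exact Hom_mul (Hom_gg a) ih

lemma gP_span : Submodule.span F (Set.range gP) = ⊤ := by
  rw [eq_top_iff]
  intro f _
  rw [f.as_sum]
  refine Submodule.sum_mem _ fun m _ => ?_
  exact Submodule.span_mono (Set.image_subset_range _ _) (Hom_le_GS _ (Hom_monomial m _))

/-! ### link with evaluation in finitely many variables -/

lemma coeffV_prod {ι : Type*} (s : Finset ι) (e : ι → ℕ) (k : ℕ) (hk : 0 < k) :
    (V (∏ i ∈ s, gg (e i))).coeff k = ∑ j ∈ s, if k ≤ e j then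
      gg (e j - k) * ∏ i ∈ s.erase j, gg (e i) else 0 := by
  have h0 : ∀ n, (V (gg n)).coeff k = if k ≤ n then gg (n - k) else 0 := by
    intro n
    rw [V_gg_sum, Polynomial.finsetSum_coeff]
    have : ∀ x ∈ antidiagonal n, (zz x.1 * C (gg x.2)).coeff k = if x.1 = k then gg x.2 else 0 := by
      intro x _
      rw [zz]
      by_cases h : x.1 = 0
      · rw [if_pos h, zero_mul, if_neg (by omega), Polynomial.coeff_zero]
      · rw [if_neg h, mul_comm, Polynomial.coeff_C_mul, Polynomial.coeff_X_pow]
        by_cases h' : x.1 = k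
        · simp [h']
        · rw [if_neg (Ne.symm h'), if_neg h', mul_zero]
    rw [Finset.sum_congr rfl this]
    split_ifs with h
    · rw [Finset.sum_eq_single (k, n - k)]
      · simp
      · intro x hx hne
        have := Finset.HasAntidiagonal.mem_antidiagonal.1 hx
        rw [if_neg]
        intro e
        apply hne
        ext <;> simp <;> omega
      · intro hh
        exact absurd (Finset.HasAntidiagonal.mem_antidiagonal.2 (by simp; omega)) hh
    · refine Finset.sum_eq_zero fun x hx => ?_
      have := Finset.HasAntidiagonal.mem_antidiagonal.1 hx
      rw [if_neg (by omega)]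
  induction s using Finset.induction_on with
  | empty => simp
  | insert a s ha ih =>
    rw [Finset.prod_insert ha, V_mul, Polynomial.coeff_add, Polynomial.coeff_C_mul,
      Polynomial.coeff_C_mul, ih, h0, Finset.sum_insert ha, Finset.erase_insert ha, add_comm,
      Finset.mul_sum]
    congr 1
    · split_ifs <;> simp [mul_comm]
    · refine Finset.sum_congr rfl fun j hj => ?_
      have hja : a ≠ j := by rintro rfl; exact ha hj
      rw [Finset.erase_insert_of_ne hja, Finset.prod_insert (by simp [ha])]
      split_ifs <;> ring

lemma prod_sub {N : ℕ} (e : Fin N →₀ ℕ) (j : Fin N) (k : ℕ) :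
    ∏ i, gg ((e - Finsupp.single j k) i) = gg (e j - k) * ∏ i ∈ Finset.univ.erase j, gg (e i) := by
  rw [← Finset.mul_prod_erase _ _ (Finset.mem_univ j)]
  congr 1
  · simp
  · refine Finset.prod_congr rfl fun i hi => ?_
    have : i ≠ j := (Finset.mem_erase.1 hi).1
    simp [Finsupp.single_eq_of_ne this]

lemma H_prod_one {N : ℕ} (e : Fin N →₀ ℕ) : H (∏ i, gg (e i)) 1 = if e = 0 then 1 else 0 := by
  split_ifs with h
  · subst h
    simp [gg_zero]
    have := H_monomial 0 1 1
    simpa [zalpha_zero] using this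
  · obtain ⟨j, hj⟩ : ∃ j, e j ≠ 0 := by
      by_contra hc
      push Not at hc
      exact h (Finsupp.ext hc)
    rw [← Finset.mul_prod_erase _ _ (Finset.mem_univ j)]
    have hz : ∀ f, H (gg (e j) * f) 1 = 0 := by
      intro f
      have hne : alpha * (e j : F) ≠ 0 := mul_ne_zero alpha_ne (by exact_mod_cast hj)
      have : gg (e j) = (alpha * (e j : F))⁻¹ • ∑ x ∈ antidiagonal (e j), pp x.1 * gg x.2 := by
        rw [gg_rec, smul_smul, inv_mul_cancel₀ hne, one_smul]
      rw [this, smul_mul_assoc, Finset.sum_mul, map_smul, LinearMap.smul_apply, map_sum,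
        LinearMap.sum_apply, Finset.sum_eq_zero, smul_zero]
      intro x _
      rw [mul_assoc, H_pp_mul]
      simp
    exact hz _

lemma evalN_coeff (N : ℕ) (f : SymA) (e : Fin N →₀ ℕ) :
    MvPolynomial.coeff e (evalN N f) = H (∏ i, gg (e i)) f := by
  induction f using MvPolynomial.induction_on generalizing e with
  | C a =>
    have : (MvPolynomial.C a : SymA) = a • 1 := by rw [MvPolynomial.smul_eq_C_mul, mul_one]
    rw [this, map_smul, map_smul, map_one, MvPolynomial.coeff_smul, MvPolynomial.coeff_one,
      H_prod_one]
    simp only [eq_comm]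
  | add f g hf hg => rw [map_add, map_add, MvPolynomial.coeff_add, hf, hg]
  | mul_X f k ih =>
    have e1 : evalN N (MvPolynomial.X k) = ∑ j : Fin N, MvPolynomial.X j ^ (k : ℕ) := by
      simp [evalN]
    rw [map_mul, e1, Finset.mul_sum, MvPolynomial.coeff_sum, mul_comm f, H_comm, ← pp_pnat,
      H_pp_mul, coeffV_prod _ _ _ k.pos, map_sum]
    refine Finset.sum_congr rfl fun j _ => ?_
    rw [MvPolynomial.X_pow_eq_monomial, MvPolynomial.coeff_mul_monomial']
    have : Finsupp.single j (k : ℕ) ≤ e ↔ (k : ℕ) ≤ e j := by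
      rw [Finsupp.single_le_iff]
    by_cases h : (k : ℕ) ≤ e j
    · rw [if_pos (this.2 h), if_pos h, ih, mul_one, prod_sub e j k, H_comm]
      congr!
    · rw [if_neg (fun h' => h (this.1 h')), if_neg h, map_zero]

lemma prod_getD (f : ℕ → SymA) (hf : f 0 = 1) (l : List ℕ) (N : ℕ) (h : l.length ≤ N) :
    ∏ j : Fin N, f (l.getD j 0) = (l.map f).prod := by
  induction l generalizing N with
  | nil => simp [hf]
  | cons a t ih =>
    cases N with
    | zero => simp at h
    | succ N =>
      rw [Fin.prod_univ_succ, List.map_cons, List.prod_cons, ← ih N (by simpa using h)]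
      simp

lemma H_gP_J {J : JPartition → SymA} (hJ : IsJackFamily J) (m l : JPartition)
    (h : ¬ dominates m l) : H (gP m) (J l) = 0 := by
  have := hJ.triangular l m h
  rw [evalN_coeff] at this
  have e := prod_getD gg gg_zero (sortedParts m) (psize l + psize m + plen m) (by
    have : (sortedParts m).length = plen m := by
      rw [← Multiset.coe_card, sP_coe, Multiset.card_map]; rfl
    omega)
  have e2 : ((sortedParts m).map gg).prod = gP m := by
    rw [gP, ← Multiset.prod_coe, ← Multiset.map_coe, sP_coe, Multiset.map_map]; rfl
  rw [← e2, ← e]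
  exact this

end JK

set_option linter.unusedSimpArgs false

namespace JK
open Finset.HasAntidiagonal (antidiagonal)
open Polynomial (X C monomial)
open MvPolynomial (pderiv rename)

/-! ### Structure of the Jack basis -/

lemma span_map {M : Type*} [AddCommGroup M] [Module F M] (T : SymA →ₗ[F] M) {A : Set SymA}
    {S : Submodule F M} (h : ∀ a ∈ A, T a ∈ S) {f : SymA} (hf : f ∈ Submodule.span F A) : T f ∈ S :=
  (Submodule.span_le (p := S.comap T)).2 h hf

lemma J_ne {J : JPartition → SymA} (hJ : IsJackFamily J) (l : JPartition) : J l ≠ 0 := by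
  intro h
  have := hJ.normalized l
  rw [h] at this
  simp at this

lemma jj_ne {J : JPartition → SymA} (hJ : IsJackFamily J) (l : JPartition) : H (J l) (J l) ≠ 0 :=
  fun h => J_ne hJ l (H_pos h)

lemma J_orth {J : JPartition → SymA} (hJ : IsJackFamily J) {l m : JPartition} (h : l ≠ m) :
    H (J l) (J m) = 0 := hJ.orthogonal l m h

lemma H_gP_ne {J : JPartition → SymA} (hJ : IsJackFamily J) {m l : JPartition}
    (h : H (gP m) (J l) ≠ 0) : dominates m l := by
  by_contra hc
  exact h (H_gP_J hJ m l hc)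

lemma Hom_J {J : JPartition → SymA} (hJ : IsJackFamily J) (l : JPartition) :
    J l ∈ Hom (psize l) := by
  refine mem_Hom.2 fun m hm => ?_
  by_contra hne
  have h1 : H (MvPolynomial.monomial m 1) (J l) ≠ 0 := by
    rw [H_monomial, one_mul]
    exact mul_ne_zero hm (zalpha_ne m)
  apply h1
  have h2 := Hom_le_GS _ (Hom_monomial m 1)
  refine (Submodule.mem_bot F).1 (span_map (H.flip (J l)) (S := ⊥) ?_ h2)
  rintro _ ⟨k, hk, rfl⟩
  refine (Submodule.mem_bot F).2 (H_gP_J hJ k l fun hd => hne ?_)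
  rw [← hd.1]; exact hk.symm

lemma J_LI {J : JPartition → SymA} (hJ : IsJackFamily J) : LinearIndependent F J := by
  rw [linearIndependent_iff']
  intro s a h k hk
  have h1 := congrArg (fun f => H f (J k)) h
  simp only [map_sum, LinearMap.sum_apply, map_smul, LinearMap.smul_apply, map_zero,
    LinearMap.zero_apply, smul_eq_mul] at h1
  rw [Finset.sum_eq_single k (fun b _ hb => by rw [J_orth hJ hb, mul_zero])
    (fun h => absurd hk h)] at h1
  exact (mul_eq_zero.1 h1).resolve_right (jj_ne hJ k)

lemma GS_eq {J : JPartition → SymA} (hJ : IsJackFamily J) (n : ℕ) :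
    Submodule.span F (J '' {l | psize l = n}) = GS n := by
  have := (finite_psize n).to_subtype
  have := Fintype.ofFinite {l : JPartition | psize l = n}
  have hfin : Module.Finite F (GS n) := by
    rw [GS]; exact Module.Finite.span_of_finite F ((finite_psize n).image _)
  refine Submodule.eq_of_le_of_finrank_le ?_ ?_
  · refine Submodule.span_le.2 ?_
    rintro _ ⟨l, hl, rfl⟩
    have := Hom_le_GS _ (Hom_J hJ l)
    rwa [show psize l = n from hl] at this
  · have h1 := finrank_span_eq_card ((J_LI hJ).comp _ (Subtype.coe_injective (p := fun l => l ∈ {l : JPartition | psize l = n})))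
    have h2 := finrank_range_le_card (R := F) (fun l : {l : JPartition | psize l = n} => gP l)
    have e1 : Set.range (J ∘ fun l : {l : JPartition | psize l = n} => (l : JPartition)) = J '' {l | psize l = n} := by
      rw [Set.range_comp, Subtype.range_coe]
    have e2 : Set.range (fun l : {l : JPartition | psize l = n} => gP l) = gP '' {l | psize l = n} := by
      rw [Set.image_eq_range]
    rw [e1] at h1
    rw [e2] at h2
    rw [h1]
    exact h2

lemma J_span {J : JPartition → SymA} (hJ : IsJackFamily J) : ⊤ ≤ Submodule.span F (Set.range J) := by
  intro f _
  rw [f.as_sum]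
  refine Submodule.sum_mem _ fun m _ => ?_
  have h := Hom_le_GS _ (Hom_monomial m (MvPolynomial.coeff m f))
  rw [← GS_eq hJ] at h
  exact Submodule.span_mono (Set.image_subset_range _ _) h

/-- The Jack basis. -/
def bJ {J : JPartition → SymA} (hJ : IsJackFamily J) : Module.Basis JPartition F SymA :=
  Module.Basis.mk (J_LI hJ) (J_span hJ)

lemma bJ_apply {J : JPartition → SymA} (hJ : IsJackFamily J) (l : JPartition) : bJ hJ l = J l :=
  Module.Basis.mk_apply _ _ _

lemma bJ_repr {J : JPartition → SymA} (hJ : IsJackFamily J) (f : SymA) (l : JPartition) :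
    H f (J l) = (bJ hJ).repr f l * H (J l) (J l) := by
  have h := (bJ hJ).linearCombination_repr f
  conv_lhs => rw [← h]
  rw [Finsupp.linearCombination_apply, Finsupp.sum, map_sum, LinearMap.sum_apply]
  simp only [map_smul, LinearMap.smul_apply, bJ_apply, smul_eq_mul]
  rw [Finset.sum_eq_single l (fun b _ hb => by rw [J_orth hJ hb, mul_zero])]
  intro h
  rw [Finsupp.notMem_support_iff.1 h, zero_mul]

lemma mem_spanJ {J : JPartition → SymA} (hJ : IsJackFamily J) {f : SymA} {S : Set JPartition} :
    f ∈ Submodule.span F (J '' S) ↔ ∀ l, H f (J l) ≠ 0 → l ∈ S := by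
  have e : J '' S = (bJ hJ) '' S := by
    refine Set.image_congr fun l _ => (bJ_apply hJ l).symm
  rw [e, Module.Basis.mem_span_image]
  constructor
  · intro h l hl
    refine h (Finsupp.mem_support_iff.2 fun h0 => hl ?_)
    rw [bJ_repr hJ, h0, zero_mul]
  · intro h l hl
    refine h l ?_
    rw [bJ_repr hJ]
    exact mul_ne_zero (Finsupp.mem_support_iff.1 hl) (jj_ne hJ l)

lemma H_ext {J : JPartition → SymA} (hJ : IsJackFamily J) {f g : SymA}
    (h : ∀ l, H f (J l) = H g (J l)) : f = g := by
  refine (bJ hJ).repr.injective (Finsupp.ext fun l => ?_)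
  have := h l
  rw [bJ_repr hJ f, bJ_repr hJ g] at this
  exact mul_right_cancel₀ (jj_ne hJ l) this

lemma gP_LI {J : JPartition → SymA} (hJ : IsJackFamily J) (n : ℕ) :
    LinearIndependent F (fun l : {l : JPartition | psize l = n} => gP l) := by
  have := (finite_psize n).to_subtype
  have := Fintype.ofFinite {l : JPartition | psize l = n}
  rw [linearIndependent_iff_card_eq_finrank_span]
  have h1 := finrank_span_eq_card ((J_LI hJ).comp _ (Subtype.coe_injective (p := fun l => l ∈ {l : JPartition | psize l = n})))
  rw [Set.finrank, ← h1]
  have e1 : Set.range (J ∘ fun l : {l : JPartition | psize l = n} => (l : JPartition)) = J '' {l | psize l = n} := by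
    rw [Set.range_comp, Subtype.range_coe]
  have e2 : Set.range (fun l : {l : JPartition | psize l = n} => gP l) = gP '' {l | psize l = n} := by
    rw [Set.image_eq_range]
  rw [e1, e2, GS_eq hJ]; rfl

lemma upset_eq {J : JPartition → SymA} (hJ : IsJackFamily J) (S : Set JPartition)
    (hS : ∀ k ∈ S, ∀ l, dominates k l → l ∈ S) :
    Submodule.span F (gP '' S) = Submodule.span F (J '' S) := by
  apply le_antisymm
  · refine Submodule.span_le.2 ?_
    rintro _ ⟨k, hk, rfl⟩
    exact (mem_spanJ hJ).2 fun l hl => hS k hk l (H_gP_ne hJ hl)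
  · refine Submodule.span_le.2 ?_
    rintro _ ⟨k, hk, rfl⟩
    set n := psize k with hn
    set T : Set JPartition := S ∩ {l | psize l = n}
    have hT : T.Finite := (finite_psize n).subset Set.inter_subset_right
    have hle : Submodule.span F (gP '' T) ≤ Submodule.span F (J '' T) := by
      refine Submodule.span_le.2 ?_
      rintro _ ⟨k, hk, rfl⟩
      refine (mem_spanJ hJ).2 fun l hl => ⟨hS k hk.1 l (H_gP_ne hJ hl), ?_⟩
      exact (H_gP_ne hJ hl).1.symm.trans hk.2
    have := hT.to_subtype
    have := Fintype.ofFinite T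
    have hfin : Module.Finite F (Submodule.span F (J '' T)) :=
      Module.Finite.span_of_finite F (hT.image _)
    have h1 := finrank_span_eq_card ((J_LI hJ).comp _ (Subtype.coe_injective (p := fun l => l ∈ T)))
    have h2 := finrank_span_eq_card ((gP_LI hJ n).comp (fun l : T => ⟨l.1, l.2.2⟩)
      (fun a b h => Subtype.ext (by simpa using h)))
    have e1 : Set.range (J ∘ fun l : T => (l : JPartition)) = J '' T := by
      rw [Set.range_comp, Subtype.range_coe]
    have e2 : Set.range ((fun l : {l : JPartition | psize l = n} => gP l) ∘ (fun l : T => ⟨l.1, l.2.2⟩)) = gP '' T := by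
      rw [Set.image_eq_range]; rfl
    rw [e1] at h1
    rw [e2] at h2
    have heq := Submodule.eq_of_le_of_finrank_eq hle (h2.trans h1.symm)
    have : J k ∈ Submodule.span F (J '' T) := Submodule.subset_span ⟨k, ⟨hk, rfl⟩, rfl⟩
    rw [← heq] at this
    exact Submodule.span_mono (Set.image_mono Set.inter_subset_left) this

lemma upset_dom {J : JPartition → SymA} (hJ : IsJackFamily J) (l : JPartition) :
    Submodule.span F (gP '' {k | dominates l k}) = Submodule.span F (J '' {k | dominates l k}) :=
  upset_eq hJ {k | dominates l k} (fun _ hk _ hm => dom_trans hk hm)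

/-- strict up set -/
def sup (l : JPartition) : Set JPartition := {k | dominates l k ∧ k ≠ l}

lemma J_lead {J : JPartition → SymA} (hJ : IsJackFamily J) (l : JPartition) :
    ∃ a : F, a ≠ 0 ∧ J l - a • gP l ∈ Submodule.span F (gP '' sup l) := by
  have h : J l ∈ Submodule.span F (gP '' {k | dominates l k}) := by
    rw [upset_dom hJ]
    exact Submodule.subset_span ⟨l, dom_refl l, rfl⟩
  have e : {k | dominates l k} = insert l (sup l) := by
    ext k
    simp only [sup, Set.mem_insert_iff, Set.mem_ofPred_eq]
    constructor
    · intro h; by_cases hk : k = l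
      · exact Or.inl hk
      · exact Or.inr ⟨h, hk⟩
    · rintro (rfl | h)
      · exact dom_refl _
      · exact h.1
  rw [e, Set.image_insert_eq, Submodule.mem_span_insert] at h
  obtain ⟨a, z, hz, h⟩ := h
  refine ⟨a, ?_, by rw [h]; simpa using hz⟩
  rintro rfl
  rw [zero_smul, zero_add] at h
  apply jj_ne hJ l
  rw [← h] at hz
  refine (Submodule.mem_bot F).1 (span_map (H.flip (J l)) (S := ⊥) ?_ hz)
  rintro _ ⟨k, hk, rfl⟩
  refine (Submodule.mem_bot F).2 (H_gP_J hJ k l fun hd => hk.2 ?_)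
  exact dom_antisymm hd hk.1

lemma H_sup {J : JPartition → SymA} (hJ : IsJackFamily J) (l : JPartition) {f : SymA}
    (hf : f ∈ Submodule.span F (gP '' sup l)) : H f (J l) = 0 := by
  refine (Submodule.mem_bot F).1 (span_map (H.flip (J l)) (S := ⊥) ?_ hf)
  rintro _ ⟨k, hk, rfl⟩
  refine (Submodule.mem_bot F).2 (H_gP_J hJ k l fun hd => hk.2 ?_)
  exact dom_antisymm hd hk.1

lemma H_gP_self {J : JPartition → SymA} (hJ : IsJackFamily J) (l : JPartition) :
    H (gP l) (J l) ≠ 0 := by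
  obtain ⟨a, ha, h⟩ := J_lead hJ l
  have := H_sup hJ l h
  rw [map_sub, LinearMap.sub_apply, map_smul, LinearMap.smul_apply, sub_eq_zero] at this
  intro h0
  rw [h0, smul_zero] at this
  exact jj_ne hJ l this

/-- span of `g_μ` with a part larger than `s` -/
def Is (s : ℕ) : Submodule F SymA := Submodule.span F (gP '' {k | ¬ ple k s})

lemma Is_eq {J : JPartition → SymA} (hJ : IsJackFamily J) (s : ℕ) :
    Is s = Submodule.span F (J '' {k | ¬ ple k s}) :=
  upset_eq hJ _ fun _ hk _ hd hl => hk (dom_ple hd hl)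

lemma ple_add {l m : JPartition} {s : ℕ} : ple (l + m) s ↔ ple l s ∧ ple m s := by
  simp only [ple, Multiset.mem_add, or_imp, forall_and]

lemma ple_cons {a : ℕ+} {m : JPartition} {s : ℕ} : ple (a ::ₘ m) s ↔ (a : ℕ) ≤ s ∧ ple m s := by
  simp only [ple, Multiset.mem_cons, or_imp, forall_and, forall_eq]

lemma Is_mul (s : ℕ) (h : SymA) {f : SymA} (hf : f ∈ Is s) : h * f ∈ Is s := by
  refine span_map (LinearMap.mulLeft F h) ?_ hf
  rintro _ ⟨k, hk, rfl⟩
  have hh : h ∈ Submodule.span F (Set.range gP) := by rw [gP_span]; trivial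
  refine span_map (LinearMap.mulRight F (gP k)) ?_ hh
  rintro _ ⟨m, rfl⟩
  refine Submodule.subset_span ⟨m + k, ?_, gP_add _ _⟩
  intro hp
  exact hk (ple_add.1 hp).2

lemma Is_gg {s k : ℕ} (h : s < k) (f : SymA) : gg k * f ∈ Is s := by
  rw [mul_comm]
  refine Is_mul s f (Submodule.subset_span ⟨consx k 0, ?_, by rw [gP_consx, gP_zero, mul_one]⟩)
  obtain ⟨k, rfl⟩ := (nat_cases k).resolve_left (by omega)
  rw [consx_pnat]
  intro hp
  have := (ple_cons.1 hp).1
  omega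

lemma H_Is {J : JPartition → SymA} (hJ : IsJackFamily J) {s : ℕ} {l : JPartition} (hl : ple l s)
    {f : SymA} (hf : f ∈ Is s) : H f (J l) = 0 := by
  rw [Is_eq hJ, mem_spanJ hJ] at hf
  by_contra hc
  exact hf l hc hl

lemma Is_of {J : JPartition → SymA} (hJ : IsJackFamily J) {s : ℕ} {f : SymA}
    (hf : ∀ l, ple l s → H f (J l) = 0) : f ∈ Is s := by
  rw [Is_eq hJ, mem_spanJ hJ]
  intro l hl hp
  exact hl (hf l hp)

/-! degree operator -/
lemma N_gP (l : JPartition) : alpha⁻¹ • rho (V (gP l)) = (psize l : F) • gP l := by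
  induction l using Multiset.induction with
  | empty => simp [gP_zero]
  | cons a l ih =>
    rw [gP_cons, V_mul, map_add, rho_C_mul, rho_C_mul, rho_V_gg, smul_add, ← mul_smul_comm, ih,
      psize_cons, mul_smul_comm, mul_smul_comm, smul_smul, ← mul_assoc, inv_mul_cancel₀ alpha_ne,
      one_mul]
    push_cast
    rw [add_smul, mul_comm (gP l)]; abel

lemma N_Hom {n : ℕ} {f : SymA} (hf : f ∈ Hom n) : alpha⁻¹ • rho (V f) = (n : F) • f := by
  have h := Hom_le_GS n hf
  have := span_map (alpha⁻¹ • (rho ∘ₗ (V : SymA →ₗ[F] ZA)) - (n : F) • LinearMap.id) (S := ⊥) ?_ h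
  · rw [Submodule.mem_bot] at this
    exact sub_eq_zero.1 this
  · rintro _ ⟨k, hk, rfl⟩
    rw [Submodule.mem_bot]
    have := N_gP k
    rw [show psize k = n from hk] at this
    exact sub_eq_zero.2 this

lemma cross_mul (f g h : SymA) : rho (V f * V (g * h)) = g * rho (V f * V h) + h * rho (V f * V g) := by
  rw [V_mul, mul_add, map_add, mul_left_comm, rho_C_mul, mul_left_comm, rho_C_mul]

lemma crossP (s : ℕ+) (l : JPartition) (hl : ple l s) :
    alpha⁻¹ • rho (V (gg s) * V (gP l)) + (psize l : F) • (gg s * gP l)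
      ∈ Submodule.span F (gP '' {k | dominates (s ::ₘ l) k ∧ ¬ ple k s}) := by
  induction l using Multiset.induction with
  | empty => simp [gP_zero]
  | cons b l ih =>
    obtain ⟨hb, hl⟩ := ple_cons.1 hl
    have ih := ih hl
    have e : alpha⁻¹ • rho (V (gg s) * V (gP (b ::ₘ l))) + (psize (b ::ₘ l) : F) • (gg s * gP (b ::ₘ l))
        = gg b * (alpha⁻¹ • rho (V (gg s) * V (gP l)) + (psize l : F) • (gg s * gP l))
        + gP l * (alpha⁻¹ • rho (V (gg s) * V (gg b)) + ((b : ℕ) : F) • (gg s * gg b)) := by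
      rw [gP_cons, cross_mul, psize_cons]
      push_cast
      simp only [smul_eq_cF, map_add]
      ring
    rw [e]
    refine add_mem ?_ ?_
    · refine span_map (LinearMap.mulLeft F (gg b)) ?_ ih
      rintro _ ⟨k, hk, rfl⟩
      refine Submodule.subset_span ⟨b ::ₘ k, ⟨?_, fun hp => hk.2 (ple_cons.1 hp).2⟩, gP_cons _ _⟩
      rw [Multiset.cons_swap]
      exact dom_cons b hk.1
    · refine span_map (LinearMap.mulLeft F (gP l)) ?_ (cross_mem b s)
      rintro _ ⟨j, h1, h2, rfl⟩
      refine Submodule.subset_span ⟨consx (s + j) (consx (b - j) l), ⟨?_, ?_⟩, ?_⟩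
      · have := dom_raise s b j hb h2 l
        rwa [consx_pnat, consx_pnat] at this
      · obtain ⟨k, hk⟩ := (nat_cases (s + j)).resolve_left (by have := s.pos; omega)
        rw [hk, consx_pnat]
        intro hp
        have := (ple_cons.1 hp).1
        omega
      · rw [gP_consx, gP_consx, LinearMap.mulLeft_apply]; ring

lemma D_gP (l : JPartition) : D (gP l) - ee l • gP l ∈ Submodule.span F (gP '' sup l) := by
  induction l using part_ind with
  | h0 =>
    have := D_gg 0
    simp [gg_zero] at this
    simp [gP_zero, this, ee_zero]
  | h1 s l hl ih =>
    have e : D (gP (s ::ₘ l)) - ee (s ::ₘ l) • gP (s ::ₘ l)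
        = gg s * (D (gP l) - ee l • gP l)
        + (alpha⁻¹ • rho (V (gg s) * V (gP l)) + (psize l : F) • (gg s * gP l)) := by
      rw [gP_cons, D_mul, D_gg, ee_cons s l hl]
      simp only [smul_eq_cF, map_add, map_sub]
      ring
    rw [e]
    refine add_mem ?_ (Submodule.span_mono (Set.image_mono ?_) (crossP s l hl))
    · refine span_map (LinearMap.mulLeft F (gg s)) ?_ ih
      rintro _ ⟨k, hk, rfl⟩
      refine Submodule.subset_span ⟨s ::ₘ k, ⟨dom_cons s hk.1, fun h => hk.2 ?_⟩, gP_cons _ _⟩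
      simpa using h
    · rintro k ⟨h1, h2⟩
      refine ⟨h1, ?_⟩
      rintro rfl
      exact h2 (ple_cons.2 ⟨le_rfl, hl⟩)

lemma D_J {J : JPartition → SymA} (hJ : IsJackFamily J) (l : JPartition) : D (J l) = ee l • J l := by
  have key : ∀ l m, H (D (J l)) (J m) ≠ 0 → dominates l m := by
    intro l
    have hup : ∀ k ∈ {k | dominates l k}, ∀ m, dominates k m → m ∈ {k | dominates l k} :=
      fun k hk m hm => dom_trans hk hm
    have h : J l ∈ Submodule.span F (gP '' {k | dominates l k}) := by
      rw [upset_dom hJ]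
      exact Submodule.subset_span ⟨l, dom_refl l, rfl⟩
    have h2 : D (J l) ∈ Submodule.span F (gP '' {k | dominates l k}) := by
      refine span_map D ?_ h
      rintro _ ⟨k, hk, rfl⟩
      have h3 := D_gP k
      have : D (gP k) = (D (gP k) - ee k • gP k) + ee k • gP k := by abel
      rw [this]
      refine add_mem (Submodule.span_mono (Set.image_mono ?_) h3)
        (Submodule.smul_mem _ _ (Submodule.subset_span ⟨k, hk, rfl⟩))
      exact fun m hm => dom_trans hk hm.1
    rw [upset_dom hJ] at h2
    exact (mem_spanJ hJ).1 h2
  have h1 : D (J l) ∈ Submodule.span F (J '' {l}) := by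
    refine (mem_spanJ hJ).2 fun m hm => ?_
    have a1 := key l m hm
    rw [H_D, H_comm] at hm
    exact (dom_antisymm a1 (key m l hm)).symm
  rw [Set.image_singleton, Submodule.mem_span_singleton] at h1
  obtain ⟨a, ha⟩ := h1
  rw [← ha]
  congr 1
  have h3 := H_sup hJ l (D_gP l)
  rw [map_sub, LinearMap.sub_apply, H_D, ← ha, map_smul, map_smul, LinearMap.smul_apply,
    ← sub_smul, smul_eq_mul] at h3
  exact sub_eq_zero.1 ((mul_eq_zero.1 h3).resolve_right (H_gP_self hJ l))

/-! multiplication by `g_s` modulo `Is s` -/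

lemma cross_Is_gg (s b : ℕ) :
    alpha⁻¹ • rho (V (gg s) * V (gg b)) + (b : F) • (gg s * gg b) ∈ Is s := by
  by_cases h : b ≤ s
  · refine Submodule.span_le.2 ?_ (cross_mem b s)
    rintro _ ⟨j, h1, h2, rfl⟩
    exact Is_gg (by omega) _
  · have h1 := cross_mem s b
    have h2 : alpha⁻¹ • rho (V (gg b) * V (gg s)) + (s : F) • (gg b * gg s) ∈ Is s := by
      refine Submodule.span_le.2 ?_ h1
      rintro _ ⟨j, h1, h2, rfl⟩
      exact Is_gg (by omega) _
    have h3 : gg b * gg s ∈ Is s := Is_gg (by omega) _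
    have e : alpha⁻¹ • rho (V (gg s) * V (gg b)) + (b : F) • (gg s * gg b)
        = (alpha⁻¹ • rho (V (gg b) * V (gg s)) + (s : F) • (gg b * gg s))
          + ((b : F) - s) • (gg b * gg s) := by
      rw [mul_comm (V (gg s)), mul_comm (gg s), sub_smul]; abel
    rw [e]
    exact add_mem h2 (Submodule.smul_mem _ _ h3)

lemma cross_Is (s n : ℕ) {f : SymA} (hf : f ∈ Hom n) :
    alpha⁻¹ • rho (V (gg s) * V f) + (n : F) • (gg s * f) ∈ Is s := by
  have hP : ∀ l, alpha⁻¹ • rho (V (gg s) * V (gP l)) + (psize l : F) • (gg s * gP l) ∈ Is s := by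
    intro l
    induction l using Multiset.induction with
    | empty => simp [gP_zero]
    | cons b l ih =>
      have e : alpha⁻¹ • rho (V (gg s) * V (gP (b ::ₘ l))) + (psize (b ::ₘ l) : F) • (gg s * gP (b ::ₘ l))
          = gg b * (alpha⁻¹ • rho (V (gg s) * V (gP l)) + (psize l : F) • (gg s * gP l))
          + gP l * (alpha⁻¹ • rho (V (gg s) * V (gg b)) + ((b : ℕ) : F) • (gg s * gg b)) := by
        rw [gP_cons, cross_mul, psize_cons]
        push_cast
        simp only [smul_eq_cF, map_add]
        ring
      rw [e]
      exact add_mem (Is_mul _ _ ih) (Is_mul _ _ (cross_Is_gg s b))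
  refine span_map (alpha⁻¹ • (rho ∘ₗ LinearMap.mulLeft F (V (gg s)) ∘ₗ (V : SymA →ₗ[F] ZA))
    + (n : F) • LinearMap.mulLeft F (gg s)) ?_ (Hom_le_GS n hf)
  rintro _ ⟨k, hk, rfl⟩
  have := hP k
  rw [show psize k = n from hk] at this
  exact this

lemma H_gJ {J : JPartition → SymA} (hJ : IsJackFamily J) (s : ℕ+) (l k : JPartition)
    (hl : ple l s) (hk : ple k s) : H (gg s * J l) (J k) ≠ 0 ↔ k = s ::ₘ l := by
  constructor
  · intro hne
    have h1 : H (D (gg s * J l)) (J k) = ee k * H (gg s * J l) (J k) := by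
      rw [H_D, D_J hJ, map_smul, smul_eq_mul]
    have e : D (gg s * J l) = ee (s ::ₘ l) • (gg s * J l)
        + (alpha⁻¹ • rho (V (gg s) * V (J l)) + (psize l : F) • (gg s * J l)) := by
      rw [D_mul, D_J hJ, D_gg, ee_cons s l hl]
      simp only [smul_eq_cF, map_add, map_sub]
      ring
    rw [e, map_add, LinearMap.add_apply, H_Is hJ hk (cross_Is s _ (Hom_J hJ l)), add_zero, map_smul,
      LinearMap.smul_apply, smul_eq_mul] at h1
    have h2 := mul_right_cancel₀ hne h1
    have hJl : J l ∈ Submodule.span F (gP '' {k | dominates l k}) := by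
      rw [upset_dom hJ]
      exact Submodule.subset_span ⟨l, dom_refl l, rfl⟩
    have h3 : gg s * J l ∈ Submodule.span F (gP '' {k | dominates (s ::ₘ l) k}) := by
      refine span_map (LinearMap.mulLeft F (gg s)) ?_ hJl
      rintro _ ⟨m, hm, rfl⟩
      exact Submodule.subset_span ⟨s ::ₘ m, dom_cons s hm, gP_cons _ _⟩
    rw [upset_dom hJ, mem_spanJ hJ] at h3
    exact (eq_of_ee (h3 k hne) h2).symm
  · rintro rfl
    obtain ⟨a, ha, h⟩ := J_lead hJ l
    have h2 : gg s * (J l - a • gP l) ∈ Submodule.span F (gP '' sup (s ::ₘ l)) := by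
      refine span_map (LinearMap.mulLeft F (gg s)) ?_ h
      rintro _ ⟨m, hm, rfl⟩
      refine Submodule.subset_span ⟨s ::ₘ m, ⟨dom_cons s hm.1, fun h => hm.2 ?_⟩, gP_cons _ _⟩
      simpa using h
    have h3 := H_sup hJ _ h2
    rw [mul_sub, map_sub, LinearMap.sub_apply, mul_smul_comm, map_smul, LinearMap.smul_apply,
      ← gP_cons, sub_eq_zero] at h3
    rw [h3]
    exact mul_ne_zero ha (H_gP_self hJ _)

lemma gJ_mod {J : JPartition → SymA} (hJ : IsJackFamily J) (s : ℕ+) (l : JPartition)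
    (hl : ple l s) : ∃ c : F, c ≠ 0 ∧ gg s * J l - c • J (s ::ₘ l) ∈ Is s := by
  refine ⟨H (gg s * J l) (J (s ::ₘ l)) / H (J (s ::ₘ l)) (J (s ::ₘ l)), ?_, ?_⟩
  · exact div_ne_zero ((H_gJ hJ s l _ hl (ple_cons.2 ⟨le_rfl, hl⟩)).2 rfl) (jj_ne hJ _)
  · refine Is_of hJ fun k hk => ?_
    rw [map_sub, LinearMap.sub_apply, map_smul, LinearMap.smul_apply, smul_eq_mul]
    by_cases h : k = s ::ₘ l
    · subst h
      rw [div_mul_cancel₀ _ (jj_ne hJ _), sub_self]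
    · have := (H_gJ hJ s l k hl hk).not.2 h
      rw [not_not] at this
      rw [this, J_orth hJ (Ne.symm h), mul_zero, sub_zero]

end JK

set_option linter.unusedSimpArgs false

namespace JK
open Finset.HasAntidiagonal (antidiagonal)
open Polynomial (X C monomial)
open MvPolynomial (pderiv rename)

/-! ### Pieri rule -/

/-- `∂/∂p_1` -/
def d1 : SymA →ₗ[F] SymA := (pderiv (1 : ℕ+)).toLinearMap

lemma d1_apply (f : SymA) : d1 f = pderiv (1 : ℕ+) f := rfl

lemma d1_mul (f g : SymA) : d1 (f * g) = f * d1 g + g * d1 f := by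
  simp only [d1_apply, Derivation.leibniz, smul_eq_mul]

lemma coeff_V_one (f : SymA) : (V f).coeff 1 = alpha • d1 f := by
  have := coeff_V f 1
  simpa [d1_apply] using this

lemma H_d1 (f g : SymA) : H (pp 1 * f) g = alpha * H f (d1 g) := by
  rw [H_pp_mul, coeff_V_one, map_smul, smul_eq_mul]

lemma d1_gg_zero : d1 (gg 0) = 0 := by
  rw [gg_zero, d1_apply]; simp

lemma d1_gg (k : ℕ) : d1 (gg (k + 1)) = alpha⁻¹ • gg k := by
  have h := coeff_V_one (gg (k + 1))
  rw [V_gg_succ, Polynomial.coeff_X_mul, xx, Polynomial.coeff_add, coeff_V_zero,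
    Polynomial.coeff_C_zero, add_zero] at h
  rw [h, smul_smul, inv_mul_cancel₀ alpha_ne, one_smul]

lemma Is_gP {s : ℕ} {k : JPartition} (hk : ¬ ple k s) : gP k ∈ Is s :=
  Submodule.subset_span ⟨k, hk, rfl⟩

lemma d1_Is (s : ℕ) {f : SymA} (hf : f ∈ Is (s + 1)) : d1 f ∈ Is s := by
  refine span_map d1 ?_ hf
  rintro _ ⟨k, hk, rfl⟩
  obtain ⟨i, hi, h⟩ := not_ple.1 hk
  obtain ⟨k, rfl⟩ := Multiset.exists_cons_of_mem hi
  obtain ⟨j, hj⟩ : ∃ j, (i : ℕ) = j + 1 := ⟨i - 1, by omega⟩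
  rw [gP_cons, d1_mul, hj, d1_gg]
  refine add_mem (Is_gg (by omega) _) ?_
  rw [mul_smul_comm, mul_comm]
  exact Submodule.smul_mem _ _ (Is_gg (by omega) _)

variable {J : JPartition → SymA}

lemma J_Is (hJ : IsJackFamily J) {s : ℕ} {l : JPartition} (h : ¬ ple l s) : J l ∈ Is s := by
  rw [Is_eq hJ]
  exact Submodule.subset_span ⟨l, h, rfl⟩

lemma H_deg (hJ : IsJackFamily J) {n : ℕ} {f : SymA} (hf : f ∈ Hom n) {l : JPartition}
    (h : H f (J l) ≠ 0) : psize l = n := by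
  have := Hom_le_GS n hf
  rw [← GS_eq hJ] at this
  exact (mem_spanJ hJ).1 this l h

lemma H_gg_f (hJ : IsJackFamily J) (r : ℕ+) (k : JPartition) (hk : ple k r) (f : SymA)
    (h : H f (J k) = 0) : H (gg r * f) (J (r ::ₘ k)) = 0 := by
  have hf : f ∈ Submodule.span F (J '' {m | m ≠ k}) := by
    refine (mem_spanJ hJ).2 fun l hl => ?_
    rintro rfl
    exact hl h
  have hk' : ple (r ::ₘ k) r := ple_cons.2 ⟨le_rfl, hk⟩
  refine (Submodule.mem_bot F).1 (span_map (H.flip (J (r ::ₘ k)) ∘ₗ LinearMap.mulLeft F (gg r)) (S := ⊥) ?_ hf)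
  rintro _ ⟨m, hm, rfl⟩
  refine (Submodule.mem_bot F).2 ?_
  change H (gg r * J m) (J (r ::ₘ k)) = 0
  by_cases hp : ple m r
  · by_contra hc
    have := (H_gJ hJ r m _ hp hk').1 hc
    exact hm ((Multiset.cons_inj_right r).1 this).symm
  · exact H_Is hJ hk' (Is_mul _ _ (J_Is hJ hp))

lemma pieri (hJ : IsJackFamily J) (k l : JPartition) (u : F) (h : H (pp 1 * J l) (J k) ≠ 0) :
    cc u k = (u + ee k - ee l) * cc u l := by
  induction k using part_ind generalizing l u with
  | h0 =>
    have := H_deg hJ (Hom_mul (Hom_pp 1) (Hom_J hJ l)) h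
    simp at this
    omega
  | h1 r k hk ih =>
    have hd := H_deg hJ (Hom_mul (Hom_pp 1) (Hom_J hJ l)) h
    have hk' : ple (r ::ₘ k) r := ple_cons.2 ⟨le_rfl, hk⟩
    by_cases hl : ple l r
    swap
    · exact absurd (H_Is hJ hk' (Is_mul _ _ (J_Is hJ hl))) h
    by_cases hr : r ∈ l
    · obtain ⟨l, rfl⟩ := Multiset.exists_cons_of_mem hr
      have hl := (ple_cons.1 hl).2
      obtain ⟨c, hc, hm⟩ := gJ_mod hJ r l hl
      have h1 := H_Is hJ hk' (Is_mul _ (pp 1) hm)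
      rw [mul_sub, map_sub, LinearMap.sub_apply, mul_smul_comm, map_smul, LinearMap.smul_apply,
        sub_eq_zero, mul_left_comm] at h1
      have h2 : H (pp 1 * J l) (J k) ≠ 0 := by
        intro h0
        rw [H_gg_f hJ r k hk _ h0] at h1
        exact smul_ne_zero hc h h1.symm
      have h3 := ih l (u - 1) h2
      have hd' := H_deg hJ (Hom_mul (Hom_pp 1) (Hom_J hJ l)) h2
      rw [cc_cons _ _ _ hk, cc_cons _ _ _ hl, h3, ee_cons _ _ hk, ee_cons _ _ hl, hd']
      push_cast
      ring
    · obtain ⟨R, hR⟩ : ∃ R, (r : ℕ) = R + 1 := ⟨r - 1, by have := r.pos; omega⟩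
      have hlR : ple l R := by
        intro i hi
        have h1 := hl i hi
        have h2 : (i : ℕ) ≠ r := fun h => hr (by rwa [← PNat.coe_injective h])
        omega
      obtain ⟨c, hc, hm⟩ := gJ_mod hJ r k hk
      rw [hR] at hm
      have h1 := H_Is hJ hlR (d1_Is R hm)
      rw [map_sub, d1_mul, map_smul, map_sub, map_add, LinearMap.sub_apply, LinearMap.add_apply,
        H_Is hJ hlR (Is_gg (Nat.lt_succ_self R) _), zero_add, d1_gg, map_smul, LinearMap.smul_apply,
        H_comm (d1 _), sub_eq_zero, mul_smul_comm, map_smul, LinearMap.smul_apply, mul_comm] at h1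
      rw [H_d1] at h
      have h2 : H (gg R * J k) (J l) ≠ 0 := by
        intro h0
        rw [h0, smul_zero] at h1
        exact smul_ne_zero hc (right_ne_zero_of_mul h) h1.symm
      have hkR : ple k R := by
        by_contra hkR
        exact h2 (H_Is hJ hlR (Is_mul _ _ (J_Is hJ hkR)))
      rcases nat_cases R with rfl | ⟨q, rfl⟩
      · have hk0 : k = 0 := by
          refine Multiset.eq_zero_of_forall_notMem fun i hi => ?_
          have := hkR i hi
          have := i.pos
          omega
        have hl0 : l = 0 := by
          refine Multiset.eq_zero_of_forall_notMem fun i hi => ?_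
          have := hlR i hi
          have := i.pos
          omega
        subst hk0; subst hl0
        rw [cc_cons _ _ _ hk, ee_cons _ _ hk, hR]
        simp [cc_zero, ee_zero]
      · have := (H_gJ hJ q k l hkR hlR).1 h2
        subst this
        rw [cc_cons _ _ _ hk, cc_cons _ _ _ hkR, ee_cons _ _ hk, ee_cons _ _ hkR, hR,
          Finset.prod_range_succ, Nat.choose_succ_succ' (q : ℕ) 1, Nat.choose_one_right]
        push_cast
        ring

end JK

set_option linter.unusedSimpArgs false

namespace JK
open Finset.HasAntidiagonal (antidiagonal)
open Polynomial (X C monomial)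
open MvPolynomial (pderiv rename)

/-! ### Operators diagonal in the Jack basis -/

variable {J : JPartition → SymA}

/-- diagonal operator -/
def dg (hJ : IsJackFamily J) (a : JPartition → F) : SymA →ₗ[F] SymA :=
  (bJ hJ).constr F (fun l => a l • J l)

lemma dg_J (hJ : IsJackFamily J) (a : JPartition → F) (l : JPartition) : dg hJ a (J l) = a l • J l := by
  have := (bJ hJ).constr_basis F (fun l => a l • J l) l
  rwa [bJ_apply] at this

lemma J_ext (hJ : IsJackFamily J) {M : Type*} [AddCommGroup M] [Module F M] {T T' : SymA →ₗ[F] M}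
    (h : ∀ l, T (J l) = T' (J l)) (f : SymA) : T f = T' f := by
  have : T = T' := (bJ hJ).ext fun l => by rw [bJ_apply]; exact h l
  rw [this]

lemma H_dg (hJ : IsJackFamily J) (a : JPartition → F) (f : SymA) (k : JPartition) :
    H (dg hJ a f) (J k) = a k * H f (J k) := by
  refine J_ext hJ (T := H.flip (J k) ∘ₗ dg hJ a) (T' := a k • H.flip (J k)) (fun l => ?_) f
  change H (dg hJ a (J l)) (J k) = a k * H (J l) (J k)
  rw [dg_J, map_smul, LinearMap.smul_apply, smul_eq_mul]
  by_cases h : l = k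
  · rw [h]
  · rw [J_orth hJ h]; simp

lemma H_dg' (hJ : IsJackFamily J) (a : JPartition → F) (f g : SymA) :
    H (dg hJ a f) g = H f (dg hJ a g) := by
  refine J_ext hJ (T := H (dg hJ a f)) (T' := H f ∘ₗ dg hJ a) (fun l => ?_) g
  rw [H_dg]
  change _ = H f (dg hJ a (J l))
  rw [dg_J, map_smul, smul_eq_mul]

/-- The operator `C_u`. -/
def CC (hJ : IsJackFamily J) (u : F) : SymA →ₗ[F] SymA := dg hJ (cc u)
/-- The (pseudo) inverse of `C_u`. -/
def Ci (hJ : IsJackFamily J) (u : F) : SymA →ₗ[F] SymA := dg hJ (fun l => (cc u l)⁻¹)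

lemma CC_p1 (hJ : IsJackFamily J) (u : F) (f : SymA) : CC hJ u (pp 1 * f) = BB u 1 (CC hJ u f) := by
  refine J_ext hJ (T := CC hJ u ∘ₗ LinearMap.mulLeft F (pp 1)) (T' := BB u 1 ∘ₗ CC hJ u) (fun l => ?_) f
  change CC hJ u (pp 1 * J l) = BB u 1 (CC hJ u (J l))
  refine H_ext hJ fun k => ?_
  rw [CC, H_dg, dg_J, map_smul, map_smul, LinearMap.smul_apply, BB_one', D_J hJ, map_add, map_sub,
    LinearMap.add_apply, LinearMap.sub_apply, H_D, D_J hJ, mul_smul_comm]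
  simp only [map_smul, LinearMap.smul_apply, smul_eq_mul]
  by_cases h : H (pp 1 * J l) (J k) = 0
  · rw [h]; ring
  · rw [pieri hJ k l u h]; ring

lemma dg_D (hJ : IsJackFamily J) (a : JPartition → F) (f : SymA) : D (dg hJ a f) = dg hJ a (D f) := by
  refine J_ext hJ (T := D ∘ₗ dg hJ a) (T' := dg hJ a ∘ₗ D) (fun l => ?_) f
  change D (dg hJ a (J l)) = dg hJ a (D (J l))
  rw [dg_J, D_J hJ, map_smul, map_smul, D_J hJ, dg_J, smul_comm]

/-- `[D, p_1]` -/
def EE (f : SymA) : SymA := D (pp 1 * f) - pp 1 * D f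

lemma EE_eq (f : SymA) : EE f = rho (X * V f) := by
  have h1 := BB_one 0 f
  rw [BB_one' 0 f] at h1
  simpa [EE] using h1

lemma EE_pp (n : ℕ) (f : SymA) : EE (pp n * f) - pp n * EE f = (alpha * (n : F)) • (pp (n + 1) * f) := by
  rw [EE_eq, EE_eq, V_mul, mul_add, map_add, mul_left_comm, rho_C_mul, add_sub_cancel_left, V_pp',
    mul_smul_comm, mul_smul_comm, map_smul, mul_left_comm, rho_C_mul, ← pow_succ', ← Polynomial.monomial_one_right_eq_X_pow,
    rho_mon, mul_one, mul_comm f]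

lemma CC_EE (hJ : IsJackFamily J) (u : F) (f : SymA) : CC hJ u (EE f) = MM u (CC hJ u f) := by
  rw [EE, map_sub, CC_p1, CC, ← dg_D, ← CC, CC_p1]
  simp only [MM, LinearMap.sub_apply, Module.End.mul_apply]
  rw [CC, dg_D]

lemma CC_pp (hJ : IsJackFamily J) (u : F) (n : ℕ) (f : SymA) :
    CC hJ u (pp (n + 1) * f) = BB u (n + 1) (CC hJ u f) := by
  induction n generalizing f with
  | zero => exact CC_p1 hJ u f
  | succ n ih =>
    have h1 := congrArg (CC hJ u) (EE_pp (n + 1) f)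
    rw [map_sub, CC_EE, ih, ih, CC_EE, map_smul] at h1
    have h2 := congrArg (fun T => T (CC hJ u f)) (BB_rel u (n + 1))
    simp only [LinearMap.sub_apply, Module.End.mul_apply, LinearMap.smul_apply] at h2
    rw [h2, mul_comm] at h1
    have hne : alpha * ((n + 1 : ℕ) : F) ≠ 0 := by
      have := an_ne n
      push_cast; exact this
    exact (smul_right_injective SymA hne h1).symm

/-- adjoint of `BB u 1`, up to `alpha` -/
def TT (u : F) (f : SymA) : SymA := u • d1 f + alpha⁻¹ • A1t f

lemma H_TT (u : F) (f g : SymA) : H (BB u 1 f) g = alpha * H f (TT u g) := by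
  rw [BB_one, TT, map_add, LinearMap.add_apply, map_smul, LinearMap.smul_apply, H_d1, H_A1, map_add,
    map_smul, map_smul, smul_eq_mul, smul_eq_mul, smul_eq_mul, mul_add, mul_inv_cancel_left₀ alpha_ne]
  ring

lemma TT_mul (u : F) (f g : SymA) : TT u (f * g) = f * TT u g + g * TT u f := by
  simp only [TT, d1_mul, A1t_mul, smul_eq_cF]; ring

lemma TT_add (u : F) (f g : SymA) : TT u (f + g) = TT u f + TT u g := by
  simp only [TT, A1t, map_add, Polynomial.divX_add, smul_add]; abel

lemma TT_zero (u : F) : TT u 0 = 0 := by simp [TT, A1t]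

lemma TT_smul (u a : F) (f : SymA) : TT u (a • f) = a • TT u f := by
  have : a • f = cF a * f := smul_eq_cF a f
  rw [this, TT_mul]
  have h : TT u (cF a) = 0 := by
    rw [TT, A1t, d1_apply, cF, MvPolynomial.pderiv_C]
    have : V (MvPolynomial.C a) = 0 := V.map_algebraMap a
    rw [this]; simp
  rw [h, mul_zero, add_zero, ← smul_eq_cF]

lemma TT_sum (u : F) {ι : Type*} (s : Finset ι) (f : ι → SymA) : TT u (∑ i ∈ s, f i) = ∑ i ∈ s, TT u (f i) :=
  map_sum (⟨⟨TT u, TT_zero u⟩, TT_add u⟩ : SymA →+ SymA) f s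

lemma d1_CC (hJ : IsJackFamily J) (u : F) (f : SymA) : d1 (CC hJ u f) = CC hJ u (TT u f) := by
  refine H_ext hJ fun k => ?_
  have h : alpha * H (J k) (d1 (CC hJ u f)) = alpha * H (J k) (CC hJ u (TT u f)) := by
    rw [← H_d1, CC, ← H_dg', ← CC, CC_p1, H_TT, CC, H_dg']
  rw [H_comm, mul_left_cancel₀ alpha_ne h, H_comm]

lemma A1t_gg (i : ℕ) : A1t (gg (i + 1)) = (alpha * (i : F)) • gg i := by
  have hd : Polynomial.divX (X * xx i) = xx i := by
    ext1 n
    rw [Polynomial.coeff_divX, Polynomial.coeff_X_mul]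
  rw [A1t, V_gg_succ, hd, xx, map_add, rho_V_gg]
  have : rho (C (gg i)) = 0 := by
    rw [← Polynomial.monomial_zero_left, rho_mon, pp_zero, zero_mul]
  rw [this, zero_add]

lemma TT_gg (s i : ℕ) : TT (-(alpha * (s : F))) (gg (i + 1)) = ((i : F) - s) • gg i := by
  rw [TT, A1t_gg, d1_gg, smul_smul, smul_smul, ← add_smul, ← mul_assoc, inv_mul_cancel₀ alpha_ne, one_mul,
    neg_mul, mul_comm alpha, mul_assoc, mul_inv_cancel₀ alpha_ne]
  congr 1; ring

lemma TT_gg_zero (u : F) : TT u (gg 0) = 0 := by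
  rw [TT, d1_gg_zero, A1t, V_gg_zero]; simp

/-! ### the space orthogonal to `Is s` -/

/-- orthogonal of `Is s` -/
def Ms (s : ℕ) : Submodule F SymA where
  carrier := {f | ∀ h ∈ Is s, H h f = 0}
  add_mem' := by
    intro a b ha hb h hh
    rw [map_add, ha h hh, hb h hh, add_zero]
  zero_mem' := by intro h hh; simp
  smul_mem' := by
    intro c a ha h hh
    rw [map_smul, ha h hh, smul_zero]

lemma mem_Ms {s : ℕ} {f : SymA} : f ∈ Ms s ↔ ∀ h ∈ Is s, H h f = 0 := Iff.rfl

lemma mem_MsJ (hJ : IsJackFamily J) {s : ℕ} {f : SymA} : f ∈ Ms s ↔ ∀ l, ¬ ple l s → H f (J l) = 0 := by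
  constructor
  · intro h l hl
    rw [H_comm]; exact h _ (J_Is hJ hl)
  · intro h x hx
    rw [Is_eq hJ] at hx
    refine (Submodule.mem_bot F).1 (span_map (H.flip f) (S := ⊥) ?_ hx)
    rintro _ ⟨l, hl, rfl⟩
    rw [Submodule.mem_bot]
    change H (J l) f = 0
    rw [H_comm]; exact h l hl

lemma J_Ms (hJ : IsJackFamily J) {s : ℕ} {l : JPartition} (h : ple l s) : J l ∈ Ms s :=
  fun _ hx => H_Is hJ h hx

lemma dg_Ms (hJ : IsJackFamily J) (a : JPartition → F) {s : ℕ} {f : SymA} (hf : f ∈ Ms s) :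
    dg hJ a f ∈ Ms s := by
  rw [mem_MsJ hJ] at hf ⊢
  intro l hl
  rw [H_dg, hf l hl, mul_zero]

lemma Is_D (hJ : IsJackFamily J) {s : ℕ} {f : SymA} (hf : f ∈ Is s) : D f ∈ Is s := by
  have h := hf
  rw [Is_eq hJ] at h
  refine span_map D ?_ h
  rintro _ ⟨l, hl, rfl⟩
  rw [D_J hJ]
  exact Submodule.smul_mem _ _ (J_Is hJ hl)

lemma Is_BB (hJ : IsJackFamily J) (u : F) {s : ℕ} {f : SymA} (hf : f ∈ Is s) : BB u 1 f ∈ Is s := by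
  rw [BB_one']
  have h := Is_mul s (pp 1) hf
  exact add_mem (Submodule.smul_mem _ _ h) (sub_mem (Is_D hJ h) (Is_mul _ _ (Is_D hJ hf)))

lemma Ms_d1 {s : ℕ} {f : SymA} (hf : f ∈ Ms s) : d1 f ∈ Ms s := by
  intro x hx
  have := H_d1 x f
  rw [hf _ (Is_mul _ _ hx)] at this
  exact (mul_eq_zero.1 this.symm).resolve_left alpha_ne

lemma Ms_TT (hJ : IsJackFamily J) (u : F) {s : ℕ} {f : SymA} (hf : f ∈ Ms s) : TT u f ∈ Ms s := by
  intro x hx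
  have := H_TT u x f
  rw [hf _ (Is_BB hJ u hx)] at this
  exact (mul_eq_zero.1 this.symm).resolve_left alpha_ne

/-- `-α s` -/
def us (s : ℕ) : F := -(alpha * (s : F))

lemma ccs_ne (s : ℕ) (l : JPartition) (h : ple l s) : cc (us s) l ≠ 0 :=
  cc_ne _ s 0 (by simp [us]) l h

lemma CC_Is (hJ : IsJackFamily J) {s : ℕ} {f : SymA} (hf : f ∈ Is s) : CC hJ (us s) f = 0 := by
  refine H_ext hJ fun l => ?_
  rw [CC, H_dg, map_zero, LinearMap.zero_apply]
  by_cases h : ple l s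
  · rw [H_Is hJ h hf, mul_zero]
  · rw [us, cc_eq_zero s l h, zero_mul]

lemma CC_Ci (hJ : IsJackFamily J) {s : ℕ} {f : SymA} (hf : f ∈ Ms s) : CC hJ (us s) (Ci hJ (us s) f) = f := by
  rw [mem_MsJ hJ] at hf
  refine H_ext hJ fun l => ?_
  rw [CC, Ci, H_dg, H_dg]
  by_cases h : ple l s
  · rw [mul_inv_cancel_left₀ (ccs_ne s l h)]
  · rw [hf l h]; simp

lemma Ci_CC (hJ : IsJackFamily J) {s : ℕ} {f : SymA} (hf : f ∈ Ms s) : Ci hJ (us s) (CC hJ (us s) f) = f := by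
  rw [mem_MsJ hJ] at hf
  refine H_ext hJ fun l => ?_
  rw [CC, Ci, H_dg, H_dg]
  by_cases h : ple l s
  · rw [inv_mul_cancel_left₀ (ccs_ne s l h)]
  · rw [hf l h]; simp

lemma TT_Ci (hJ : IsJackFamily J) {s : ℕ} {f : SymA} (hf : f ∈ Ms s) :
    TT (us s) (Ci hJ (us s) f) = Ci hJ (us s) (d1 f) := by
  have h := d1_CC hJ (us s) (Ci hJ (us s) f)
  rw [CC_Ci hJ hf] at h
  rw [h]
  exact (Ci_CC hJ (Ms_TT hJ _ (dg_Ms hJ _ hf))).symm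

end JK

set_option linter.unusedSimpArgs false

namespace JK
open Finset.HasAntidiagonal (antidiagonal)
open Polynomial (X C monomial)
open MvPolynomial (pderiv rename)

/-! ### Adding a long row to a Jack polynomial -/

variable {J : JPartition → SymA}

/-- divided derivatives of Jack polynomials -/
def Phi (J : JPartition → SymA) (l : JPartition) (a : ℕ) : SymA := ((a.factorial : F))⁻¹ • (d1 ^ a) (J l)

lemma Phi_zero (l : JPartition) : Phi J l 0 = J l := by simp [Phi]

lemma d1_Phi (l : JPartition) (a : ℕ) : d1 (Phi J l a) = ((a : F) + 1) • Phi J l (a + 1) := by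
  rw [Phi, Phi, map_smul, smul_smul, pow_succ', Module.End.mul_apply, Nat.factorial_succ]
  congr 1
  have : ((a : F) + 1) ≠ 0 := by exact_mod_cast Nat.succ_ne_zero a
  have h2 : ((a.factorial : F)) ≠ 0 := by exact_mod_cast Nat.factorial_ne_zero a
  push_cast
  field_simp

lemma coeff_d1_pow (a : ℕ) (f : SymA) (m : Exp) : MvPolynomial.coeff m ((d1 ^ a) f)
    = ((m 1 + 1).ascFactorial a : F) * MvPolynomial.coeff (m + Finsupp.single 1 a) f := by
  induction a generalizing f with
  | zero => simp
  | succ a ih =>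
    rw [pow_succ, Module.End.mul_apply, ih, d1_apply, MvPolynomial.coeff_pderiv, add_assoc,
      ← Finsupp.single_add, Nat.ascFactorial]
    simp only [Finsupp.add_apply, Finsupp.single_eq_same]
    push_cast
    ring

lemma coeff_Phi (l : JPartition) (a : ℕ) (m : Exp) : MvPolynomial.coeff m (Phi J l a)
    = ((m 1 + a).choose a : F) * MvPolynomial.coeff (m + Finsupp.single 1 a) (J l) := by
  rw [Phi, MvPolynomial.coeff_smul, coeff_d1_pow, Nat.ascFactorial_eq_factorial_mul_choose, smul_eq_mul]
  have h2 : ((a.factorial : F)) ≠ 0 := by exact_mod_cast Nat.factorial_ne_zero a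
  push_cast
  field_simp

lemma Phi_wt (hJ : IsJackFamily J) {l : JPartition} {a : ℕ} {m : Exp}
    (h : MvPolynomial.coeff m (Phi J l a) ≠ 0) : wt m + a = psize l := by
  rw [coeff_Phi] at h
  have := mem_Hom.1 (Hom_J hJ l) _ (right_ne_zero_of_mul h)
  rw [wt_add, wt_single] at this
  simpa using this

lemma Phi_gt (hJ : IsJackFamily J) {l : JPartition} {a : ℕ} (h : psize l < a) : Phi J l a = 0 := by
  ext m
  rw [MvPolynomial.coeff_zero]
  by_contra hc
  have := Phi_wt hJ hc
  omega

lemma Hom_Phi (hJ : IsJackFamily J) (l : JPartition) {a d : ℕ} (h : d + a = psize l) :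
    Phi J l a ∈ Hom d :=
  mem_Hom.2 fun m hm => by have := Phi_wt hJ hm; omega

lemma wt_eq_zero {m : Exp} (h : wt m = 0) : m = 0 := by
  obtain ⟨l, rfl⟩ := toExp_surj m
  rw [wt_toExp] at h
  have : l = 0 := by
    refine Multiset.eq_zero_of_forall_notMem fun i hi => ?_
    have := ple_of_psize (s := 0) h.le i hi
    have := i.pos
    omega
  rw [this, toExp_zero]

lemma Phi_top (hJ : IsJackFamily J) (l : JPartition) : Phi J l (psize l) = 1 := by
  ext m
  rw [MvPolynomial.coeff_one]
  split_ifs with h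
  · subst h
    rw [coeff_Phi]
    simp [hJ.normalized l]
  · by_contra hc
    have := Phi_wt hJ hc
    exact h (wt_eq_zero (by omega)).symm

lemma J_zero (hJ : IsJackFamily J) : J 0 = 1 := by
  have := Phi_top hJ 0
  rwa [psize_zero, Phi_zero] at this

lemma Phi_Ms (hJ : IsJackFamily J) {l : JPartition} {s : ℕ} (h : ple l s) (a : ℕ) : Phi J l a ∈ Ms s := by
  refine Submodule.smul_mem _ _ ?_
  induction a with
  | zero => exact J_Ms hJ h
  | succ a ih => rw [pow_succ', Module.End.mul_apply]; exact Ms_d1 ih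

/-- signed `g_{s-j}` -/
def yy (s j : ℕ) : SymA := if j ≤ s then (-1 : F) ^ j • gg (s - j) else 0

lemma TT_yy (s j : ℕ) : TT (us s) (yy s j) = ((j : F) + 1) • yy s (j + 1) := by
  unfold yy
  rcases lt_trichotomy j s with h | h | h
  · obtain ⟨i, rfl⟩ : ∃ i, s = j + 1 + i := ⟨s - j - 1, by omega⟩
    rw [if_pos (by omega), if_pos (by omega), TT_smul, show j + 1 + i - j = i + 1 by omega,
      show j + 1 + i - (j + 1) = i by omega, us, TT_gg, smul_smul, smul_smul]
    congr 1
    push_cast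
    ring
  · subst h
    rw [if_pos le_rfl, if_neg (by omega), TT_smul, Nat.sub_self, TT_gg_zero, smul_zero, smul_zero]
  · rw [if_neg (by omega), if_neg (by omega), TT_zero, smul_zero]

/-- the convolution -/
def zc (hJ : IsJackFamily J) (s : ℕ) (l : JPartition) (k : ℕ) : SymA :=
  ∑ x ∈ antidiagonal k, yy s x.1 * Ci hJ (us s) (Phi J l x.2)

lemma conv_deriv (c p : ℕ → SymA) (k : ℕ) :
    ∑ x ∈ antidiagonal k, (c x.1 * (((x.2 : F) + 1) • p (x.2 + 1)) + p x.2 * (((x.1 : F) + 1) • c (x.1 + 1)))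
    = ((k : F) + 1) • ∑ x ∈ antidiagonal (k + 1), c x.1 * p x.2 := by
  have e : ((k : F) + 1) • ∑ x ∈ antidiagonal (k + 1), c x.1 * p x.2
      = ∑ x ∈ antidiagonal (k + 1), (x.1 : F) • (c x.1 * p x.2)
      + ∑ x ∈ antidiagonal (k + 1), (x.2 : F) • (c x.1 * p x.2) := by
    rw [← Finset.sum_add_distrib, Finset.smul_sum]
    refine Finset.sum_congr rfl fun x hx => ?_
    rw [← add_smul]
    congr 1
    have := Finset.HasAntidiagonal.mem_antidiagonal.1 hx
    exact_mod_cast this.symm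
  rw [e, Finset.Nat.sum_antidiagonal_succ, Finset.Nat.sum_antidiagonal_succ' (f := fun x : ℕ × ℕ => (x.2 : F) • (c x.1 * p x.2))]
  simp only [Nat.cast_zero, zero_smul, zero_add, ← Finset.sum_add_distrib]
  refine Finset.sum_congr rfl fun x hx => ?_
  push_cast
  rw [mul_smul_comm, mul_smul_comm, mul_comm (p x.2), add_comm]

lemma TT_zc (hJ : IsJackFamily J) (s : ℕ) {l : JPartition} (hl : ple l s) (k : ℕ) :
    TT (us s) (zc hJ s l k) = ((k : F) + 1) • zc hJ s l (k + 1) := by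
  rw [zc, TT_sum, zc, ← conv_deriv (yy s) (fun a => Ci hJ (us s) (Phi J l a))]
  refine Finset.sum_congr rfl fun x _ => ?_
  rw [TT_mul, TT_yy, TT_Ci hJ (Phi_Ms hJ hl _), d1_Phi, map_smul]

lemma CC_one (hJ : IsJackFamily J) (a : JPartition → F) (ha : a 0 = 1) : dg hJ a 1 = 1 := by
  have := dg_J hJ a 0
  rwa [J_zero hJ, ha, one_smul] at this

lemma zc_top (hJ : IsJackFamily J) (s : ℕ) (l : JPartition) :
    zc hJ s l (s + psize l) = (-1 : F) ^ s • 1 := by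
  rw [zc, Finset.sum_eq_single (s, psize l)]
  · rw [Phi_top hJ, Ci, CC_one hJ _ (by rw [cc_zero, inv_one]), yy, if_pos le_rfl, Nat.sub_self, gg_zero, mul_one]
  · intro x hx hne
    have := Finset.HasAntidiagonal.mem_antidiagonal.1 hx
    by_cases h : x.1 ≤ s
    · have : psize l < x.2 := by
        by_contra hc
        exact hne (Prod.ext (by simp; omega) (by simp; omega))
      rw [Phi_gt hJ this, map_zero, mul_zero]
    · rw [yy, if_neg h, zero_mul]
  · intro h
    exact absurd (Finset.HasAntidiagonal.mem_antidiagonal (n := s + psize l).2 rfl) h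

lemma add_row (hJ : IsJackFamily J) (s : ℕ+) {l : JPartition} (hl : ple l s) (k : ℕ) :
    Phi J (s ::ₘ l) k = (-1 : F) ^ (s : ℕ) • CC hJ (us s) (zc hJ s l k) := by
  obtain ⟨e, he⟩ : ∃ e : F, CC hJ (us s) (zc hJ s l 0) = e • J (s ::ₘ l) := by
    obtain ⟨c, hc, hm⟩ := gJ_mod hJ s l hl
    have h1 := CC_Is hJ hm
    rw [map_sub, sub_eq_zero, map_smul, CC, dg_J, ← CC] at h1
    refine ⟨(cc (us s) l)⁻¹ * (c * cc (us s) (s ::ₘ l)), ?_⟩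
    rw [zc, Finset.Nat.antidiagonal_zero, Finset.sum_singleton, Phi_zero, Ci, dg_J, yy, if_pos (Nat.zero_le _),
      pow_zero, one_smul, Nat.sub_zero, mul_smul_comm, map_smul, h1, smul_smul, smul_smul, mul_assoc]
  have hk : ∀ k, CC hJ (us s) (zc hJ s l k) = e • Phi J (s ::ₘ l) k := by
    intro k
    induction k with
    | zero => rw [he, Phi_zero]
    | succ k ih =>
      have h1 := congrArg d1 ih
      rw [d1_CC, TT_zc hJ s hl, map_smul, map_smul, d1_Phi, smul_comm e] at h1
      have : ((k : F) + 1) ≠ 0 := by exact_mod_cast Nat.succ_ne_zero k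
      exact smul_right_injective SymA this h1
  have h2 := hk (s + psize l)
  rw [zc_top, ← psize_cons, Phi_top hJ, map_smul, CC, CC_one hJ _ (cc_zero _)] at h2
  have h3 : (-1 : F) ^ (s : ℕ) = e := by
    have := congrArg (MvPolynomial.coeff 0) h2
    simpa using this
  rw [hk, h3, smul_smul, ← h3, ← mul_pow]
  simp

/-! ### Truncated generating functions -/

/-- `Θ_{λ,d}` -/
def Th (J : JPartition → SymA) (l : JPartition) (d : ℕ) : SymA :=
  if d ≤ psize l then Phi J l (psize l - d) else 0

lemma Hom_Th (hJ : IsJackFamily J) (l : JPartition) (d : ℕ) : Th J l d ∈ Hom d := by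
  rw [Th]
  split_ifs with h
  · exact Hom_Phi hJ l (by omega)
  · exact zero_mem _

lemma theta_eq (m l : JPartition) :
    theta J m l = MvPolynomial.coeff (toExp m) (Th J l (psize m)) := by
  rw [theta, Th]
  by_cases h : psize l < psize m
  · rw [if_pos h, if_neg (by omega), MvPolynomial.coeff_zero]
  · rw [if_neg h, if_pos (by omega), coeff_Phi]
    have e1 : toExp (addOnes m (psize l - psize m)) = toExp m + Finsupp.single 1 (psize l - psize m) := by
      rw [addOnes, toExp_add]
      congr 1
      rw [toExp_eq]
      ext i
      simp [Multiset.count_replicate, Finsupp.single_apply, eq_comm]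
      try (split_ifs <;> simp)
    have e2 : (toExp m) 1 = pmult m 1 := by
      simp [toExp_eq, pmult]
    rw [e1, e2, add_comm (psize l - psize m), ← Nat.choose_symm_add]

lemma Hom_Ms (hJ : IsJackFamily J) {d s : ℕ} (h : d ≤ s) {f : SymA} (hf : f ∈ Hom d) : f ∈ Ms s := by
  rw [mem_MsJ hJ]
  intro l hl
  by_contra hc
  exact hl (ple_of_psize (by rw [H_deg hJ hf hc]; exact h))

lemma Hom_dg (hJ : IsJackFamily J) (a : JPartition → F) {d : ℕ} {f : SymA} (hf : f ∈ Hom d) :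
    dg hJ a f ∈ Hom d := by
  have h := Hom_le_GS _ hf
  rw [← GS_eq hJ] at h
  refine span_map (dg hJ a) ?_ h
  rintro _ ⟨l, hl, rfl⟩
  rw [dg_J]
  have := Hom_J hJ l
  rw [show psize l = d from hl] at this
  exact Submodule.smul_mem _ _ this

lemma Th_row (hJ : IsJackFamily J) (s : ℕ+) {l : JPartition} (hl : ple l s) {d : ℕ} (hd : d ≤ s) :
    Ci hJ (us s) (Th J (s ::ₘ l) d)
      = ∑ x ∈ antidiagonal d, ((-1 : F) ^ x.1 • gg x.1) * Ci hJ (us s) (Th J l x.2) := by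
  have hx : ∑ x ∈ antidiagonal d, ((-1 : F) ^ x.1 • gg x.1) * Ci hJ (us s) (Th J l x.2) ∈ Hom d := by
    refine Submodule.sum_mem _ fun x hx => ?_
    have e := Finset.HasAntidiagonal.mem_antidiagonal.1 hx
    have := Hom_mul (Submodule.smul_mem _ ((-1 : F) ^ x.1) (Hom_gg x.1)) (Hom_dg hJ (fun l => (cc (us s) l)⁻¹) (Hom_Th hJ l x.2))
    rwa [e] at this
  rw [← Ci_CC hJ (Hom_Ms hJ hd hx)]
  congr 1
  rw [Th, psize_cons, if_pos (by omega), add_row hJ s hl, ← map_smul]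
  congr 1
  rw [zc, Finset.smul_sum]
  symm
  refine Finset.sum_bij_ne_zero (fun x _ _ => ((s : ℕ) - x.1, psize l - x.2)) ?_ ?_ ?_ ?_
  · intro x hx hne
    have e := Finset.HasAntidiagonal.mem_antidiagonal.1 hx
    have h2 : x.2 ≤ psize l := by
      by_contra hc
      apply hne
      rw [Th, if_neg hc, map_zero, mul_zero]
    rw [Finset.HasAntidiagonal.mem_antidiagonal]
    simp only
    omega
  · intro x hx hne y hy hne' hxy
    have e := Finset.HasAntidiagonal.mem_antidiagonal.1 hx
    have e' := Finset.HasAntidiagonal.mem_antidiagonal.1 hy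
    have := (Prod.mk.inj hxy).1
    exact Prod.ext (by omega) (by omega)
  · intro y hy hne
    have e := Finset.HasAntidiagonal.mem_antidiagonal.1 hy
    have h1 : y.1 ≤ s := by
      by_contra hc
      apply hne
      rw [yy, if_neg hc, zero_mul, smul_zero]
    have h2 : y.2 ≤ psize l := by
      by_contra hc
      apply hne
      rw [Phi_gt hJ (by omega), map_zero, mul_zero, smul_zero]
    refine ⟨((s : ℕ) - y.1, psize l - y.2), ?_, ?_, ?_⟩
    · rw [Finset.HasAntidiagonal.mem_antidiagonal]
      simp only
      omega
    · intro h0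
      apply hne
      simp only at h0
      rw [Th, if_pos (by omega), show psize l - (psize l - y.2) = y.2 by omega, smul_mul_assoc] at h0
      have h0' := (smul_eq_zero.1 h0).resolve_left (pow_ne_zero _ (by simp))
      rw [yy, if_pos h1, smul_mul_assoc, h0', smul_zero, smul_zero]
    · ext <;> simp only <;> omega
  · intro x hx hne
    have e := Finset.HasAntidiagonal.mem_antidiagonal.1 hx
    have h2 : x.2 ≤ psize l := by
      by_contra hc
      apply hne
      rw [Th, if_neg hc, map_zero, mul_zero]
    simp only
    rw [Th, if_pos h2, yy, if_pos (by omega), show (s : ℕ) - (s - x.1) = x.1 by omega, smul_mul_assoc,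
      smul_mul_assoc, smul_smul]
    congr 1
    obtain ⟨t, ht⟩ : ∃ t, (s : ℕ) = t + x.1 := ⟨s - x.1, by omega⟩
    rw [ht, Nat.add_sub_cancel, pow_add, mul_right_comm, ← mul_pow]
    simp

end JK

set_option linter.unusedSimpArgs false

namespace JK
open Finset.HasAntidiagonal (antidiagonal)
open Polynomial (X C monomial)
open MvPolynomial (pderiv rename)

/-! ### Adding many rows -/

variable {J : JPartition → SymA}

/-- `G(-t)` -/
def Gm : PowerSeries SymA := PowerSeries.mk fun i => (-1 : F) ^ i • gg i
/-- logarithmic derivative coefficients -/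
def Qc (j : ℕ) : SymA := ((-1 : F) ^ (j + 1) * alpha⁻¹) • pp (j + 1)

lemma Gm_deriv : PowerSeries.derivative SymA Gm = PowerSeries.mk Qc * Gm := by
  ext1 n
  rw [PowerSeries.coeff_derivative, PowerSeries.coeff_mul]
  simp only [Gm, PowerSeries.coeff_mk]
  have h := gg_rec (n + 1)
  rw [Finset.Nat.sum_antidiagonal_succ, pp_zero, zero_mul, zero_add] at h
  have e : ∀ x ∈ antidiagonal n, Qc x.1 * ((-1 : F) ^ x.2 • gg x.2)
      = ((-1 : F) ^ (n + 1) * alpha⁻¹) • (pp (x.1 + 1) * gg x.2) := by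
    intro x hx
    have e := Finset.HasAntidiagonal.mem_antidiagonal.1 hx
    rw [Qc, mul_smul_comm, smul_mul_assoc, smul_smul, ← e]
    congr 1
    ring
  rw [Finset.sum_congr rfl e, ← Finset.smul_sum, h, smul_smul, mul_assoc, ← mul_assoc alpha⁻¹,
    inv_mul_cancel₀ alpha_ne, one_mul, ← smul_smul, smul_mul_assoc]
  congr 1
  push_cast
  rw [smul_eq_cF, cF, map_add, map_one, map_natCast, mul_comm]

lemma Gm_pow_rec (m n : ℕ) : ((n : SymA) + 1) * PowerSeries.coeff (n + 1) (Gm ^ m)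
    = (m : SymA) * ∑ x ∈ antidiagonal n, Qc x.1 * PowerSeries.coeff x.2 (Gm ^ m) := by
  have h : PowerSeries.derivative SymA (Gm ^ m) = (m : PowerSeries SymA) * (PowerSeries.mk Qc * Gm ^ m) := by
    rw [Derivation.leibniz_pow, Gm_deriv]
    rcases m with _ | m
    · simp
    · rw [Nat.add_sub_cancel, smul_eq_mul, nsmul_eq_mul]; ring
  have h2 := congrArg (PowerSeries.coeff n) h
  rw [PowerSeries.coeff_derivative, ← map_natCast (PowerSeries.C (R := SymA)), PowerSeries.coeff_C_mul,
    PowerSeries.coeff_mul] at h2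
  simp only [PowerSeries.coeff_mk] at h2
  rw [mul_comm, h2]

/-- coefficients of powers as polynomials in the exponent -/
def qq : ℕ → Polynomial SymA
  | 0 => 1
  | n + 1 => C (cF ((n : F) + 1)⁻¹) * (X * ∑ i : Fin (n + 1), C (Qc (n - i)) * qq i)

lemma qq_zero : qq 0 = 1 := by rw [qq]

lemma qq_succ (n : ℕ) : qq (n + 1)
    = C (cF ((n : F) + 1)⁻¹) * (X * ∑ x ∈ antidiagonal n, C (Qc x.1) * qq x.2) := by
  rw [qq, ← Finset.Nat.sum_antidiagonal_swap, Finset.Nat.sum_antidiagonal_eq_sum_range_succ_mk,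
    Finset.sum_range]
  rfl

lemma cF_inv (n : ℕ) : cF ((n : F) + 1)⁻¹ * ((n : SymA) + 1) = 1 := by
  have : ((n : F) + 1) ≠ 0 := by exact_mod_cast Nat.succ_ne_zero n
  have h : ((n : SymA) + 1) = cF ((n : F) + 1) := by rw [cF, map_add, map_one, map_natCast]
  rw [h, cF, cF, ← map_mul, inv_mul_cancel₀ this, map_one]

lemma qq_eval (m i : ℕ) : (qq i).eval (m : SymA) = PowerSeries.coeff i (Gm ^ m) := by
  induction i using Nat.strong_induction_on with
  | _ i ih =>
    rcases i with _ | n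
    · rw [qq_zero, Polynomial.eval_one, PowerSeries.coeff_zero_eq_constantCoeff_apply, map_pow]
      have : PowerSeries.constantCoeff Gm = 1 := by
        rw [← PowerSeries.coeff_zero_eq_constantCoeff_apply, Gm, PowerSeries.coeff_mk]
        simp [gg_zero]
      rw [this, one_pow]
    · rw [qq_succ, Polynomial.eval_mul, Polynomial.eval_C, Polynomial.eval_mul, Polynomial.eval_X,
        Polynomial.eval_finsetSum]
      have e : ∀ x ∈ antidiagonal n, Polynomial.eval (m : SymA) (C (Qc x.1) * qq x.2)
          = Qc x.1 * PowerSeries.coeff x.2 (Gm ^ m) := by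
        intro x hx
        have := Finset.HasAntidiagonal.mem_antidiagonal.1 hx
        rw [Polynomial.eval_mul, Polynomial.eval_C, ih x.2 (by omega)]
      rw [Finset.sum_congr rfl e, ← Gm_pow_rec, ← mul_assoc, cF_inv, one_mul]

lemma qq_coeff_zero (n : ℕ) : (qq (n + 1)).coeff 0 = 0 := by
  rw [qq_succ, Polynomial.coeff_C_mul, Polynomial.coeff_X_mul_zero, mul_zero]

lemma qq_coeff_one (n : ℕ) : (qq (n + 1)).coeff 1
    = ((-1 : F) ^ (n + 1) / ((n + 1 : ℕ) : F)) • alpha⁻¹ • pp (n + 1) := by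
  rw [qq_succ, Polynomial.coeff_C_mul, Polynomial.coeff_X_mul, Polynomial.finsetSum_coeff,
    Finset.sum_eq_single (n, 0)]
  · rw [qq_zero, mul_one, Polynomial.coeff_C_zero, ← smul_eq_cF, Qc, smul_smul, smul_smul]
    congr 1
    push_cast
    ring
  · rintro ⟨a, b⟩ hx hne
    have h := Finset.HasAntidiagonal.mem_antidiagonal.1 hx
    rcases b with _ | b
    · exact (hne (by rw [show a = n from h])).elim
    · simp only
      rw [Polynomial.coeff_C_mul, qq_coeff_zero, mul_zero]
  · intro h
    exact absurd (Finset.HasAntidiagonal.mem_antidiagonal (n := n).2 (by simp)) h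

lemma Th_rows (hJ : IsJackFamily J) (s : ℕ+) {l : JPartition} (hl : ple l s) (m : ℕ) {d : ℕ} (hd : d ≤ s) :
    Ci hJ (us s) (Th J (Multiset.replicate m s + l) d)
      = ∑ x ∈ antidiagonal d, PowerSeries.coeff x.1 (Gm ^ m) * Ci hJ (us s) (Th J l x.2) := by
  have key : ∀ d ≤ (s : ℕ), Ci hJ (us s) (Th J (Multiset.replicate m s + l) d)
      = PowerSeries.coeff d (Gm ^ m * PowerSeries.mk fun e => Ci hJ (us s) (Th J l e)) := by
    induction m with
    | zero => intro d _; simp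
    | succ m ih =>
      intro d hd
      have hp : ple (Multiset.replicate m s + l) s := by
        refine ple_add.2 ⟨fun i hi => ?_, hl⟩
        rw [Multiset.eq_of_mem_replicate hi]
      rw [Multiset.replicate_succ, Multiset.cons_add, Th_row hJ s hp hd, pow_succ', mul_assoc,
        PowerSeries.coeff_mul]
      refine Finset.sum_congr rfl fun x hx => ?_
      have := Finset.HasAntidiagonal.mem_antidiagonal.1 hx
      rw [ih x.2 (by omega), Gm, PowerSeries.coeff_mk]
  rw [key d hd, PowerSeries.coeff_mul]
  simp only [PowerSeries.coeff_mk]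

/-- apply a linear form to the coefficients of a polynomial -/
lemma exists_mapL (φ : SymA →ₗ[F] F) (S : Polynomial SymA) : ∃ Q : Polynomial F,
    (∀ j, Q.coeff j = φ (S.coeff j)) ∧ ∀ m : ℕ, Q.eval (m : F) = φ (S.eval (m : SymA)) := by
  refine ⟨∑ j ∈ S.support, monomial j (φ (S.coeff j)), ?_, ?_⟩
  · intro j
    rw [Polynomial.finsetSum_coeff]
    simp only [Polynomial.coeff_monomial]
    rw [Finset.sum_ite_eq' S.support j]
    split_ifs with h
    · rfl
    · rw [Polynomial.notMem_support_iff.1 h, map_zero]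
  · intro m
    rw [Polynomial.eval_finsetSum, Polynomial.eval_eq_sum, Polynomial.sum, map_sum]
    refine Finset.sum_congr rfl fun j _ => ?_
    rw [Polynomial.eval_monomial]
    have : S.coeff j * (m : SymA) ^ j = ((m : F) ^ j) • S.coeff j := by
      rw [smul_eq_cF, cF, map_pow, map_natCast, mul_comm]
    rw [this, map_smul, smul_eq_mul, mul_comm]

/-- derivative of characters in the row direction -/
def dth (J : JPartition → SymA) (s : ℕ) (m l : JPartition) : F :=
  ∑ n ∈ Finset.Icc 1 (psize m), ((-1 : F) ^ n / (n : F)) *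
    MvPolynomial.coeff (toExp m) (alpha⁻¹ • BB (us s) n (Th J l (psize m - n)))

lemma theta_poly (hJ : IsJackFamily J) (s : ℕ+) {l : JPartition} (hl : ple l s) (μ : JPartition)
    (hμ : psize μ ≤ s) : ∃ Q : Polynomial F,
    Q.coeff 0 = theta J μ l ∧ Q.coeff 1 = dth J s μ l ∧
      ∀ m : ℕ, Q.eval (m : F) = theta J μ (Multiset.replicate m s + l) := by
  set d := psize μ with hd
  let φ : SymA →ₗ[F] F := MvPolynomial.lcoeff F (toExp μ) ∘ₗ CC hJ (us s)
  have hφ : ∀ f, φ f = MvPolynomial.coeff (toExp μ) (CC hJ (us s) f) := fun f => rfl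
  obtain ⟨Q, h1, h2⟩ := exists_mapL φ (∑ x ∈ antidiagonal d, qq x.1 * C (Ci hJ (us s) (Th J l x.2)))
  have hsplit : ∀ k f : ℕ → SymA, ∑ x ∈ antidiagonal d, k x.1 * f x.2
      = k 0 * f d + ∑ n ∈ Finset.Icc 1 d, k n * f (d - n) := by
    intro k f
    rw [Finset.Nat.sum_antidiagonal_eq_sum_range_succ_mk, Finset.range_eq_Ico, Finset.sum_eq_sum_Ico_succ_bot (by omega)]
    rfl
  refine ⟨Q, ?_, ?_, ?_⟩
  · rw [h1, Polynomial.finsetSum_coeff]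
    simp only [Polynomial.coeff_mul_C]
    rw [hsplit (fun i => (qq i).coeff 0) (fun e => Ci hJ (us s) (Th J l e)), Finset.sum_eq_zero, add_zero,
      qq_zero, Polynomial.coeff_one_zero, one_mul, hφ, CC_Ci hJ (Hom_Ms hJ hμ (Hom_Th hJ l d)), theta_eq]
    intro n hn
    obtain ⟨n, rfl⟩ : ∃ k, n = k + 1 := ⟨n - 1, by have := Finset.mem_Icc.1 hn; omega⟩
    rw [qq_coeff_zero, zero_mul]
  · rw [h1, Polynomial.finsetSum_coeff]
    simp only [Polynomial.coeff_mul_C]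
    rw [hsplit (fun i => (qq i).coeff 1) (fun e => Ci hJ (us s) (Th J l e)), qq_zero,
      Polynomial.coeff_one, if_neg (by omega), zero_mul, zero_add, map_sum, dth]
    refine Finset.sum_congr rfl fun n hn => ?_
    have hn' := Finset.mem_Icc.1 hn
    obtain ⟨n, rfl⟩ : ∃ k, n = k + 1 := ⟨n - 1, by omega⟩
    rw [qq_coeff_one, smul_mul_assoc, map_smul, hφ, smul_mul_assoc, map_smul, CC_pp,
      CC_Ci hJ (Hom_Ms hJ (by omega) (Hom_Th hJ l _)), smul_eq_mul]
  · intro m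
    rw [h2, Polynomial.eval_finsetSum, theta_eq, ← hd,
      ← CC_Ci hJ (Hom_Ms hJ hμ (Hom_Th hJ (Multiset.replicate m s + l) d)), Th_rows hJ s hl m hμ, hφ]
    simp only [Polynomial.eval_mul, Polynomial.eval_C, qq_eval]

end JK

set_option linter.unusedSimpArgs false

namespace JK
open Finset.HasAntidiagonal (antidiagonal)
open Polynomial (X C monomial)
open MvPolynomial (pderiv rename)

/-! ### The relation between structure coefficients -/

variable {J : JPartition → SymA}

/-- partitions of size less than `N` -/
def Plt (N : ℕ) : Finset JPartition := (Finset.range N).biUnion fun d => (finite_psize d).toFinset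

lemma mem_Plt {N : ℕ} {l : JPartition} : l ∈ Plt N ↔ psize l < N := by
  simp [Plt]

/-- matrix of `B_∞` -/
def bb (ℓ : ℕ) (m m' : JPartition) : F :=
  if psize m' < psize m then
    ((-1 : F) ^ (psize m - psize m') / ((psize m - psize m' : ℕ) : F)) * Bmat (psize m - psize m') ℓ (toExp m) (toExp m')
  else 0

lemma Bmat_ps {n ℓ : ℕ} {m m' : JPartition} (h : Bmat n ℓ (toExp m) (toExp m') ≠ 0) :
    psize m = psize m' + n := by
  have := Bmat_wt h
  rwa [wt_toExp, wt_toExp] at this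

lemma bb_sum (ℓ k : ℕ) (m m' : JPartition) (h : psize m ≤ psize m' + k) :
    ∑ n ∈ Finset.Icc 1 k, ((-1 : F) ^ n / (n : F)) * Bmat n ℓ (toExp m) (toExp m') = bb ℓ m m' := by
  rw [bb]
  split_ifs with hlt
  · refine Finset.sum_eq_single _ ?_ ?_
    · intro n hn hne
      by_contra hc
      have := Bmat_ps (right_ne_zero_of_mul hc)
      omega
    · intro hn
      exact absurd (Finset.mem_Icc.2 ⟨by omega, by omega⟩) hn
  · refine Finset.sum_eq_zero fun n hn => ?_
    by_contra hc
    have := Bmat_ps (right_ne_zero_of_mul hc)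
    have := Finset.mem_Icc.1 hn
    omega

lemma bb_sum_gt (ℓ k : ℕ) (m m' : JPartition) (h : psize m' + k < psize m) :
    ∑ n ∈ Finset.Icc 1 k, ((-1 : F) ^ n / (n : F)) * Bmat n ℓ (toExp m) (toExp m') = 0 := by
  refine Finset.sum_eq_zero fun n hn => ?_
  by_contra hc
  have := Bmat_ps (right_ne_zero_of_mul hc)
  have := Finset.mem_Icc.1 hn
  omega

lemma Hom_expand {d : ℕ} {f : SymA} (hf : f ∈ Hom d) (T : Finset JPartition) (hT : ∀ m, psize m = d → m ∈ T) :
    f = ∑ m ∈ T, MvPolynomial.monomial (toExp m) (MvPolynomial.coeff (toExp m) f) := by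
  ext e
  obtain ⟨l, rfl⟩ := toExp_surj e
  rw [MvPolynomial.coeff_sum]
  simp only [MvPolynomial.coeff_monomial]
  by_cases hl : l ∈ T
  · rw [Finset.sum_eq_single l]
    · simp
    · intro b _ hb
      rw [if_neg fun h => hb (toExp_inj.1 h)]
    · exact fun h => absurd hl h
  · rw [Finset.sum_eq_zero]
    · by_contra hc
      refine hl (hT l ?_)
      rw [← wt_toExp]
      exact mem_Hom.1 hf _ hc
    · intro b hb
      rw [if_neg fun h => hl (by rw [← toExp_inj.1 h]; exact hb)]

lemma coeff_Bc {n ℓ d : ℕ} {f : SymA} (hf : f ∈ Hom d) (T : Finset JPartition)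
    (hT : ∀ m, psize m = d → m ∈ T) (m : Exp) :
    MvPolynomial.coeff m (Bc n ℓ f) = ∑ m' ∈ T, Bmat n ℓ m (toExp m') * MvPolynomial.coeff (toExp m') f := by
  conv_lhs => rw [Hom_expand hf T hT, Bc_eq_BL, map_sum, MvPolynomial.coeff_sum]
  refine Finset.sum_congr rfl fun m' _ => ?_
  have : MvPolynomial.monomial (toExp m') (MvPolynomial.coeff (toExp m') f)
      = MvPolynomial.coeff (toExp m') f • MvPolynomial.monomial (toExp m') (1 : F) := by
    rw [MvPolynomial.smul_monomial, smul_eq_mul, mul_one]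
  rw [this, map_smul, MvPolynomial.coeff_smul, ← Bc_eq_BL, smul_eq_mul, mul_comm]; rfl

lemma dth_eq (hJ : IsJackFamily J) (s : ℕ) (m l : JPartition) {N : ℕ} (hN : psize m < N) :
    dth J s m l = ∑ ℓ ∈ Finset.range N, us s ^ ℓ * ∑ m' ∈ Plt (psize m), bb ℓ m m' * theta J m' l := by
  have h1 : ∀ n ∈ Finset.Icc 1 (psize m),
      ((-1 : F) ^ n / (n : F)) * MvPolynomial.coeff (toExp m) (alpha⁻¹ • BB (us s) n (Th J l (psize m - n)))
      = ∑ ℓ ∈ Finset.range N, us s ^ ℓ * ∑ m' ∈ (Plt (psize m)).filter (fun m' => psize m - psize m' = n),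
        bb ℓ m m' * theta J m' l := by
    intro n hn
    have hn' := Finset.mem_Icc.1 hn
    have e : ∑ ℓ ∈ Finset.range (n + 1), us s ^ ℓ • Bc n ℓ (Th J l (psize m - n))
        = ∑ ℓ ∈ Finset.range N, us s ^ ℓ • Bc n ℓ (Th J l (psize m - n)) := by
      refine Finset.sum_subset (Finset.range_mono (by omega)) fun ℓ _ hℓ => ?_
      rw [Bc_gt (by simpa using hℓ), smul_zero]
    rw [← BB_eq_sum, e, MvPolynomial.coeff_sum, Finset.mul_sum]
    refine Finset.sum_congr rfl fun ℓ _ => ?_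
    rw [MvPolynomial.coeff_smul, smul_eq_mul, mul_left_comm]
    congr 1
    rw [coeff_Bc (Hom_Th hJ l (psize m - n)) ((Plt (psize m)).filter (fun m' => psize m - psize m' = n)),
      Finset.mul_sum]
    · refine Finset.sum_congr rfl fun m' hm' => ?_
      obtain ⟨h1, h2⟩ := Finset.mem_filter.1 hm'
      rw [mem_Plt] at h1
      rw [bb, if_pos h1, h2, theta_eq, show psize m - n = psize m' by omega, mul_assoc]
    · intro m' hm'
      rw [Finset.mem_filter, mem_Plt]
      omega
  rw [dth, Finset.sum_congr rfl h1, Finset.sum_comm]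
  refine Finset.sum_congr rfl fun ℓ _ => ?_
  rw [← Finset.mul_sum]
  congr 1
  refine Finset.sum_fiberwise_of_maps_to (fun m' hm' => ?_) _
  rw [mem_Plt] at hm'
  rw [Finset.mem_Icc]
  omega

variable {g : JPartition → JPartition → JPartition → F}

/-- support of the structure coefficients -/
def SS (hg : IsStructCoeffs J g) (μ ν : JPartition) : Finset JPartition := (hg.1 μ ν).toFinset

lemma mem_SS (hg : IsStructCoeffs J g) {μ ν π : JPartition} : π ∈ SS hg μ ν ↔ g π μ ν ≠ 0 := by
  simp [SS]

lemma theta_mul (hg : IsStructCoeffs J g) (μ ν l : JPartition) :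
    theta J μ l * theta J ν l = ∑ π ∈ SS hg μ ν, g π μ ν * theta J π l := by
  rw [hg.2 μ ν l]
  refine finsum_eq_sum_of_support_subset _ fun π hπ => ?_
  exact (mem_SS hg).2 (left_ne_zero_of_mul hπ)

lemma poly_zero (P : Polynomial F) (h : ∀ m : ℕ, P.eval (m : F) = 0) : P = 0 := by
  refine Polynomial.eq_zero_of_infinite_isRoot P ?_
  exact (Set.infinite_range_of_injective (Nat.cast_injective (R := F))).mono
    (by rintro _ ⟨m, rfl⟩; exact h m)

lemma deriv_rel (hJ : IsJackFamily J) (hg : IsStructCoeffs J g) (s : ℕ+) (μ ν l : JPartition)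
    (hl : ple l s) (hμ : psize μ ≤ s) (hν : psize ν ≤ s) (hπ : ∀ π ∈ SS hg μ ν, psize π ≤ s) :
    theta J μ l * dth J s ν l + dth J s μ l * theta J ν l = ∑ π ∈ SS hg μ ν, g π μ ν * dth J s π l := by
  obtain ⟨A, a0, a1, a⟩ := theta_poly hJ s hl μ hμ
  obtain ⟨B, b0, b1, b⟩ := theta_poly hJ s hl ν hν
  choose! Q q0 q1 q using fun π hp => theta_poly hJ s hl π (hπ π hp)
  have hP := poly_zero (A * B - ∑ π ∈ SS hg μ ν, C (g π μ ν) * Q π) (fun m => by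
    rw [Polynomial.eval_sub, Polynomial.eval_mul, a, b, theta_mul hg, Polynomial.eval_finsetSum, sub_eq_zero]
    refine Finset.sum_congr rfl fun π hp => ?_
    rw [Polynomial.eval_mul, Polynomial.eval_C, q π hp])
  have h1 := congrArg (fun P => Polynomial.coeff P 1) (sub_eq_zero.1 hP)
  simp only [Polynomial.finsetSum_coeff, Polynomial.coeff_C_mul] at h1
  rw [Polynomial.mul_coeff_one] at h1
  rw [a0, a1, b0, b1] at h1
  rw [h1]
  exact Finset.sum_congr rfl fun π hp => by rw [q1 π hp]

/-- row-derivative of characters, coefficient of `u^ℓ` -/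
def dl (J : JPartition → SymA) (ℓ : ℕ) (m l : JPartition) : F := ∑ m' ∈ Plt (psize m), bb ℓ m m' * theta J m' l

lemma dl_rel (hJ : IsJackFamily J) (hg : IsStructCoeffs J g) (ℓ : ℕ) (μ ν l : JPartition) :
    theta J μ l * dl J ℓ ν l + dl J ℓ μ l * theta J ν l = ∑ π ∈ SS hg μ ν, g π μ ν * dl J ℓ π l := by
  set N := ℓ + psize μ + psize ν + psize l + ∑ π ∈ SS hg μ ν, psize π + 1 with hN
  have hS : ∀ π ∈ SS hg μ ν, psize π ≤ ∑ π ∈ SS hg μ ν, psize π := fun π hp =>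
    Finset.single_le_sum (f := psize) (fun _ _ => Nat.zero_le _) hp
  have key := poly_coeff_zero (n := N)
    (a := fun ℓ => theta J μ l * dl J ℓ ν l + dl J ℓ μ l * theta J ν l - ∑ π ∈ SS hg μ ν, g π μ ν * dl J ℓ π l)
    N ?_ ℓ (by omega)
  · exact sub_eq_zero.1 key
  intro s hs
  obtain ⟨s, rfl⟩ : ∃ k' : ℕ+, (k' : ℕ) = s := ⟨⟨s, by omega⟩, rfl⟩
  have h := deriv_rel hJ hg s μ ν l (ple_of_psize (by omega)) (by omega) (by omega)
    (fun π hp => by have := hS π hp; omega)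
  have hR : ∑ π ∈ SS hg μ ν, g π μ ν * dth J s π l = ∑ π ∈ SS hg μ ν, g π μ ν *
      ∑ ℓ ∈ Finset.range N, us s ^ ℓ * ∑ m' ∈ Plt (psize π), bb ℓ π m' * theta J m' l :=
    Finset.sum_congr rfl fun π hp => by
      rw [dth_eq hJ s π l (N := N) (by have := hS π hp; omega)]
  rw [dth_eq hJ s μ l (N := N) (by omega), dth_eq hJ s ν l (N := N) (by omega), hR] at h
  rw [← sub_eq_zero] at h
  rw [← h]
  simp only [mul_sub, mul_add, Finset.sum_sub_distrib, Finset.sum_add_distrib, Finset.mul_sum, Finset.sum_mul]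
  simp only [dl, us, Finset.mul_sum, Finset.sum_mul]
  congr 1
  · congr 1
    · refine Finset.sum_congr rfl fun _ _ => Finset.sum_congr rfl fun _ _ => by ring
    · refine Finset.sum_congr rfl fun _ _ => Finset.sum_congr rfl fun _ _ => by ring
  · rw [Finset.sum_comm]
    refine Finset.sum_congr rfl fun _ _ => Finset.sum_congr rfl fun _ _ => Finset.sum_congr rfl fun _ _ => by ring

/-! ### linear independence of characters -/

/-- evaluation of a combination of characters -/
def Lam (J : JPartition → SymA) : (JPartition →₀ F) →ₗ[F] (JPartition → F) :=
  Finsupp.linearCombination F (fun m => theta J m)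

lemma Lam_single (m : JPartition) (a : F) : Lam J (Finsupp.single m a) = a • theta J m := by
  rw [Lam, Finsupp.linearCombination_single]

lemma Lam_inj (hJ : IsJackFamily J) (x : JPartition →₀ F) (hx : Lam J x = 0) : x = 0 := by
  have key : ∀ n, ∀ m, psize m = n → x m = 0 := by
    intro n
    induction n using Nat.strong_induction_on with
    | _ n ih =>
      intro m hm
      let φ : SymA →ₗ[F] F := ∑ ρ ∈ x.support, x ρ • MvPolynomial.lcoeff F (toExp ρ)
      have hφ : ∀ f, φ f = ∑ ρ ∈ x.support, x ρ * MvPolynomial.coeff (toExp ρ) f := by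
        intro f
        simp [φ, LinearMap.sum_apply, MvPolynomial.lcoeff]
      have hJφ : ∀ l, psize l = n → φ (J l) = 0 := by
        intro l hl
        have h0 := congrFun hx l
        rw [Lam, Finsupp.linearCombination_apply, Finsupp.sum, Finset.sum_apply] at h0
        rw [hφ]
        refine Eq.trans (Finset.sum_congr rfl fun ρ _ => ?_) h0
        rw [Pi.smul_apply, smul_eq_mul]
        rcases lt_trichotomy (psize ρ) n with h | h | h
        · rw [ih _ h ρ rfl, zero_mul, zero_mul]
        · rw [theta_eq, Th, if_pos (by omega), show psize l - psize ρ = 0 by omega, Phi_zero]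
        · rw [theta_eq, Th, if_neg (by omega), MvPolynomial.coeff_zero]
          congr 1
          by_contra hc
          have := mem_Hom.1 (Hom_J hJ l) _ hc
          rw [wt_toExp] at this
          omega
      have hz : φ (MvPolynomial.monomial (toExp m) 1) = 0 := by
        have h := Hom_le_GS _ (Hom_monomial (toExp m) 1)
        rw [wt_toExp, hm, ← GS_eq hJ] at h
        refine (Submodule.mem_bot F).1 (span_map φ (S := ⊥) ?_ h)
        rintro _ ⟨l, hl, rfl⟩
        exact (Submodule.mem_bot F).2 (hJφ l hl)
      rw [hφ, Finset.sum_eq_single m] at hz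
      · simpa using hz
      · intro b _ hb
        rw [MvPolynomial.coeff_monomial, if_neg fun h => hb (toExp_inj.1 h).symm, mul_zero]
      · intro hm
        rw [Finsupp.notMem_support_iff.1 hm, zero_mul]
  exact Finsupp.ext fun m => key _ m rfl

lemma main_rel (hJ : IsJackFamily J) (hg : IsStructCoeffs J g) (ℓ : ℕ) (μ ν ρ : JPartition) :
    ∑ ν' ∈ Plt (psize ν), bb ℓ ν ν' * g ρ μ ν' + ∑ μ' ∈ Plt (psize μ), bb ℓ μ μ' * g ρ μ' ν
      = ∑ π ∈ SS hg μ ν, g π μ ν * bb ℓ π ρ := by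
  let gF : JPartition → JPartition → (JPartition →₀ F) := fun μ ν =>
    ∑ π ∈ SS hg μ ν, Finsupp.single π (g π μ ν)
  have hgF : ∀ μ ν ρ, gF μ ν ρ = g ρ μ ν := by
    intro μ ν ρ
    simp only [gF, Finsupp.coe_finsetSum, Finset.sum_apply, Finsupp.single_apply]
    rw [Finset.sum_ite_eq' (SS hg μ ν) ρ]
    split_ifs with h
    · rfl
    · rw [mem_SS, not_not] at h; exact h.symm
  have hLg : ∀ μ ν, Lam J (gF μ ν) = theta J μ * theta J ν := by
    intro μ ν
    ext l
    simp only [gF, map_sum, Lam_single, Finset.sum_apply, Pi.smul_apply, Pi.mul_apply, smul_eq_mul]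
    rw [theta_mul hg]
  let bF : JPartition → (JPartition →₀ F) := fun m => ∑ m' ∈ Plt (psize m), Finsupp.single m' (bb ℓ m m')
  have hbF : ∀ m ρ, bF m ρ = bb ℓ m ρ := by
    intro m ρ
    simp only [bF, Finsupp.coe_finsetSum, Finset.sum_apply, Finsupp.single_apply]
    rw [Finset.sum_ite_eq' (Plt (psize m)) ρ]
    split_ifs with h
    · rfl
    · rw [bb, if_neg]; rwa [mem_Plt] at h
  have hLb : ∀ m, Lam J (bF m) = dl J ℓ m := by
    intro m
    ext l
    simp only [bF, map_sum, Lam_single, Finset.sum_apply, Pi.smul_apply, smul_eq_mul]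
    rfl
  have h := Lam_inj hJ (∑ ν' ∈ Plt (psize ν), bb ℓ ν ν' • gF μ ν' + ∑ μ' ∈ Plt (psize μ), bb ℓ μ μ' • gF μ' ν
      - ∑ π ∈ SS hg μ ν, g π μ ν • bF π) (by
    simp only [map_sub, map_add, map_sum, map_smul, hLg, hLb]
    rw [sub_eq_zero]
    ext l
    simp only [Pi.add_apply, Finset.sum_apply, Pi.smul_apply, Pi.mul_apply, smul_eq_mul]
    rw [← dl_rel hJ hg, dl, dl, Finset.mul_sum, Finset.sum_mul]
    congr 1
    · exact Finset.sum_congr rfl fun _ _ => by ring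
    · exact Finset.sum_congr rfl fun _ _ => by ring)
  have h2 := congrArg (fun x : JPartition →₀ F => x ρ) (sub_eq_zero.1 h)
  simpa only [Finsupp.add_apply, Finsupp.coe_finsetSum, Finset.sum_apply, Finsupp.smul_apply, hgF, hbF,
    smul_eq_mul] using h2

end JK

set_option linter.unusedSimpArgs false

namespace JK
open Finset.HasAntidiagonal (antidiagonal)
open Polynomial (X C monomial)
open MvPolynomial (pderiv rename)

/-! ### Degree bound and conclusion -/

variable {J : JPartition → SymA} {g : JPartition → JPartition → JPartition → F}

lemma bb_ne {ℓ : ℕ} {m m' : JPartition} (h : bb ℓ m m' ≠ 0) : psize m' < psize m ∧ psize m' + ℓ ≤ psize m := by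
  rw [bb] at h
  split_ifs at h with h1
  · refine ⟨h1, ?_⟩
    by_contra hc
    apply right_ne_zero_of_mul h
    rw [Bmat, Bc_gt (by omega), MvPolynomial.coeff_zero]
  · exact absurd rfl h

lemma Bmat_top (a : ℕ+) (π ρ : JPartition) :
    Bmat a a (toExp π) (toExp ρ) = if π = a ::ₘ ρ then alpha⁻¹ else 0 := by
  rw [Bmat, Bc_top, MvPolynomial.coeff_smul, pp_pnat, ← pPow_eq]
  have : (MvPolynomial.X a * pPow ρ : SymA) = pPow (a ::ₘ ρ) := by
    simp [pPow]
  rw [this, pPow_eq, MvPolynomial.coeff_monomial]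
  by_cases h : π = a ::ₘ ρ
  · subst h; simp
  · rw [if_neg h, if_neg fun h2 => h (toExp_inj.1 h2).symm, smul_zero]

lemma deg_bound (hJ : IsJackFamily J) (hg : IsStructCoeffs J g) : ∀ (K : ℕ) (μ ν π : JPartition),
    psize μ + psize ν = K → K < psize π → g π μ ν = 0 := by
  intro K
  induction K using Nat.strong_induction_on with
  | _ K ih =>
    intro μ ν π hK hπ
    by_contra hne
    obtain ⟨π0, h0, hmax⟩ := Finset.exists_max_image (SS hg μ ν) psize ⟨π, (mem_SS hg).2 hne⟩
    have hb := hmax π ((mem_SS hg).2 hne)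
    obtain ⟨a, ρ, rfl⟩ : ∃ a ρ, π0 = a ::ₘ ρ := by
      rcases Multiset.empty_or_exists_mem π0 with h | ⟨a, ha⟩
      · subst h
        have := psize_zero
        omega
      · exact ⟨a, _, (Multiset.cons_erase ha).symm⟩
    have hps := psize_cons a ρ
    have ha := a.pos
    have h := main_rel hJ hg (a : ℕ) μ ν ρ
    rw [Finset.sum_eq_zero, Finset.sum_eq_zero, Finset.sum_eq_single_of_mem _ h0] at h
    · rw [add_zero, bb, if_pos (by omega), show psize (a ::ₘ ρ) - psize ρ = (a : ℕ) by omega,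
        Bmat_top, if_pos rfl] at h
      have h1 := (mem_SS hg).1 h0
      have h2 : ((a : ℕ) : F) ≠ 0 := Nat.cast_ne_zero.2 (by omega)
      have h3 := inv_ne_zero alpha_ne
      have h4 : ((-1 : F) ^ (a : ℕ)) ≠ 0 := pow_ne_zero _ (neg_ne_zero.2 one_ne_zero)
      exact mul_ne_zero h1 (mul_ne_zero (div_ne_zero h4 h2) h3) h.symm
    · intro b hbS hbne
      by_contra hc
      have hc' := right_ne_zero_of_mul hc
      have h1 := bb_ne hc'
      have h2 := hmax b hbS
      apply hc'
      rw [bb, if_pos h1.1, show psize b - psize ρ = (a : ℕ) by omega, Bmat_top, if_neg hbne, mul_zero]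
    · intro μ' _
      by_contra hc
      have h1 := bb_ne (left_ne_zero_of_mul hc)
      exact right_ne_zero_of_mul hc (ih (psize μ' + psize ν) (by omega) μ' ν ρ rfl (by omega))
    · intro ν' _
      by_contra hc
      have h1 := bb_ne (left_ne_zero_of_mul hc)
      exact right_ne_zero_of_mul hc (ih (psize μ + psize ν') (by omega) μ ν' ρ rfl (by omega))

lemma Gcoef_eq (hg : IsStructCoeffs J g) (μ ν : JPartition) (k : ℕ) :
    Gcoef g μ ν k = ∑ π ∈ SS hg μ ν, if psize π + k = psize μ + psize ν then
      MvPolynomial.monomial (toExp π) (g π μ ν / zalpha (toExp π)) else 0 := by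
  rw [Gcoef]
  have : ∀ π, (if psize π + k = psize μ + psize ν then (g π μ ν / zalpha (toExp π)) • pPow π else 0)
      = if psize π + k = psize μ + psize ν then
      MvPolynomial.monomial (toExp π) (g π μ ν / zalpha (toExp π)) else 0 := by
    intro π
    rw [pPow_eq, MvPolynomial.smul_monomial, smul_eq_mul, mul_one]
  simp only [this]
  refine finsum_eq_sum_of_support_subset _ fun π hπ => ?_
  rw [Finset.mem_coe, mem_SS]
  intro h
  apply hπ
  simp [h]

lemma coeff_Gcoef (hg : IsStructCoeffs J g) (μ ν ρ : JPartition) (k : ℕ) :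
    MvPolynomial.coeff (toExp ρ) (Gcoef g μ ν k)
      = if psize ρ + k = psize μ + psize ν then g ρ μ ν / zalpha (toExp ρ) else 0 := by
  rw [Gcoef_eq hg, MvPolynomial.coeff_sum]
  by_cases hρ : ρ ∈ SS hg μ ν
  · rw [Finset.sum_eq_single_of_mem ρ hρ]
    · split_ifs <;> simp
    · intro b _ hb
      split_ifs
      · rw [MvPolynomial.coeff_monomial, if_neg fun h => hb (toExp_inj.1 h)]
      · simp
  · have h0 : g ρ μ ν = 0 := by rwa [mem_SS, not_not] at hρ
    rw [Finset.sum_eq_zero]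
    · simp [h0]
    · intro b hbS
      split_ifs
      · rw [MvPolynomial.coeff_monomial, if_neg fun h => hρ (by rw [← toExp_inj.1 h]; exact hbS)]
      · simp

lemma finite_wt (N : ℕ) : {m : Exp | wt m < N}.Finite := by
  refine ((Plt N).finite_toSet.image toExp).subset fun m hm => ?_
  obtain ⟨l, rfl⟩ := toExp_surj m
  refine ⟨l, ?_, rfl⟩
  rw [Finset.mem_coe, mem_Plt, ← wt_toExp]
  exact hm

lemma coeff_Bperp (n ℓ : ℕ) (f : SymA) (e : Exp) :
    MvPolynomial.coeff e (Bperp n ℓ f)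
      = ∑ m' ∈ f.support, MvPolynomial.coeff m' f * (Bmat n ℓ m' e * zalpha m' / zalpha e) := by
  rw [Bperp, MvPolynomial.coeff_sum]
  refine Finset.sum_congr rfl fun m' _ => ?_
  rw [MvPolynomial.coeff_smul, smul_eq_mul]
  congr 1
  rw [finsum_eq_sum_of_support_subset (s := (finite_wt (wt m' + wt e + 1)).toFinset), MvPolynomial.coeff_sum,
    Finset.sum_eq_single_of_mem e]
  · simp
  · simp only [Set.Finite.mem_toFinset, Set.mem_ofPred_eq]; omega
  · intro b _ hb
    rw [MvPolynomial.coeff_smul, MvPolynomial.coeff_monomial, if_neg hb, smul_zero]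
  · intro m hm
    simp only [Set.Finite.coe_toFinset, Set.mem_ofPred_eq]
    have h1 : Bmat n ℓ m' m ≠ 0 := by
      intro h
      apply hm
      simp [h]
    have := Bmat_wt h1
    omega

lemma coeff_Bperp_G (hg : IsStructCoeffs J g) (n ℓ k : ℕ) (μ ν ρ : JPartition) :
    MvPolynomial.coeff (toExp ρ) (Bperp n ℓ (Gcoef g μ ν k))
      = ∑ π ∈ SS hg μ ν, if psize π + k = psize μ + psize ν then
        g π μ ν * Bmat n ℓ (toExp π) (toExp ρ) / zalpha (toExp ρ) else 0 := by
  rw [coeff_Bperp]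
  have hsub : (Gcoef g μ ν k).support ⊆ (SS hg μ ν).image toExp := by
    intro e he
    obtain ⟨π, rfl⟩ := toExp_surj e
    rw [MvPolynomial.mem_support_iff, coeff_Gcoef hg] at he
    refine Finset.mem_image_of_mem _ ((mem_SS hg).2 fun h => he ?_)
    simp [h]
  rw [Finset.sum_subset hsub, Finset.sum_image]
  · refine Finset.sum_congr rfl fun π _ => ?_
    rw [coeff_Gcoef hg]
    split_ifs
    · have := zalpha_ne (toExp π)
      have := zalpha_ne (toExp ρ)
      field_simp
    · rw [zero_mul]
  · intro a _ b _ h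
    exact toExp_inj.1 h
  · intro e _ he
    rw [MvPolynomial.notMem_support_iff.1 he, zero_mul]

lemma fin_Bmat {n ℓ : ℕ} (hn : 1 ≤ n) (m : JPartition) (G : JPartition → SymA) :
    ∑ᶠ m' : JPartition, Bmat n ℓ (toExp m) (toExp m') • G m'
      = ∑ m' ∈ Plt (psize m), Bmat n ℓ (toExp m) (toExp m') • G m' := by
  refine finsum_eq_sum_of_support_subset _ fun m' h => ?_
  rw [Finset.mem_coe, mem_Plt]
  have h1 : Bmat n ℓ (toExp m) (toExp m') ≠ 0 := by
    intro h0
    apply h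
    simp [h0]
  have := Bmat_ps h1
  omega

/-- One half of the left-hand side. -/
lemma lhs_half (m : JPartition) (ρ : JPartition) (ℓ k c : ℕ) (γ : JPartition → F)
    (G : JPartition → ℕ → SymA)
    (hG : ∀ m' j, MvPolynomial.coeff (toExp ρ) (G m' j)
      = if psize ρ + j = psize m' + c then γ m' / zalpha (toExp ρ) else 0)
    (hγ : ∀ m', psize m' + c < psize ρ → γ m' = 0) :
    ∑ n ∈ Finset.Icc 1 k, ((-1 : F) ^ n / (n : F)) * MvPolynomial.coeff (toExp ρ)
        (∑ᶠ m' : JPartition, Bmat n ℓ (toExp m) (toExp m') • G m' (k - n))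
      = if psize ρ + k = psize m + c then
        (∑ m' ∈ Plt (psize m), bb ℓ m m' * γ m') / zalpha (toExp ρ) else 0 := by
  have h1 : ∀ n ∈ Finset.Icc 1 k, ((-1 : F) ^ n / (n : F)) * MvPolynomial.coeff (toExp ρ)
        (∑ᶠ m' : JPartition, Bmat n ℓ (toExp m) (toExp m') • G m' (k - n))
      = ∑ m' ∈ Plt (psize m), ((-1 : F) ^ n / (n : F)) * Bmat n ℓ (toExp m) (toExp m') *
        (if psize ρ + k = psize m + c then γ m' / zalpha (toExp ρ) else 0) := by
    intro n hn
    have hn' := Finset.mem_Icc.1 hn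
    rw [fin_Bmat hn'.1, MvPolynomial.coeff_sum, Finset.mul_sum]
    refine Finset.sum_congr rfl fun m' _ => ?_
    rw [MvPolynomial.coeff_smul, smul_eq_mul, hG, mul_assoc]
    congr 1
    by_cases hB : Bmat n ℓ (toExp m) (toExp m') = 0
    · rw [hB, zero_mul, zero_mul]
    · have := Bmat_ps hB
      congr 1
      refine if_congr ?_ rfl rfl
      omega
  rw [Finset.sum_congr rfl h1, Finset.sum_comm]
  split_ifs with h
  · rw [Finset.sum_div]
    refine Finset.sum_congr rfl fun m' _ => ?_
    rw [← Finset.sum_mul]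
    by_cases hle : psize m ≤ psize m' + k
    · rw [bb_sum _ _ _ _ hle, mul_div_assoc]
    · rw [hγ m' (by omega)]
      simp
  · simp

theorem final (hJ : IsJackFamily J) (hg : IsStructCoeffs J g) (mu nu : JPartition) (ℓ k : ℕ) :
    (∑ n ∈ Finset.Icc 1 k, ((-1 : F) ^ n / (n : F)) •
        ((∑ᶠ mu' : JPartition, Bmat n ℓ (toExp mu) (toExp mu') • Gcoef g mu' nu (k - n))
          + ∑ᶠ nu' : JPartition, Bmat n ℓ (toExp nu) (toExp nu') • Gcoef g mu nu' (k - n)))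
    = ∑ n ∈ Finset.Icc 1 k, ((-1 : F) ^ n / (n : F)) • Bperp n ℓ (Gcoef g mu nu (k - n)) := by
  ext e
  obtain ⟨ρ, rfl⟩ := toExp_surj e
  simp only [MvPolynomial.coeff_sum, MvPolynomial.coeff_smul, MvPolynomial.coeff_add, smul_eq_mul, mul_add,
    Finset.sum_add_distrib]
  rw [lhs_half mu ρ ℓ k (psize nu) (fun m' => g ρ m' nu) (fun m' j => Gcoef g m' nu j)
      (fun m' j => coeff_Gcoef hg m' nu ρ j) (fun m' h => deg_bound hJ hg _ m' nu ρ rfl h),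
    lhs_half nu ρ ℓ k (psize mu) (fun m' => g ρ mu m') (fun m' j => Gcoef g mu m' j)
      (fun m' j => by rw [coeff_Gcoef hg, add_comm (psize mu)])
      (fun m' h => deg_bound hJ hg _ mu m' ρ rfl (by omega))]
  have h1 : ∀ n ∈ Finset.Icc 1 k, ((-1 : F) ^ n / (n : F)) * MvPolynomial.coeff (toExp ρ)
        (Bperp n ℓ (Gcoef g mu nu (k - n)))
      = ∑ π ∈ SS hg mu nu, ((-1 : F) ^ n / (n : F)) * Bmat n ℓ (toExp π) (toExp ρ) *
        (if psize ρ + k = psize mu + psize nu then g π mu nu / zalpha (toExp ρ) else 0) := by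
    intro n hn
    have hn' := Finset.mem_Icc.1 hn
    rw [coeff_Bperp_G hg, Finset.mul_sum]
    refine Finset.sum_congr rfl fun π _ => ?_
    rw [mul_assoc]
    congr 1
    by_cases hB : Bmat n ℓ (toExp π) (toExp ρ) = 0
    · simp [hB]
    · have := Bmat_ps hB
      have hiff : psize π + (k - n) = psize mu + psize nu ↔ psize ρ + k = psize mu + psize nu := by omega
      simp only [hiff]
      split_ifs
      · ring
      · rw [mul_zero]
  rw [Finset.sum_congr rfl h1, Finset.sum_comm, add_comm (psize nu)]
  split_ifs with h
  · rw [← add_div, add_comm, main_rel hJ hg, Finset.sum_div]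
    refine Finset.sum_congr rfl fun π hp => ?_
    rw [← Finset.sum_mul]
    have hle : psize π ≤ psize ρ + k := by
      by_contra hc
      exact (mem_SS hg).1 hp (deg_bound hJ hg _ mu nu π rfl (by omega))
    rw [bb_sum _ _ _ _ hle]
    ring
  · simp

end JK

/-- **Main theorem (Theorem 1.8).** The generating series `G^{(α)}(t,p,q,r)` satisfies
`(B_∞^{(α)}(-t,q,u) + B_∞^{(α)}(-t,r,u)) ⬝ G^{(α)} = B_∞^{(α)⊥}(-t,p,u) ⬝ G^{(α)}`
as an identity in `A⟦u⟧`, `A = ℚ(α)[t,p]⟦q,r⟧`.  The identity is stated coefficientwise: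
for every `μ, ν` (exponents of `q, r`), every `ℓ` (exponent of `u`) and every
`k` (exponent of `t`), the corresponding coefficients in `ℚ(α)[p]` agree.  Here
`B_∞^{(α)}(t,p,u) = ∑_{n≥1} (t^n/n) B_n^{(α)}(p,u)`, the coefficient of `u^ℓ t^n` of
`B_∞^{(α)}(-t,·,u)` being the operator `((-1)^n/n) ⬝ Bc n ℓ` with matrix `Bmat n ℓ`. -/
theorem statement0
    (J : JPartition → SymA) (hJ : IsJackFamily J)
    (g : JPartition → JPartition → JPartition → F) (hg : IsStructCoeffs J g)
    (mu nu : JPartition) (ℓ k : ℕ) :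
    (∑ n ∈ Finset.Icc 1 k, ((-1 : F) ^ n / (n : F)) •
        ((∑ᶠ mu' : JPartition, Bmat n ℓ (toExp mu) (toExp mu') • Gcoef g mu' nu (k - n))
          + ∑ᶠ nu' : JPartition, Bmat n ℓ (toExp nu) (toExp nu') • Gcoef g mu nu' (k - n)))
    = ∑ n ∈ Finset.Icc 1 k, ((-1 : F) ^ n / (n : F)) • Bperp n ℓ (Gcoef g mu nu (k - n)) := by
  exact JK.final hJ hg mu nu ℓ k

end
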